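/- The half-perimeter generating function T(x) = Σ_{n≥0} t_n x^n of three-choice polygons is differentiably finite (D-finite): there exist an integer m ≥ 0 and polynomials P_0(x), …, P_m(x) with rational coefficients, not all zero, such that Σ_{k=0}^m P_k(x)·T^{(k)}(x) = 0 as formal power series, where T^{(k)} denotes the k-th formal derivative of T. -/

import Mathlib

/-- A directed lattice path of `n` steps: each step is a unit step east or north. -/
def IsDirectedPath (n : ℕ) (p : Fin (n + 1) → ℤ × ℤ) : Prop :=
  ∀ i : Fin n, p i.succ - p i.castSucc = (1, 0) ∨ p i.succ - p i.castSucc = (0, 1)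

/-- `p, q` form a staircase polygon of half-perimeter `n`: two distinct directed paths of
`n` steps, both starting at the origin, ending at the same point, and sharing no
vertices other than their common start and end. -/
def IsStaircasePair (n : ℕ) (p q : Fin (n + 1) → ℤ × ℤ) : Prop :=
  IsDirectedPath n p ∧ IsDirectedPath n q ∧
  p 0 = (0, 0) ∧ q 0 = (0, 0) ∧ p ≠ q ∧
  p (Fin.last n) = q (Fin.last n) ∧
  ∀ i j : Fin (n + 1), p i = q j →
    (i = 0 ∧ j = 0) ∨ (i = Fin.last n ∧ j = Fin.last n)

/-- The number of staircase polygons of half-perimeter `n`, counted as unordered pairs. -/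
noncomputable def staircaseCount (n : ℕ) : ℕ :=
  Nat.card {s : Sym2 (Fin (n + 1) → ℤ × ℤ) //
    ∃ p q, s = s(p, q) ∧ IsStaircasePair n p q}

/-- The `i`-th step of a walk. -/
def walkStep (n : ℕ) (w : Fin (n + 1) → ℤ × ℤ) (i : Fin n) : ℤ × ℤ :=
  w i.succ - w i.castSucc

/-- The three-choice condition: a step immediately following an east step is east or
north, and a step immediately following a west step is west or south. -/
def ThreeChoiceCond (n : ℕ) (w : Fin (n + 1) → ℤ × ℤ) : Prop :=
  ∀ i j : Fin n, (j : ℕ) = (i : ℕ) + 1 →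
    (walkStep n w i = (1, 0) → walkStep n w j = (1, 0) ∨ walkStep n w j = (0, 1)) ∧
    (walkStep n w i = (-1, 0) → walkStep n w j = (-1, 0) ∨ walkStep n w j = (0, -1))

/-- A three-choice walk of `n` steps: a self-avoiding walk on `ℤ²` starting at the
origin with unit steps, satisfying the three-choice condition. -/
def IsThreeChoiceWalk (n : ℕ) (w : Fin (n + 1) → ℤ × ℤ) : Prop :=
  w 0 = (0, 0) ∧
  (∀ i : Fin n, walkStep n w i ∈ ({(1, 0), (-1, 0), (0, 1), (0, -1)} : Set (ℤ × ℤ))) ∧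
  Function.Injective w ∧
  ThreeChoiceCond n w

/-- The number of three-choice walks of `n` steps. -/
noncomputable def threeChoiceWalkCount (n : ℕ) : ℕ :=
  Nat.card {w : Fin (n + 1) → ℤ × ℤ // IsThreeChoiceWalk n w}

/-- A three-choice polygon of perimeter `2n`: a three-choice walk of `2n` steps ending at
the origin, visiting no vertex twice except that its first vertex equals its last. -/
def IsThreeChoicePolygon (n : ℕ) (w : Fin (2 * n + 1) → ℤ × ℤ) : Prop :=
  w 0 = (0, 0) ∧ w (Fin.last (2 * n)) = (0, 0) ∧
  (∀ i : Fin (2 * n),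
    walkStep (2 * n) w i ∈ ({(1, 0), (-1, 0), (0, 1), (0, -1)} : Set (ℤ × ℤ))) ∧
  (∀ i j : Fin (2 * n), w i.castSucc = w j.castSucc → i = j) ∧
  ThreeChoiceCond (2 * n) w

/-- The number of three-choice polygons of perimeter `2n`. -/
noncomputable def threeChoicePolygonCount (n : ℕ) : ℕ :=
  Nat.card {w : Fin (2 * n + 1) → ℤ × ℤ // IsThreeChoicePolygon n w}

/-- The set of lattice edges traversed by a path of `n` steps. -/
def pathEdges (n : ℕ) (p : Fin (n + 1) → ℤ × ℤ) : Set (Sym2 (ℤ × ℤ)) :=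
  {e | ∃ i : Fin n, e = s(p i.castSucc, p i.succ)}

/-- The edge set of a three-choice polygon of perimeter `2n`. -/
def polygonEdges (n : ℕ) (w : Fin (2 * n + 1) → ℤ × ℤ) : Set (Sym2 (ℤ × ℤ)) :=
  {e | ∃ i : Fin (2 * n), e = s(w i.castSucc, w i.succ)}

/-- Translation of a set of lattice edges by the vector `v`. -/
def translateEdges (v : ℤ × ℤ) (E : Set (Sym2 (ℤ × ℤ))) : Set (Sym2 (ℤ × ℤ)) :=
  (Sym2.map (· + v)) '' E

/-- `E` is the edge set of some staircase polygon. -/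
def IsStaircaseEdgeSet (E : Set (Sym2 (ℤ × ℤ))) : Prop :=
  ∃ (n : ℕ) (p q : Fin (n + 1) → ℤ × ℤ),
    IsStaircasePair n p q ∧ E = pathEdges n p ∪ pathEdges n q

/-- `E` is a translate of the edge set of some staircase polygon. -/
def IsStaircaseTranslate (E : Set (Sym2 (ℤ × ℤ))) : Prop :=
  ∃ (v : ℤ × ℤ) (F : Set (Sym2 (ℤ × ℤ))), IsStaircaseEdgeSet F ∧ E = translateEdges v F

/-- Two edge sets are translation-equivalent. -/
def TransEquiv (E F : Set (Sym2 (ℤ × ℤ))) : Prop :=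
  ∃ v : ℤ × ℤ, F = translateEdges v E

/-- The number of imperfect staircase polygons of perimeter `2n`: translation-equivalence
classes of edge sets of three-choice polygons of perimeter `2n` that are not translates of
the edge set of any staircase polygon. -/
noncomputable def imperfectCount (n : ℕ) : ℕ :=
  Nat.card {C : Set (Set (Sym2 (ℤ × ℤ))) //
    ∃ w : Fin (2 * n + 1) → ℤ × ℤ, IsThreeChoicePolygon n w ∧
      ¬ IsStaircaseTranslate (polygonEdges n w) ∧
      C = {F | TransEquiv (polygonEdges n w) F}}

/-- The half-perimeter generating function `T(x) = Σ_{n≥0} t_n x^n` of three-choice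
polygons, as a formal power series over `ℚ`. -/
noncomputable def Tgf : PowerSeries ℚ :=
  PowerSeries.mk fun n => (threeChoicePolygonCount n : ℚ)

namespace ThreeChoice

/-- Laurent polynomials in three variables. -/
abbrev Laurent : Type := AddMonoidAlgebra ℚ (Fin 3 → ℤ)

/-- The monomial with exponent `e`. -/
noncomputable def zpw (e : Fin 3 → ℤ) : Laurent := AddMonoidAlgebra.single e 1

theorem zpw_add (e f : Fin 3 → ℤ) : zpw (e + f) = zpw e * zpw f := by
  simp [zpw, AddMonoidAlgebra.single_mul_single]

theorem zpw_zero : zpw 0 = 1 := rfl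

theorem Laurent.induction {p : Laurent → Prop} (h0 : p 0) (hadd : ∀ f g, p f → p g → p (f + g))
    (hz : ∀ e (q : ℚ), p (q • zpw e)) (f : Laurent) : p f := by
  refine AddMonoidAlgebra.induction_linear f h0 hadd fun e q => ?_
  have := hz e q
  simpa [zpw] using this

theorem Laurent.hom_ext {M : Type*} [AddCommGroup M] [Module ℚ M] {φ ψ : Laurent →ₗ[ℚ] M}
    (h : ∀ e, φ (zpw e) = ψ (zpw e)) : φ = ψ := by
  refine LinearMap.ext fun f => ?_
  induction f using Laurent.induction with
  | h0 => simp
  | hadd f g hf hg => simp [hf, hg]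
  | hz e q => simp [h]

/-- The linear map sending each monomial `z ^ e` to `b e`. -/
noncomputable def ofMon {M : Type*} [AddCommGroup M] [Module ℚ M] (b : (Fin 3 → ℤ) → M) :
    Laurent →ₗ[ℚ] M :=
  (Finsupp.lift M ℚ (Fin 3 → ℤ) b).comp (AddMonoidAlgebra.coeffLinearEquiv ℚ).toLinearMap

theorem ofMon_zpw {M : Type*} [AddCommGroup M] [Module ℚ M] (b : (Fin 3 → ℤ) → M) (e) :
    ofMon b (zpw e) = b e := by
  simp [ofMon, zpw]

/-- The derivation with respect to the `i`-th variable. -/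
noncomputable def pd (i : Fin 3) : Derivation ℚ Laurent Laurent :=
  Derivation.mk' (ofMon fun e => (e i : ℚ) • zpw (e - Pi.single i 1)) (by
    intro f g
    induction f using Laurent.induction with
    | h0 => simp
    | hadd f f' hf hf' => simp only [add_mul, map_add, smul_eq_mul, hf, hf', mul_add]; ring
    | hz e q =>
    induction g using Laurent.induction with
    | h0 => simp
    | hadd f f' hf hf' => simp only [add_mul, map_add, smul_eq_mul, hf, hf', mul_add]; ring
    | hz e' q' =>
    simp only [map_smul, smul_mul_assoc, mul_smul_comm, ofMon_zpw, ← zpw_add, smul_eq_mul]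
    rw [show e + (e' - Pi.single i 1) = e + e' - Pi.single i 1 by abel,
      show e' + (e - Pi.single i 1) = e + e' - Pi.single i 1 by abel]
    simp only [smul_smul, ← add_smul]
    congr 1
    push_cast [Pi.add_apply]
    ring)

theorem pd_zpw (i : Fin 3) (e) : pd i (zpw e) = (e i : ℚ) • zpw (e - Pi.single i 1) :=
  ofMon_zpw _ _

/-- The residue: the coefficient of `(z₀ z₁ z₂)⁻¹`. -/
noncomputable def res : Laurent →ₗ[ℚ] ℚ := ofMon fun e => if e = -1 then 1 else 0

theorem res_zpw (e) : res (zpw e) = if e = -1 then 1 else 0 := ofMon_zpw _ _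

theorem pd_iterate_zpw (i : Fin 3) (n : ℕ) (e) : (pd i)^[n] (zpw e) =
    (∏ j ∈ Finset.range n, ((e i : ℚ) - j)) • zpw (e - Pi.single i (n : ℤ)) := by
  induction n with
  | zero => simp
  | succ n ih =>
    rw [Function.iterate_succ_apply', ih, Derivation.map_smul, pd_zpw, smul_smul,
      Finset.prod_range_succ, sub_sub, ← Pi.single_add]
    simp

/-- Iterated partial derivatives. -/
noncomputable def pds (c : Fin 3 → ℕ) : Laurent →ₗ[ℚ] Laurent :=
  (pd 0 : Laurent →ₗ[ℚ] Laurent) ^ c 0 * (pd 1 : Laurent →ₗ[ℚ] Laurent) ^ c 1 *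
    (pd 2 : Laurent →ₗ[ℚ] Laurent) ^ c 2

theorem pds_zpw (c : Fin 3 → ℕ) (e) : pds c (zpw e) =
    (∏ i, ∏ j ∈ Finset.range (c i), ((e i : ℚ) - j)) • zpw (e - fun i => (c i : ℤ)) := by
  have h (i : Fin 3) (n : ℕ) (f : Laurent) :
      ((pd i : Laurent →ₗ[ℚ] Laurent) ^ n) f = (pd i)^[n] f := by
    rw [Module.End.pow_apply]; rfl
  have h' (i : Fin 3) (n : ℕ) (e) : ((pd i : Laurent →ₗ[ℚ] Laurent) ^ n) (zpw e) =
    (∏ j ∈ Finset.range n, ((e i : ℚ) - j)) • zpw (e - Pi.single i (n : ℤ)) := by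
    rw [h, pd_iterate_zpw]
  rw [pds, Module.End.mul_apply, Module.End.mul_apply, h', map_smul, h', map_smul, map_smul, h',
    smul_smul, smul_smul, Fin.prod_univ_three]
  congr 1
  · simp; ring
  · congr 1
    ext i
    fin_cases i <;> simp

theorem res_mul_pds_of_lt {c c' : Fin 3 → ℕ} {i : Fin 3} (h : c i < c' i) (f : Laurent) :
    res (zpw (fun i => (c i : ℤ)) * pds c' f) = 0 := by
  have : (res ∘ₗ LinearMap.mulLeft ℚ (zpw (fun i => (c i : ℤ))) ∘ₗ pds c') = 0 := by
    refine Laurent.hom_ext fun e => ?_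
    simp only [LinearMap.comp_apply, LinearMap.mulLeft_apply, pds_zpw, map_smul,
      ← zpw_add, res_zpw, LinearMap.zero_apply]
    split_ifs with he
    · have := congrFun he i
      simp only [Pi.add_apply, Pi.sub_apply, Pi.neg_apply, Pi.one_apply] at this
      rw [Finset.prod_eq_zero (Finset.mem_univ i), zero_smul]
      refine Finset.prod_eq_zero (i := c' i - c i - 1) (by simp; omega) ?_
      have h2 : e i = ((c' i - c i - 1 : ℕ) : ℤ) := by omega
      rw [h2]; simp
    · simp
  exact DFunLike.congr_fun this f

theorem res_mul_pds_self (c : Fin 3 → ℕ) : ∃ q : ℚ, q ≠ 0 ∧ ∀ f : Laurent,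
    res (zpw (fun i => (c i : ℤ)) * pds c f) = q * res f := by
  refine ⟨∏ i, ∏ j ∈ Finset.range (c i), ((-1 : ℚ) - j), ?_, fun f => ?_⟩
  · simp only [Finset.prod_ne_zero_iff]
    intro i _ j _
    have : (0 : ℚ) ≤ j := by positivity
    intro h; linarith
  · have : (res ∘ₗ LinearMap.mulLeft ℚ (zpw (fun i => (c i : ℤ))) ∘ₗ pds c) =
        (∏ i, ∏ j ∈ Finset.range (c i), ((-1 : ℚ) - j)) • res := by
      refine Laurent.hom_ext fun e => ?_
      simp only [LinearMap.comp_apply, LinearMap.mulLeft_apply, pds_zpw, map_smul,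
        ← zpw_add, res_zpw, LinearMap.smul_apply, add_sub_cancel]
      split_ifs with he
      · simp [he]
      · simp
    exact DFunLike.congr_fun this f
end ThreeChoice

namespace ThreeChoice
open PowerSeries

/-- Power series with Laurent polynomial coefficients. -/
abbrev LSeries : Type := PowerSeries Laurent

theorem coeff_qsmul {S : Type*} [CommRing S] [Algebra ℚ S] (q : ℚ) (f : PowerSeries S) (n : ℕ) :
    coeff n (q • f) = q • coeff n f := rfl

/-- Coefficientwise application of a linear map. -/
noncomputable def lmap {S : Type*} [CommRing S] [Algebra ℚ S] (φ : Laurent →ₗ[ℚ] S) :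
    LSeries →ₗ[ℚ] PowerSeries S where
  toFun f := PowerSeries.mk fun n => φ (coeff n f)
  map_add' f g := by ext n; simp
  map_smul' q f := by
    ext n
    rw [coeff_mk, coeff_qsmul, map_smul, RingHom.id_apply, coeff_qsmul, coeff_mk]

section
variable {S : Type*} [CommRing S] [Algebra ℚ S]

@[simp] theorem coeff_lmap (φ : Laurent →ₗ[ℚ] S) (f : LSeries) (n : ℕ) :
    coeff n (lmap φ f) = φ (coeff n f) := by
  simp [lmap]

theorem lmap_derivative (φ : Laurent →ₗ[ℚ] S) (f : LSeries) :
    lmap φ (d⁄dX Laurent f) = d⁄dX S (lmap φ f) := by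
  ext n
  rw [coeff_lmap, coeff_derivative, coeff_derivative, coeff_lmap]
  have : (coeff (n + 1) f) * ((n : Laurent) + 1) = ((n : ℚ) + 1) • coeff (n + 1) f := by
    rw [Algebra.smul_def, map_add, map_natCast, map_one, mul_comm]
  rw [this, map_smul, Algebra.smul_def]
  simp; ring

theorem lmap_X_mul (φ : Laurent →ₗ[ℚ] S) (f : LSeries) :
    lmap φ (X * f) = X * lmap φ f := by
  ext n
  rw [coeff_lmap]
  cases n with
  | zero => simp
  | succ n => simp [coeff_succ_X_mul]

/-- The inclusion of the coefficient series. -/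
noncomputable def emb : PowerSeries ℚ →+* LSeries := PowerSeries.map (algebraMap ℚ Laurent)

theorem coeff_emb (d : PowerSeries ℚ) (n : ℕ) :
    coeff n (emb d) = algebraMap ℚ Laurent (coeff n d) := by simp [emb]

theorem lmap_emb_mul (φ : Laurent →ₗ[ℚ] S) (d : PowerSeries ℚ) (f : LSeries) :
    lmap φ (emb d * f) = PowerSeries.map (algebraMap ℚ S) d * lmap φ f := by
  ext n
  rw [coeff_lmap, coeff_mul, coeff_mul, map_sum]
  refine Finset.sum_congr rfl fun p _ => ?_
  rw [coeff_emb, ← Algebra.smul_def, map_smul, Algebra.smul_def]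
  simp
end

theorem lmap_X_pow_dvd {S : Type*} [CommRing S] [Algebra ℚ S] (φ : Laurent →ₗ[ℚ] S) (N : ℕ)
    {f : LSeries} (h : X ^ N ∣ f) : X ^ N ∣ lmap φ f := by
  rw [X_pow_dvd_iff] at h ⊢
  intro m hm
  rw [coeff_lmap, h m hm, map_zero]

/-- The residue, coefficientwise. -/
noncomputable def CTR : LSeries →ₗ[ℚ] PowerSeries ℚ := lmap res

/-- The monomial `z ^ e` as a series. -/
noncomputable def zs (e : Fin 3 → ℤ) : LSeries := C (zpw e)

theorem zs_add (e f : Fin 3 → ℤ) : zs (e + f) = zs e * zs f := by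
  simp [zs, zpw_add]

theorem zs_zero : zs 0 = 1 := by simp [zs, zpw_zero]

/-- Coefficientwise partial derivatives. -/
noncomputable def Pd (i : Fin 3) : Derivation ℚ LSeries LSeries :=
  Derivation.mk' (lmap (pd i : Laurent →ₗ[ℚ] Laurent)) (by
    intro f g
    ext n : 1
    simp only [coeff_lmap, smul_eq_mul, map_add, coeff_mul, map_sum, Derivation.coeFn_coe,
      Derivation.leibniz, Finset.sum_add_distrib]
    congr 1
    rw [← Finset.Nat.sum_antidiagonal_swap]
    simp only [Prod.fst_swap, Prod.snd_swap])

theorem coeff_Pd (i : Fin 3) (f : LSeries) (n : ℕ) : coeff n (Pd i f) = pd i (coeff n f) := by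
  simp [Pd]

theorem Pd_emb (i : Fin 3) (d : PowerSeries ℚ) : Pd i (emb d) = 0 := by
  ext n : 1
  rw [coeff_Pd, coeff_emb, Derivation.map_algebraMap, map_zero]

theorem Pd_zs (i : Fin 3) (e) : Pd i (zs e) = (e i : ℚ) • zs (e - Pi.single i 1) := by
  ext n : 1
  rw [coeff_Pd, coeff_qsmul]
  simp only [zs, coeff_C]
  split_ifs
  · rw [pd_zpw]
  · simp

theorem deriv_emb (d : PowerSeries ℚ) : d⁄dX Laurent (emb d) = emb (d⁄dX ℚ d) := by
  ext n : 1
  rw [coeff_derivative, coeff_emb, coeff_emb, coeff_derivative, map_mul, map_add,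
    map_natCast, map_one]

theorem deriv_zs (e) : d⁄dX Laurent (zs e) = 0 := by simp [zs]

/-- Iterated coefficientwise partial derivatives. -/
noncomputable def Pds (c : Fin 3 → ℕ) : LSeries →ₗ[ℚ] LSeries :=
  (Pd 0 : LSeries →ₗ[ℚ] LSeries) ^ c 0 * (Pd 1 : LSeries →ₗ[ℚ] LSeries) ^ c 1 *
    (Pd 2 : LSeries →ₗ[ℚ] LSeries) ^ c 2

theorem coeff_Pds (c : Fin 3 → ℕ) (f : LSeries) (n : ℕ) :
    coeff n (Pds c f) = pds c (coeff n f) := by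
  have h (i : Fin 3) (k n : ℕ) (f : LSeries) :
      coeff n (((Pd i : LSeries →ₗ[ℚ] LSeries) ^ k) f) =
        ((pd i : Laurent →ₗ[ℚ] Laurent) ^ k) (coeff n f) := by
    induction k generalizing f with
    | zero => simp
    | succ k ih => rw [pow_succ, Module.End.mul_apply, ih, pow_succ, Module.End.mul_apply]
                   simp [coeff_Pd]
  simp only [Pds, pds, Module.End.mul_apply, h]

theorem CTR_mul_Pds_of_lt {c c' : Fin 3 → ℕ} {i : Fin 3} (h : c i < c' i) (f : LSeries) :
    CTR (zs (fun i => (c i : ℤ)) * Pds c' f) = 0 := by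
  ext n
  simp only [CTR, coeff_lmap, zs, coeff_C_mul, coeff_Pds, res_mul_pds_of_lt h, map_zero]

theorem CTR_mul_Pds_self (c : Fin 3 → ℕ) : ∃ q : ℚ, q ≠ 0 ∧ ∀ f : LSeries,
    CTR (zs (fun i => (c i : ℤ)) * Pds c f) = q • CTR f := by
  obtain ⟨q, hq, h⟩ := res_mul_pds_self c
  refine ⟨q, hq, fun f => ?_⟩
  ext n
  simp only [CTR, coeff_lmap, zs, coeff_C_mul, coeff_Pds, h, map_smul, smul_eq_mul]

end ThreeChoice

namespace ThreeChoice
open PowerSeries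

/-- The Catalan series without its constant term. -/
noncomputable def uS : PowerSeries ℚ := PowerSeries.map (Nat.castRingHom ℚ) catalanSeries - 1

theorem uS_eq : uS = X * (1 + uS) ^ 2 := by
  have h := congrArg (PowerSeries.map (Nat.castRingHom ℚ)) catalanSeries_sq_mul_X_add_one
  simp only [map_add, map_mul, map_pow, map_one, PowerSeries.map_X] at h
  rw [uS, add_sub_cancel, sub_eq_iff_eq_add]
  linear_combination -h

theorem constantCoeff_uS : constantCoeff uS = 0 := by
  rw [uS_eq]; simp

theorem uS_deriv : (1 - uS) * d⁄dX ℚ uS = (1 + uS) ^ 3 := by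
  have h : d⁄dX ℚ uS = d⁄dX ℚ (X * (1 + uS) ^ 2) := congrArg _ uS_eq
  rw [Derivation.leibniz, Derivation.leibniz_pow, map_add, Derivation.map_one_eq_zero] at h
  simp only [smul_eq_mul, derivative_X] at h
  have e := uS_eq
  generalize d⁄dX ℚ uS = v at *
  generalize uS = u at *
  simp at h
  linear_combination (1 + u) * h - 2 * v * e

/-- The Catalan parameter among series with Laurent polynomial coefficients. -/
noncomputable def U : LSeries := emb uS

theorem emb_X : emb X = X := by simp [emb]

theorem U_eq : U = X * (1 + U) ^ 2 := by
  have := congrArg emb uS_eq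
  simpa [emb_X, U] using this

/-- Differentiation with respect to the main variable, as a `ℚ`-derivation. -/
noncomputable def Dx : Derivation ℚ LSeries LSeries := (d⁄dX Laurent).restrictScalars ℚ

theorem Dx_apply (f : LSeries) : Dx f = d⁄dX Laurent f := rfl

theorem U_deriv : (1 - U) * Dx U = (1 + U) ^ 3 := by
  have := congrArg emb uS_deriv
  rw [map_mul, ← deriv_emb] at this
  simpa [U, Dx_apply] using this

theorem isUnit_one_add_U : IsUnit (1 + U) := by
  rw [PowerSeries.isUnit_iff_constantCoeff]
  rw [← coeff_zero_eq_constantCoeff_apply, map_add, U, coeff_emb]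
  simp [constantCoeff_uS]

theorem isUnit_one_sub_U : IsUnit (1 - U) := by
  rw [PowerSeries.isUnit_iff_constantCoeff]
  rw [← coeff_zero_eq_constantCoeff_apply, map_sub, U, coeff_emb]
  simp [constantCoeff_uS]

/-- The exponents allowed in `Pol N`. -/
noncomputable def box (N : ℕ) : Finset (ℕ × (Fin 3 → ℤ)) :=
  Finset.range (N + 1) ×ˢ Fintype.piFinset fun _ => Finset.Icc (-(N : ℤ)) N

theorem mem_box {N : ℕ} {p : ℕ × (Fin 3 → ℤ)} :
    p ∈ box N ↔ p.1 ≤ N ∧ ∀ i, |p.2 i| ≤ N := by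
  simp [box, abs_le]

theorem card_box (N : ℕ) : (box N).card = (N + 1) * (2 * N + 1) ^ 3 := by
  rw [box, Finset.card_product, Fintype.card_piFinset]
  simp only [Finset.card_range, Int.card_Icc, Finset.prod_const, Finset.card_univ, Fintype.card_fin]
  congr 2
  omega

/-- Polynomials in `U` and Laurent polynomials in `z`, with degree bounded by `N`. -/
noncomputable def Pol (N : ℕ) : Submodule ℚ LSeries :=
  Submodule.span ℚ ((fun p : ℕ × (Fin 3 → ℤ) => U ^ p.1 * zs p.2) '' (box N : Set _))

theorem monomial_mem_Pol {N a : ℕ} {e : Fin 3 → ℤ} (ha : a ≤ N) (he : ∀ i, |e i| ≤ N) :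
    U ^ a * zs e ∈ Pol N :=
  Submodule.subset_span ⟨(a, e), mem_box.2 ⟨ha, he⟩, rfl⟩

theorem Pol_induction {N : ℕ} {p : LSeries → Prop} (h0 : p 0)
    (hadd : ∀ f g, p f → p g → p (f + g)) (hsmul : ∀ (q : ℚ) f, p f → p (q • f))
    (hm : ∀ a e, a ≤ N → (∀ i : Fin 3, |e i| ≤ (N : ℤ)) → p (U ^ a * zs e)) {f : LSeries}
    (hf : f ∈ Pol N) : p f := by
  induction hf using Submodule.span_induction with
  | mem x hx =>
    obtain ⟨⟨a, e⟩, h, rfl⟩ := hx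
    have := mem_box.1 h
    exact hm _ _ this.1 this.2
  | zero => exact h0
  | add x y _ _ hx hy => exact hadd _ _ hx hy
  | smul q x _ hx => exact hsmul _ _ hx

theorem Pol_mono {M N : ℕ} (h : M ≤ N) : Pol M ≤ Pol N := by
  refine Submodule.span_mono (Set.image_mono fun p hp => ?_)
  have := mem_box.1 hp
  exact mem_box.2 ⟨this.1.trans h, fun i => (this.2 i).trans (by exact_mod_cast h)⟩

theorem Pol_mul {M N : ℕ} {f g : LSeries} (hf : f ∈ Pol M) (hg : g ∈ Pol N) :
    f * g ∈ Pol (M + N) := by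
  refine Pol_induction (p := fun f => f * g ∈ Pol (M + N)) (by simp) (fun a b ha hb => ?_)
    (fun q a ha => ?_) (fun a e ha he => ?_) hf
  · simpa only [add_mul] using add_mem ha hb
  · simpa only [smul_mul_assoc] using Submodule.smul_mem _ q ha
  refine Pol_induction (p := fun g => _ * g ∈ Pol (M + N)) (by simp) (fun a b ha hb => ?_)
    (fun q a ha => ?_) (fun b e' hb he' => ?_) hg
  · simpa only [mul_add] using add_mem ha hb
  · simpa only [mul_smul_comm] using Submodule.smul_mem _ q ha
  have : U ^ a * zs e * (U ^ b * zs e') = U ^ (a + b) * zs (e + e') := by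
    rw [zs_add]; ring
  rw [this]
  refine monomial_mem_Pol (by omega) fun i => ?_
  have := abs_add_le (e i) (e' i)
  have h1 := he i
  have h2 := he' i
  push_cast
  simp only [Pi.add_apply]
  omega

theorem Pol_Pd {N : ℕ} (i : Fin 3) {f : LSeries} (hf : f ∈ Pol N) : Pd i f ∈ Pol (N + 1) := by
  refine Pol_induction (p := fun f => Pd i f ∈ Pol (N + 1)) (by rw [map_zero]; exact zero_mem _)
    (fun a b ha hb => ?_) (fun q a ha => ?_) (fun a e ha he => ?_) hf
  · rw [map_add]; exact add_mem ha hb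
  · rw [Derivation.map_smul]; exact Submodule.smul_mem _ q ha
  rw [Derivation.leibniz, Derivation.leibniz_pow, U, Pd_emb, ← U, Pd_zs]
  rw [smul_zero, smul_zero, smul_zero, add_zero, smul_comm, smul_eq_mul]
  refine Submodule.smul_mem _ _ (monomial_mem_Pol (by omega) fun j => ?_)
  have := abs_sub (e j) (Pi.single (M := fun _ => ℤ) i 1 j)
  have h1 := he j
  have h2 : |(Pi.single (M := fun _ => ℤ) i 1 j)| ≤ 1 := by
    rcases eq_or_ne j i with rfl | h <;> simp [*]
  push_cast
  simp only [Pi.sub_apply]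
  omega

theorem Pol_Dx {N d : ℕ} {Q f : LSeries} (hQ : Q * Dx U ∈ Pol d) (hf : f ∈ Pol N) :
    Q * Dx f ∈ Pol (N + d) := by
  refine Pol_induction (p := fun f => Q * Dx f ∈ Pol (N + d))
    (by rw [map_zero, mul_zero]; exact zero_mem _) (fun a b ha hb => ?_)
    (fun q a ha => ?_) (fun a e ha he => ?_) hf
  · simpa only [map_add, mul_add] using add_mem ha hb
  · simpa only [Derivation.map_smul, mul_smul_comm] using Submodule.smul_mem _ q ha
  rw [Derivation.leibniz, Derivation.leibniz_pow, Dx_apply (zs e), deriv_zs]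
  have : Q * (U ^ a • (0 : LSeries) + zs e • a • U ^ (a - 1) • Dx U) =
      a • ((U ^ (a - 1) * zs e) * (Q * Dx U)) := by
    simp only [smul_eq_mul, nsmul_eq_mul]; ring
  rw [this]
  exact nsmul_mem (Pol_mul (monomial_mem_Pol (by omega) he) hQ) _

theorem one_mem_Pol (N : ℕ) : (1 : LSeries) ∈ Pol N := by
  have := monomial_mem_Pol (N := N) (a := 0) (e := 0) (by omega) (by simp)
  simpa [zs_zero] using this

theorem U_mem_Pol : U ∈ Pol 1 := by
  have := monomial_mem_Pol (N := 1) (a := 1) (e := 0) le_rfl (by simp)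
  simpa [zs_zero] using this

theorem zs_mem_Pol (e : Fin 3 → ℤ) : ∃ N, zs e ∈ Pol N := by
  refine ⟨∑ i, (e i).natAbs, ?_⟩
  have := monomial_mem_Pol (N := ∑ i, (e i).natAbs) (a := 0) (e := e) (by omega) (fun i => by
    rw [Int.abs_eq_natAbs]
    exact_mod_cast Finset.single_le_sum (f := fun i => (e i).natAbs) (by simp)
      (Finset.mem_univ i))
  simpa using this

instance (N : ℕ) : Module.Finite ℚ (Pol N) :=
  Module.Finite.span_of_finite ℚ ((Finset.finite_toSet _).image _)

theorem finrank_Pol_le (N : ℕ) : Module.finrank ℚ (Pol N) ≤ (N + 1) * (2 * N + 1) ^ 3 := by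
  classical
  rw [Pol, ← Finset.coe_image]
  exact (finrank_span_finset_le_card _).trans (Finset.card_image_le.trans (card_box N).le)

/-- Polynomials in `U` and Laurent polynomials in `z`. -/
def IsPol (f : LSeries) : Prop := ∃ N, f ∈ Pol N

/-- Quotients of polynomials by invertible polynomials. -/
def IsRat (f : LSeries) : Prop := ∃ W, IsPol W ∧ IsUnit W ∧ IsPol (W * f)

theorem IsPol.add {f g : LSeries} (hf : IsPol f) (hg : IsPol g) : IsPol (f + g) := by
  obtain ⟨a, ha⟩ := hf
  obtain ⟨b, hb⟩ := hg
  exact ⟨max a b, add_mem (Pol_mono (le_max_left _ _) ha) (Pol_mono (le_max_right _ _) hb)⟩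

theorem IsPol.mul {f g : LSeries} (hf : IsPol f) (hg : IsPol g) : IsPol (f * g) := by
  obtain ⟨a, ha⟩ := hf
  obtain ⟨b, hb⟩ := hg
  exact ⟨_, Pol_mul ha hb⟩

theorem IsPol.one : IsPol 1 := ⟨0, one_mem_Pol 0⟩
theorem isPol_U : IsPol U := ⟨1, U_mem_Pol⟩
theorem isPol_zs (e) : IsPol (zs e) := zs_mem_Pol e

theorem IsPol.smul (q : ℚ) {f : LSeries} (hf : IsPol f) : IsPol (q • f) := by
  obtain ⟨a, ha⟩ := hf
  exact ⟨a, Submodule.smul_mem _ _ ha⟩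

theorem IsPol.neg {f : LSeries} (hf : IsPol f) : IsPol (-f) := by
  obtain ⟨a, ha⟩ := hf
  exact ⟨a, neg_mem ha⟩

theorem IsPol.sub {f g : LSeries} (hf : IsPol f) (hg : IsPol g) : IsPol (f - g) := by
  rw [sub_eq_add_neg]; exact hf.add hg.neg

theorem IsPol.pow {f : LSeries} (hf : IsPol f) (n : ℕ) : IsPol (f ^ n) := by
  induction n with
  | zero => simpa using IsPol.one
  | succ n ih => rw [pow_succ]; exact ih.mul hf

theorem IsPol.isRat {f : LSeries} (hf : IsPol f) : IsRat f :=
  ⟨1, IsPol.one, isUnit_one, by simpa using hf⟩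

theorem IsRat.add {f g : LSeries} (hf : IsRat f) (hg : IsRat g) : IsRat (f + g) := by
  obtain ⟨V, hV, uV, pV⟩ := hf
  obtain ⟨W, hW, uW, pW⟩ := hg
  refine ⟨V * W, hV.mul hW, uV.mul uW, ?_⟩
  have : V * W * (f + g) = W * (V * f) + V * (W * g) := by ring
  rw [this]
  exact (hW.mul pV).add (hV.mul pW)

theorem IsRat.mul {f g : LSeries} (hf : IsRat f) (hg : IsRat g) : IsRat (f * g) := by
  obtain ⟨V, hV, uV, pV⟩ := hf
  obtain ⟨W, hW, uW, pW⟩ := hg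
  refine ⟨V * W, hV.mul hW, uV.mul uW, ?_⟩
  have : V * W * (f * g) = (V * f) * (W * g) := by ring
  rw [this]
  exact pV.mul pW

theorem IsRat.pow {f : LSeries} (hf : IsRat f) (n : ℕ) : IsRat (f ^ n) := by
  induction n with
  | zero => simpa using IsPol.one.isRat
  | succ n ih => rw [pow_succ]; exact ih.mul hf

theorem IsRat.neg {f : LSeries} (hf : IsRat f) : IsRat (-f) := by
  obtain ⟨V, hV, uV, pV⟩ := hf
  exact ⟨V, hV, uV, by simpa using pV.neg⟩

theorem IsRat.sub {f g : LSeries} (hf : IsRat f) (hg : IsRat g) : IsRat (f - g) := by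
  rw [sub_eq_add_neg]; exact hf.add hg.neg

theorem IsRat.sum {ι : Type*} (s : Finset ι) {f : ι → LSeries} (h : ∀ i ∈ s, IsRat (f i)) :
    IsRat (∑ i ∈ s, f i) :=
  Finset.sum_induction _ _ (fun _ _ => IsRat.add) (by simpa using (IsPol.one.smul 0).isRat) h

theorem IsRat.of_mul_eq {f g h : LSeries} (hf : IsRat f) (hu : IsUnit f) (hh : IsRat h)
    (e : f * g = h) : IsRat g := by
  obtain ⟨V, hV, uV, pV⟩ := hf
  obtain ⟨W, hW, uW, pW⟩ := hh
  refine ⟨V * f * W, pV.mul hW, (uV.mul hu).mul uW, ?_⟩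
  have : V * f * W * g = V * (W * h) := by rw [← e]; ring
  rw [this]
  exact hV.mul pW

theorem isRat_X : IsRat (X : LSeries) := by
  refine IsRat.of_mul_eq (f := (1 + U) ^ 2) ?_ (isUnit_one_add_U.pow 2) isPol_U.isRat
    (by rw [mul_comm, ← U_eq])
  exact ((IsPol.one.add isPol_U).pow 2).isRat

theorem isRat_Dx_U : IsRat (Dx U) :=
  IsRat.of_mul_eq (IsPol.one.sub isPol_U).isRat isUnit_one_sub_U
    ((IsPol.one.add isPol_U).pow 3).isRat U_deriv
end ThreeChoice

namespace ThreeChoice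
open PowerSeries

/-- The fractions with denominator `W ^ k` and numerator of degree at most `c * k`. -/
noncomputable def frac (W : LSeries) (c k : ℕ) : Submodule ℚ LSeries :=
  (Pol (c * k)).comap (LinearMap.mulLeft ℚ (W ^ k))

theorem mem_frac {W : LSeries} {c k : ℕ} {f : LSeries} :
    f ∈ frac W c k ↔ W ^ k * f ∈ Pol (c * k) := Iff.rfl

theorem finrank_frac {W : LSeries} (hW : IsUnit W) (c k : ℕ) :
    Module.Finite ℚ (frac W c k) ∧
      Module.finrank ℚ (frac W c k) ≤ (c * k + 1) * (2 * (c * k) + 1) ^ 3 := by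
  let φ : frac W c k →ₗ[ℚ] Pol (c * k) :=
    (LinearMap.mulLeft ℚ (W ^ k)).restrict (p := frac W c k) (q := Pol (c * k)) fun f hf => hf
  have hφ : Function.Injective φ := by
    intro f g h
    have := congrArg Subtype.val h
    exact Subtype.ext ((hW.pow k).mul_left_cancel this)
  exact ⟨Module.Finite.of_injective φ hφ,
    (LinearMap.finrank_le_finrank_of_injective hφ).trans (finrank_Pol_le _)⟩

section
variable {W : LSeries} {d : ℕ}

theorem frac_succ (h1 : W ∈ Pol d) {k : ℕ} {f : LSeries} (hf : f ∈ frac W (d + 1) k) :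
    f ∈ frac W (d + 1) (k + 1) := by
  rw [mem_frac] at hf ⊢
  rw [pow_succ', mul_assoc]
  exact Pol_mono (by rw [mul_add]; omega) (Pol_mul h1 hf)

theorem frac_mono (h1 : W ∈ Pol d) {k l : ℕ} (h : k ≤ l) : frac W (d + 1) k ≤ frac W (d + 1) l := by
  induction l, h using Nat.le_induction with
  | base => exact le_rfl
  | succ l _ ih => exact fun f hf => frac_succ h1 (ih hf)

theorem X_mul_mem_frac (hX : W * X ∈ Pol d) {k : ℕ} {f : LSeries} (hf : f ∈ frac W (d + 1) k) :
    X * f ∈ frac W (d + 1) (k + 1) := by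
  rw [mem_frac] at hf ⊢
  have : W ^ (k + 1) * (X * f) = (W * X) * (W ^ k * f) := by ring
  rw [this]
  exact Pol_mono (by rw [mul_add]; omega) (Pol_mul hX hf)

theorem Pd_mem_frac (h1 : W ∈ Pol d) {i : Fin 3} (hi : Pd i W ∈ Pol d) {k : ℕ} {f : LSeries}
    (hf : f ∈ frac W (d + 1) k) : Pd i f ∈ frac W (d + 1) (k + 1) := by
  rw [mem_frac] at hf ⊢
  have h := (Pd i).leibniz (W ^ k) f
  rw [Derivation.leibniz_pow] at h
  have : W ^ (k + 1) * Pd i f = W * Pd i (W ^ k * f) - k • (Pd i W * (W ^ k * f)) := by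
    rw [h]
    cases k with
    | zero => simp
    | succ k =>
      simp only [smul_eq_mul, nsmul_eq_mul, Nat.add_sub_cancel]
      ring
  rw [this]
  refine sub_mem (Pol_mono ?_ (Pol_mul h1 (Pol_Pd i hf))) (nsmul_mem (Pol_mono ?_ (Pol_mul hi hf)) _)
  all_goals rw [mul_add]; omega

theorem Dx_mem_frac (h1 : W ∈ Pol d) (hU : W * Dx U ∈ Pol d) (hx : W * Dx W ∈ Pol d) {k : ℕ} {f : LSeries}
    (hf : f ∈ frac W (d + 1) k) : Dx f ∈ frac W (d + 1) (k + 2) := by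
  rw [mem_frac] at hf ⊢
  have h := Dx.leibniz (W ^ k) f
  rw [Derivation.leibniz_pow] at h
  have : W ^ (k + 2) * Dx f = W * (W * Dx (W ^ k * f)) - k • ((W * Dx W) * (W ^ k * f)) := by
    rw [h]
    cases k with
    | zero => simp; ring
    | succ k =>
      simp only [smul_eq_mul, nsmul_eq_mul, Nat.add_sub_cancel]
      ring
  rw [this]
  refine sub_mem (Pol_mono ?_ (Pol_mul h1 (Pol_Dx hU hf)))
    (nsmul_mem (Pol_mono ?_ (Pol_mul hx hf)) _)
  all_goals rw [mul_add]; omega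

end

theorem isPol_Pd {f : LSeries} (hf : IsPol f) (i : Fin 3) : IsPol (Pd i f) := by
  obtain ⟨a, ha⟩ := hf
  exact ⟨_, Pol_Pd i ha⟩

theorem IsRat.exists_denominator {F : LSeries} (hF : IsRat F) : ∃ (W : LSeries) (d : ℕ),
    IsUnit W ∧ W ∈ Pol d ∧ W * F ∈ Pol d ∧ W * X ∈ Pol d ∧ W * Dx U ∈ Pol d ∧
      W * Dx W ∈ Pol d ∧ ∀ i, Pd i W ∈ Pol d := by
  obtain ⟨V, hV, uV, pV⟩ := hF
  have a1 := IsPol.one.add isPol_U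
  have s1 := IsPol.one.sub isPol_U
  let W := V * (1 + U) ^ 2 * (1 - U)
  have hW : IsPol W := (hV.mul (a1.pow 2)).mul s1
  have hWF : IsPol (W * F) := by
    have : W * F = (1 + U) ^ 2 * (1 - U) * (V * F) := by simp only [W]; ring
    rw [this]
    exact ((a1.pow 2).mul s1).mul pV
  have hWX : IsPol (W * X) := by
    have : W * X = V * (1 - U) * U := by
      conv_rhs => rw [U_eq, ← U_eq]
      simp only [W]; linear_combination (- V * (1 - U)) * U_eq
    rw [this]
    exact (hV.mul s1).mul isPol_U
  have hWU : IsPol (W * Dx U) := by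
    have : W * Dx U = V * (1 + U) ^ 2 * (1 + U) ^ 3 := by rw [← U_deriv]; simp only [W]; ring
    rw [this]
    exact (hV.mul (a1.pow 2)).mul (a1.pow 3)
  have hWW : IsPol (W * Dx W) := by
    obtain ⟨a, ha⟩ := hWU
    obtain ⟨b, hb⟩ := hW
    exact ⟨_, Pol_Dx ha hb⟩
  have uW : IsUnit W := (uV.mul (isUnit_one_add_U.pow 2)).mul isUnit_one_sub_U
  have hP (i) : IsPol (Pd i W) := isPol_Pd hW i
  obtain ⟨d1, h1⟩ := hW
  obtain ⟨d2, h2⟩ := hWF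
  obtain ⟨d3, h3⟩ := hWX
  obtain ⟨d4, h4⟩ := hWU
  obtain ⟨d5, h5⟩ := hWW
  choose d6 h6 using hP
  refine ⟨W, d1 + d2 + d3 + d4 + d5 + ∑ i, d6 i, uW, Pol_mono ?_ h1, Pol_mono ?_ h2,
    Pol_mono ?_ h3, Pol_mono ?_ h4, Pol_mono ?_ h5, fun i => Pol_mono ?_ (h6 i)⟩
  iterate 5 omega
  have := Finset.single_le_sum (f := d6) (fun _ _ => Nat.zero_le _) (Finset.mem_univ i)
  omega

theorem Pds_mem_frac {W F : LSeries} {d : ℕ} (h1 : W ∈ Pol d) (hi : ∀ i, Pd i W ∈ Pol d)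
    (hF : F ∈ frac W (d + 1) 1) (c : Fin 3 → ℕ) :
    Pds c F ∈ frac W (d + 1) (1 + (c 0 + c 1 + c 2)) := by
  have h (i : Fin 3) (n k : ℕ) (f : LSeries) (hf : f ∈ frac W (d + 1) k) :
      ((Pd i : LSeries →ₗ[ℚ] LSeries) ^ n) f ∈ frac W (d + 1) (k + n) := by
    induction n with
    | zero => simpa using hf
    | succ n ih => rw [pow_succ', Module.End.mul_apply]; exact Pd_mem_frac h1 (hi i) ih
  rw [Pds, Module.End.mul_apply, Module.End.mul_apply]
  convert h 0 (c 0) _ _ (h 1 (c 1) _ _ (h 2 (c 2) _ _ hF)) using 2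
  omega

/-- The index set of the monomials `X ^ a * Dx ^ b * Pds c`. -/
abbrev OpIndex (N : ℕ) : Type := Fin (N + 1) × Fin (N + 1) × (Fin 3 → Fin (N + 1))

/-- The result of applying `X ^ a * Dx ^ b * Pds c` to `F`. -/
noncomputable def opApply (F : LSeries) {N : ℕ} (p : OpIndex N) : LSeries :=
  X ^ (p.1 : ℕ) * Dx^[p.2.1] (Pds (fun i => p.2.2 i) F)

theorem opApply_mem_frac {W F : LSeries} {d : ℕ} (h1 : W ∈ Pol d) (hi : ∀ i, Pd i W ∈ Pol d)
    (hX : W * X ∈ Pol d) (hU : W * Dx U ∈ Pol d) (hx : W * Dx W ∈ Pol d)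
    (hF : F ∈ frac W (d + 1) 1) {N : ℕ} (p : OpIndex N) :
    opApply F p ∈ frac W (d + 1) (6 * N + 1) := by
  have hX' (n k : ℕ) (f : LSeries) (hf : f ∈ frac W (d + 1) k) :
      X ^ n * f ∈ frac W (d + 1) (k + n) := by
    induction n with
    | zero => simpa using hf
    | succ n ih => rw [pow_succ', mul_assoc]; exact X_mul_mem_frac hX ih
  have hD (n k : ℕ) (f : LSeries) (hf : f ∈ frac W (d + 1) k) :
      Dx^[n] f ∈ frac W (d + 1) (k + 2 * n) := by
    induction n with
    | zero => simpa using hf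
    | succ n ih => rw [Function.iterate_succ_apply']; exact Dx_mem_frac h1 hU hx ih
  refine frac_mono h1 ?_ (hX' _ _ _ (hD _ _ _ (Pds_mem_frac h1 hi hF _)))
  have := p.1.is_lt
  have := p.2.1.is_lt
  have := (p.2.2 0).is_lt
  have := (p.2.2 1).is_lt
  have := (p.2.2 2).is_lt
  omega

theorem IsRat.exists_relation {F : LSeries} (hF : IsRat F) :
    ∃ (N : ℕ) (g : OpIndex N → ℚ), ∑ p, g p • opApply F p = 0 ∧ ∃ p, g p ≠ 0 := by
  obtain ⟨W, d, uW, h1, h2, hX, hU, hx, hi⟩ := hF.exists_denominator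
  have hF1 : F ∈ frac W (d + 1) 1 := by
    rw [mem_frac, pow_one]; exact Pol_mono (by omega) h2
  let N := 16 * (7 * (d + 1)) ^ 4
  refine ⟨N, ?_⟩
  let v : OpIndex N → frac W (d + 1) (6 * N + 1) :=
    fun p => ⟨opApply F p, opApply_mem_frac h1 hi hX hU hx hF1 p⟩
  have hv : ¬ LinearIndependent ℚ v := by
    intro hv
    obtain ⟨hfin, hrank⟩ := finrank_frac uW (d + 1) (6 * N + 1)
    have hc := hv.fintype_card_le_finrank.trans hrank
    have e : Fintype.card (OpIndex N) = (N + 1) ^ 5 := by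
      simp; ring
    rw [e] at hc
    have hM : (d + 1) * (6 * N + 1) + 1 ≤ 7 * (d + 1) * (N + 1) := by nlinarith
    generalize (d + 1) * (6 * N + 1) = M at hc hM
    have h3 : (M + 1) * (2 * M + 1) ^ 3 ≤ 16 * (M + 1) ^ 4 := by
      calc (M + 1) * (2 * M + 1) ^ 3 ≤ (M + 1) * (2 * (M + 1)) ^ 3 := by gcongr; omega
        _ = 8 * (M + 1) ^ 4 := by ring
        _ ≤ _ := by gcongr; norm_num
    have h4 : 16 * (M + 1) ^ 4 ≤ 16 * (7 * (d + 1) * (N + 1)) ^ 4 := by gcongr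
    have h5 : 16 * (7 * (d + 1) * (N + 1)) ^ 4 = N * (N + 1) ^ 4 := by simp only [N]; ring
    have h6 : N * (N + 1) ^ 4 < (N + 1) ^ 5 := by
      rw [pow_succ' (N + 1) 4]
      exact Nat.mul_lt_mul_of_pos_right (by omega) (by positivity)
    omega
  obtain ⟨g, hg, p, hp⟩ := Fintype.not_linearIndependent_iff.1 hv
  refine ⟨g, ?_, p, hp⟩
  have := congrArg Subtype.val hg
  simpa [v] using this

theorem Dx_iterate_zs_mul (n : ℕ) (e) (f : LSeries) : Dx^[n] (zs e * f) = zs e * Dx^[n] f := by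
  induction n with
  | zero => rfl
  | succ n ih =>
    rw [Function.iterate_succ_apply', ih, Derivation.leibniz, Dx_apply (zs e), deriv_zs,
      smul_zero, add_zero, Function.iterate_succ_apply', smul_eq_mul]

theorem CTR_X_pow_mul_Dx_iterate (a b : ℕ) (f : LSeries) :
    CTR (X ^ a * Dx^[b] f) = X ^ a * (d⁄dX ℚ)^[b] (CTR f) := by
  have h1 : CTR (Dx^[b] f) = (d⁄dX ℚ)^[b] (CTR f) := by
    induction b with
    | zero => rfl
    | succ b ih =>
      rw [Function.iterate_succ_apply', Function.iterate_succ_apply', ← ih, Dx_apply, CTR,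
        lmap_derivative]
  rw [← h1]
  induction a with
  | zero => simp
  | succ a ih => rw [pow_succ', mul_assoc, CTR, lmap_X_mul, ← CTR, ih, pow_succ', mul_assoc]

/-- The residue of a rational function is D-finite. -/
theorem IsRat.dFinite_CTR {F : LSeries} (hF : IsRat F) :
    ∃ (m : ℕ) (P : Fin (m + 1) → Polynomial ℚ), (∃ k, P k ≠ 0) ∧
      ∑ k : Fin (m + 1), (P k : PowerSeries ℚ) * (derivativeFun^[(k : ℕ)] (CTR F)) = 0 := by
  obtain ⟨N, g, hg, hne⟩ := hF.exists_relation
  obtain ⟨p, hp, hmin⟩ := Finset.exists_min_image (Finset.univ.filter fun p => g p ≠ 0)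
    (fun p => ∑ i, (p.2.2 i : ℕ)) (by
      obtain ⟨p, hp⟩ := hne; exact ⟨p, by simpa using hp⟩)
  simp only [Finset.mem_filter, Finset.mem_univ, true_and] at hp hmin
  obtain ⟨q, hq, hres⟩ := CTR_mul_Pds_self (fun i => (p.2.2 i : ℕ))
  refine ⟨N, fun b => ∑ a : Fin (N + 1), Polynomial.monomial (a : ℕ) (g (a, b, p.2.2)),
    ⟨p.2.1, fun h => hp ?_⟩, ?_⟩
  · have := congrArg (fun P => P.coeff p.1) h
    simp only [Polynomial.finsetSum_coeff, Polynomial.coeff_monomial, Polynomial.coeff_zero,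
      Fin.val_inj, Finset.sum_ite_eq', Finset.mem_univ, if_true] at this
    exact this
  · have key := congrArg (fun f => CTR (zs (fun i => ((p.2.2 i : ℕ) : ℤ)) * f)) hg
    simp only [mul_zero, map_zero, Finset.mul_sum, map_sum, mul_smul_comm, map_smul] at key
    have term (s : OpIndex N) : g s • CTR (zs (fun i => ((p.2.2 i : ℕ) : ℤ)) * opApply F s) =
        if s.2.2 = p.2.2 then
          q • g s • (X ^ (s.1 : ℕ) * (d⁄dX ℚ)^[s.2.1] (CTR F)) else 0 := by
      have e : zs (fun i => ((p.2.2 i : ℕ) : ℤ)) * opApply F s =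
          X ^ (s.1 : ℕ) * Dx^[s.2.1] (zs (fun i => ((p.2.2 i : ℕ) : ℤ)) *
            Pds (fun i => (s.2.2 i : ℕ)) F) := by
        rw [opApply, Dx_iterate_zs_mul]; ring
      rw [e, CTR_X_pow_mul_Dx_iterate]
      split_ifs with hs
      · rw [hs, hres]
        have : (d⁄dX ℚ)^[s.2.1] (q • CTR F) = q • (d⁄dX ℚ)^[s.2.1] (CTR F) := by
          generalize (s.2.1 : ℕ) = n
          induction n with
          | zero => rfl
          | succ n ih =>
            rw [Function.iterate_succ_apply', ih, Derivation.map_smul,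
              Function.iterate_succ_apply']
        rw [this, mul_smul_comm, smul_comm]
      · rcases eq_or_ne (g s) 0 with h0 | h0
        · rw [h0, zero_smul]
        have hle := hmin s h0
        have : ∃ i, (p.2.2 i : ℕ) < s.2.2 i := by
          by_contra! hcon
          refine hs (funext fun i => Fin.ext ?_)
          have := (Finset.sum_eq_sum_iff_of_le (fun i _ => hcon i)).1
            (le_antisymm (Finset.sum_le_sum fun i _ => hcon i) hle)
          exact this i (Finset.mem_univ i)
        obtain ⟨i, hi⟩ := this
        rw [CTR_mul_Pds_of_lt (c := fun i => (p.2.2 i : ℕ)) (i := i) hi]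
        have : (d⁄dX ℚ)^[s.2.1] (0 : PowerSeries ℚ) = 0 := by
          generalize (s.2.1 : ℕ) = n
          induction n with
          | zero => rfl
          | succ n ih => rw [Function.iterate_succ_apply', ih, map_zero]
        rw [this, mul_zero, smul_zero]
    simp only [term] at key
    rw [Fintype.sum_prod_type] at key
    simp only [Fintype.sum_prod_type, Finset.sum_ite_eq', Finset.mem_univ, if_true,
      ← Finset.smul_sum] at key
    rw [smul_eq_zero_iff_right hq, Finset.sum_comm] at key
    rw [← key]
    refine Finset.sum_congr rfl fun b _ => ?_
    rw [← Polynomial.coeToPowerSeries.ringHom_apply, map_sum, Finset.sum_mul]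
    refine Finset.sum_congr rfl fun a _ => ?_
    rw [Polynomial.coeToPowerSeries.ringHom_apply, Polynomial.coe_monomial,
      PowerSeries.monomial_eq_C_mul_X_pow, mul_assoc, ← PowerSeries.smul_eq_C_mul]
    rfl

end ThreeChoice

namespace ThreeChoice

/-- Closed self-avoiding walks with period `2 * n`, described by abscissa `X` and level `L`. -/
structure CW (n : ℕ) (X L : ℤ → ℤ) : Prop where
  per_X : ∀ t, X (t + 2 * n) = X t
  per_L : ∀ t, L (t + 2 * n) = L t
  step : ∀ t, (L (t + 1) = L t + 1 ∧ (X (t + 1) = X t ∨ X (t + 1) = X t + 1)) ∨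
    (L (t + 1) = L t - 1 ∧ (X (t + 1) = X t ∨ X (t + 1) = X t - 1))
  inj : ∀ s t, X s = X t → L s = L t → (2 * n : ℤ) ∣ s - t

/-- The condition on the turn at time `t`. -/
def Turn (X L : ℤ → ℤ) (t : ℤ) : Prop :=
  (L (t - 1) = L t - 1 → L (t + 1) = L t - 1 → X (t - 1) = X t ∧ X (t + 1) = X t - 1) ∧
  (L (t - 1) = L t + 1 → L (t + 1) = L t + 1 → X (t - 1) = X t ∧ X (t + 1) = X t + 1)

/-- A local maximum of the level. -/
def Peak (L : ℤ → ℤ) (t : ℤ) : Prop := L (t - 1) = L t - 1 ∧ L (t + 1) = L t - 1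

/-- Order preservation for sequences with increments `0` and `1` that never meet. -/
theorem noncross {f g : ℤ → ℤ} {lo hi : ℤ}
    (hf : ∀ l, lo ≤ l → l < hi → f (l + 1) = f l ∨ f (l + 1) = f l + 1)
    (hg : ∀ l, lo ≤ l → l < hi → g (l + 1) = g l ∨ g (l + 1) = g l + 1)
    (hne : ∀ l, lo ≤ l → l ≤ hi → f l ≠ g l) {l₁ l₂ : ℤ} (h₁ : lo ≤ l₁ ∧ l₁ ≤ hi)
    (h₂ : lo ≤ l₂ ∧ l₂ ≤ hi) (h : f l₁ < g l₁) : f l₂ < g l₂ := by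
  have key : ∀ k : ℕ, lo + k ≤ hi → (f lo < g lo ↔ f (lo + k) < g (lo + k)) := by
    intro k
    induction k with
    | zero => simp
    | succ k ih =>
      intro hk
      push_cast at hk ⊢
      rw [ih (by omega), ← add_assoc]
      have a := hf (lo + k) (by omega) (by omega)
      have b := hg (lo + k) (by omega) (by omega)
      have c := hne (lo + k) (by omega) (by omega)
      have d := hne (lo + k + 1) (by omega) (by omega)
      omega
  have k1 := key (l₁ - lo).toNat (by omega)
  have k2 := key (l₂ - lo).toNat (by omega)
  rw [show lo + ((l₁ - lo).toNat : ℤ) = l₁ by omega] at k1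
  rw [show lo + ((l₂ - lo).toNat : ℤ) = l₂ by omega] at k2
  exact k2.1 (k1.2 h)

/-- A monotone piece of the walk, parametrised by the level. -/
def Strand (X L : ℤ → ℤ) (lo hi : ℤ) (τ : ℤ → ℤ) : Prop :=
  (∀ l, lo ≤ l → l ≤ hi → L (τ l) = l) ∧
    ∀ l, lo ≤ l → l < hi → X (τ (l + 1)) = X (τ l) ∨ X (τ (l + 1)) = X (τ l) + 1

theorem Strand.sub {X L : ℤ → ℤ} {lo hi lo' hi' : ℤ} {τ : ℤ → ℤ} (h : Strand X L lo hi τ)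
    (h1 : lo ≤ lo') (h2 : hi' ≤ hi) : Strand X L lo' hi' τ :=
  ⟨fun l a b => h.1 l (by omega) (by omega), fun l a b => h.2 l (by omega) (by omega)⟩

theorem not_dvd_of_lt {n : ℕ} {x : ℤ} (h0 : x ≠ 0) (h1 : -(2 * n : ℤ) < x) (h2 : x < 2 * n) :
    ¬ (2 * n : ℤ) ∣ x := by
  intro h
  refine h0 (Int.eq_zero_of_abs_lt_dvd h ?_)
  rw [abs_lt]; exact ⟨h1, h2⟩

namespace CW
variable {n : ℕ} {X L : ℤ → ℤ}

theorem eq_of_dvd (h : CW n X L) {s t : ℤ} (hd : (2 * n : ℤ) ∣ s - t) : X s = X t ∧ L s = L t := by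
  obtain ⟨k, hk⟩ := hd
  have e : s = t + k * (2 * n) := by linarith
  rw [e]
  exact ⟨Function.Periodic.int_mul (f := X) h.per_X k t,
    Function.Periodic.int_mul (f := L) h.per_L k t⟩

theorem stepL (h : CW n X L) (t : ℤ) : L (t + 1) = L t + 1 ∨ L (t + 1) = L t - 1 := by
  have := h.step t; omega

theorem strand_up (h : CW n X L) {lo hi c : ℤ} (hL : ∀ l, lo ≤ l → l ≤ hi → L (c + l) = l) :
    Strand X L lo hi (fun l => c + l) := by
  refine ⟨hL, fun l a b => ?_⟩
  have h1 := hL l a (by omega)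
  have h2 := hL (l + 1) (by omega) (by omega)
  have h3 := h.step (c + l)
  rw [← add_assoc] at h2
  simp only [← add_assoc]
  omega

theorem strand_dn (h : CW n X L) {lo hi c : ℤ} (hL : ∀ l, lo ≤ l → l ≤ hi → L (c - l) = l) :
    Strand X L lo hi (fun l => c - l) := by
  refine ⟨hL, fun l a b => ?_⟩
  have h1 := hL l a (by omega)
  have h2 := hL (l + 1) (by omega) (by omega)
  have h3 := h.step (c - (l + 1))
  rw [show c - (l + 1) + 1 = c - l by ring] at h3
  change X (c - (l + 1)) = X (c - l) ∨ X (c - (l + 1)) = X (c - l) + 1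
  omega

theorem order (h : CW n X L) {lo hi : ℤ} {σ τ : ℤ → ℤ} (hσ : Strand X L lo hi σ)
    (hτ : Strand X L lo hi τ) (hne : ∀ l, lo ≤ l → l ≤ hi → ¬ (2 * n : ℤ) ∣ σ l - τ l)
    (l₁ l₂ : ℤ) (h₁ : lo ≤ l₁ ∧ l₁ ≤ hi) (h₂ : lo ≤ l₂ ∧ l₂ ≤ hi) (hlt : X (σ l₁) < X (τ l₁)) :
    X (σ l₂) < X (τ l₂) :=
  noncross (f := fun l => X (σ l)) (g := fun l => X (τ l)) hσ.2 hτ.2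
    (fun l a b e => hne l a b (h.inj _ _ e (by rw [hσ.1 l a b, hτ.1 l a b]))) h₁ h₂ hlt

theorem not_dvd_of_next (h : CW n X L) {s t : ℤ} (e : L (s + 1) ≠ L (t + 1)) :
    ¬ (2 * n : ℤ) ∣ s - t := fun hd =>
  e (h.eq_of_dvd (s := s + 1) (t := t + 1) (by simpa using hd)).2

theorem not_dvd_of_prev (h : CW n X L) {s t : ℤ} (e : L (s - 1) ≠ L (t - 1)) :
    ¬ (2 * n : ℤ) ∣ s - t := fun hd =>
  e (h.eq_of_dvd (s := s - 1) (t := t - 1) (by simpa using hd)).2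

theorem refl (h : CW n X L) : CW n (fun t => L (-t) - X (-t)) (fun t => L (-t)) where
  per_X t := by
    have := h.eq_of_dvd (s := -(t + 2 * n)) (t := -t) (by simp)
    simp only [this]
  per_L t := (h.eq_of_dvd (s := -(t + 2 * n)) (t := -t) (by simp)).2
  step t := by
    have := h.step (-(t + 1))
    rw [show -(t + 1) + 1 = -t by ring] at this
    omega
  inj s t hx hl := by
    have := h.inj (-s) (-t) (by omega) hl
    rw [← Int.dvd_neg]
    convert this using 1
    ring

end CW

theorem Turn.refl {X L : ℤ → ℤ} {t : ℤ} (h : Turn X L t) :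
    Turn (fun t => L (-t) - X (-t)) (fun t => L (-t)) (-t) := by
  unfold Turn at h ⊢
  simp only [neg_neg, show -(-t - 1) = t + 1 by ring, show -(-t + 1) = t - 1 by ring]
  omega

section runs
variable {L : ℤ → ℤ}

theorem run_up (hs : ∀ t, L (t + 1) = L t + 1 ∨ L (t + 1) = L t - 1) {a K : ℤ} (h0 : L (a + 1) = L a + 1)
    (hp : ∀ k, 0 < k → k < K → L (a + k) = L a + k → ¬ Peak L (a + k)) (k : ℤ) (hk0 : 0 ≤ k) (hk : k ≤ K) :
    L (a + k) = L a + k := by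
  have key : ∀ k : ℕ, (k : ℤ) ≤ K → L (a + k) = L a + k ∧ (k < K → L (a + k + 1) = L a + k + 1) := by
    intro k
    induction k with
    | zero => intro _; simp [h0]
    | succ k ih =>
      intro hk
      push_cast at hk ⊢
      obtain ⟨h1, h2⟩ := ih (by omega)
      have h3 := h2 (by omega)
      have h6 : L (a + (k + 1)) = L a + (k + 1) := by rw [← add_assoc]; omega
      refine ⟨h6, fun hlt => ?_⟩
      have h4 := hs (a + (k + 1))
      have h5 := hp (k + 1) (by omega) (by omega) h6
      rw [Peak, show a + ((k : ℤ) + 1) - 1 = a + k by ring] at h5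
      rw [← add_assoc] at *
      omega
  have := (key k.toNat (by omega)).1
  rwa [show (k.toNat : ℤ) = k by omega] at this

theorem run_up_back (hs : ∀ t, L (t + 1) = L t + 1 ∨ L (t + 1) = L t - 1) {a K : ℤ} (h0 : L (a - 1) = L a + 1)
    (hp : ∀ k, 0 < k → k < K → L (a - k) = L a + k → ¬ Peak L (a - k)) (k : ℤ) (hk0 : 0 ≤ k) (hk : k ≤ K) :
    L (a - k) = L a + k := by
  have := run_up (L := fun t => L (-t)) (fun t => by
    have := hs (-(t + 1))
    rw [show -(t + 1) + 1 = -t by ring] at this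
    omega) (a := -a) (K := K) (by simp [h0, show -(-a+1) = a - 1 by ring])
    (fun k h1 h2 hL hP => hp k h1 h2
      (by simpa [show -(-a + k) = a - k by ring] using hL) (by
      unfold Peak at hP ⊢
      simp only [show -(-a + k) = a - k by ring, show -(-a + k + 1) = a - k - 1 by ring,
        show -(-a + k - 1) = a - k + 1 by ring] at hP
      exact hP.symm)) k hk0 hk
  simpa [show -(-a + k) = a - k by ring] using this

theorem run_down_exists (hs : ∀ t, L (t + 1) = L t + 1 ∨ L (t + 1) = L t - 1) {N : ℤ} (hN : 0 < N) (hper : ∀ t, L (t + N) = L t) {a : ℤ}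
    (h0 : L (a + 1) = L a - 1) :
    ∃ j, 1 ≤ j ∧ (∀ k, 0 ≤ k → k ≤ j → L (a + k) = L a - k) ∧ L (a + j + 1) = L a - j + 1 := by
  by_contra! hcon
  have key : ∀ k : ℕ, ∀ i : ℤ, 0 ≤ i → i ≤ k + 1 → L (a + i) = L a - i := by
    intro k
    induction k with
    | zero =>
      intro i h1 h2
      simp only [Nat.cast_zero, zero_add] at h2
      obtain rfl | rfl : i = 0 ∨ i = 1 := by omega
      · simp
      · exact h0
    | succ k ih =>
      intro i h1 h2
      push_cast at h2
      rcases lt_or_ge i (k + 2) with h | h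
      · exact ih i h1 (by omega)
      · obtain rfl : i = k + 1 + 1 := by omega
        have h3 := hcon (k + 1) (by omega) ih
        have h4 := hs (a + (k + 1))
        have h5 := ih (k + 1) (by omega) (by omega)
        rw [add_assoc] at *
        simp only [add_assoc] at *
        omega
  have h1 := key N.toNat N (by omega) (by omega)
  rw [hper] at h1
  omega

theorem exists_two_sided_descent (hs : ∀ t, L (t + 1) = L t + 1 ∨ L (t + 1) = L t - 1) {n : ℕ} {p : ℤ} (hn : 1 ≤ n) (hp : Peak L p) :
    ∃ h : ℤ, 1 ≤ h ∧ h ≤ n ∧ (∀ k, 0 ≤ k → k ≤ h → L (p + k) = L p - k ∧ L (p - k) = L p - k) ∧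
      (h = n ∨ L (p + h + 1) = L p - h + 1 ∨ L (p - h - 1) = L p - h + 1) := by
  by_contra! hcon
  have key : ∀ k : ℕ, k + 1 ≤ n → ∀ i : ℤ, 0 ≤ i → i ≤ k + 1 →
      L (p + i) = L p - i ∧ L (p - i) = L p - i := by
    intro k
    induction k with
    | zero =>
      intro _ i h1 h2
      simp only [Nat.cast_zero, zero_add] at h2
      obtain rfl | rfl : i = 0 ∨ i = 1 := by omega
      · simp
      · exact hp.symm
    | succ k ih =>
      intro hk i h1 h2
      push_cast at h2
      rcases lt_or_ge i (k + 2) with h | h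
      · exact ih (by omega) i h1 (by omega)
      · obtain rfl : i = k + 1 + 1 := by omega
        have h3 := hcon (k + 1) (by omega) (by omega) (ih (by omega))
        have h4 := hs (p + (k + 1))
        have h6 := hs (p - (k + 1 + 1))
        have h5 := ih (by omega) (k + 1) (by omega) (by omega)
        rw [show p - ((k : ℤ) + 1 + 1) + 1 = p - (k + 1) by ring] at h6
        rw [show p - ((k : ℤ) + 1) - 1 = p - (k + 1 + 1) by ring] at h3
        rw [add_assoc p] at *
        omega
  have := hcon n (by omega) le_rfl (fun k h1 h2 => key (n - 1) (by omega) k h1 (by omega))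
  exact this.1 rfl
end runs
end ThreeChoice

namespace ThreeChoice
namespace CW
variable {n : ℕ} {X L : ℤ → ℤ}

theorem no_full_ascent (h : CW n X L) {p m : ℤ} (hm : 1 ≤ m) (hmn : m < n)
    (hd : ∀ k, 0 ≤ k → k ≤ m → L (p + k) = L p - k ∧ L (p - k) = L p - k)
    (hu : ∀ k, 0 ≤ k → k ≤ m → L (p + m + k) = L p - m + k)
    (tp : Turn X L p) (ta : Turn X L (p + m)) : False := by
  obtain ⟨P, hP⟩ : ∃ P, P = L p := ⟨_, rfl⟩
  rw [← hP] at hd hu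
  have s1 : Strand X L (P - m) P (fun l => (p - P) + l) := h.strand_up fun l a b => by
    have := (hd (P - l) (by omega) (by omega)).2
    rw [show p - P + l = p - (P - l) by ring]; omega
  have s2 : Strand X L (P - m) P (fun l => (p + P) - l) := h.strand_dn fun l a b => by
    have := (hd (P - l) (by omega) (by omega)).1
    rw [show p + P - l = p + (P - l) by ring]; omega
  have s3 : Strand X L (P - m) P (fun l => (p + 2 * m - P) + l) := h.strand_up fun l a b => by
    have := hu (l - P + m) (by omega) (by omega)
    rw [show p + 2 * m - P + l = p + m + (l - P + m) by ring]; omega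
  have t1 := tp.1 (by have := (hd 1 (by omega) hm).2; omega) (by have := (hd 1 (by omega) hm).1; omega)
  have t2 := ta.2 (by
      have := (hd (m - 1) (by omega) (by omega)).1
      have := (hd m (by omega) (by omega)).1
      rw [add_sub_assoc]; omega) (by
      have := hu 1 (by omega) (by omega)
      have := (hd m (by omega) (by omega)).1
      omega)
  have o1 : X (p + P - (P - m)) < X (p - P + (P - m)) :=
    h.order (s2.sub (lo' := P - m) (hi' := P - 1) (by omega) (by omega))
      (s1.sub (by omega) (by omega)) (fun l a b => not_dvd_of_lt (by omega) (by omega) (by omega))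
      (P - 1) (P - m) (by omega) (by omega) (by
        rw [show p + P - (P - 1) = p + 1 by ring, show p - P + (P - 1) = p - 1 by ring]; omega)
  have o2 : X (p + P - P) < X (p + 2 * m - P + P) :=
    h.order (s2.sub (lo' := P - m + 1) (hi' := P) (by omega) (by omega))
      (s3.sub (by omega) (by omega)) (fun l a b => not_dvd_of_lt (by omega) (by omega) (by omega))
      (P - m + 1) P (by omega) (by omega) (by
        rw [show p + P - (P - m + 1) = p + m - 1 by ring,
          show p + 2 * m - P + (P - m + 1) = p + m + 1 by ring]; omega)
  have o3 : X (p - P + (P - m)) < X (p + 2 * m - P + (P - m)) :=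
    h.order s1 s3 (fun l a b => not_dvd_of_lt (by omega) (by omega) (by omega))
      P (P - m) (by omega) (by omega) (by
        rw [show p - P + P = p + P - P by ring]; exact o2)
  rw [show p + P - (P - m) = p + m by ring] at o1
  rw [show p + 2 * m - P + (P - m) = p + m by ring] at o3
  omega

theorem exists_peak (h : CW n X L) (hn : 1 ≤ n) : ∃ t : ℤ, 0 ≤ t ∧ t < 2 * n ∧ Peak L t := by
  obtain ⟨t, ht, hmax⟩ := Finset.exists_max_image (Finset.Ico (0 : ℤ) (2 * n)) L
    ⟨0, by simp; omega⟩
  simp only [Finset.mem_Ico] at ht hmax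
  refine ⟨t, ht.1, ht.2, ?_⟩
  have hall (s : ℤ) : L s ≤ L t := by
    have := hmax (s % (2 * n)) ⟨Int.emod_nonneg _ (by omega), Int.emod_lt_of_pos _ (by omega)⟩
    rw [(h.eq_of_dvd (s := s) (t := s % (2 * n)) (Int.dvd_self_sub_emod)).2]
    exact this
  have h1 := hall (t - 1)
  have h2 := hall (t + 1)
  have h3 := h.stepL (t - 1)
  have h4 := h.stepL t
  rw [sub_add_cancel] at h3
  constructor <;> omega

theorem peak_congr (h : CW n X L) {s t : ℤ} (hd : (2 * n : ℤ) ∣ s - t) (hp : Peak L s) :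
    Peak L t := by
  have h1 := (h.eq_of_dvd hd).2
  have h2 := (h.eq_of_dvd (s := s + 1) (t := t + 1) (by simpa using hd)).2
  have h3 := (h.eq_of_dvd (s := s - 1) (t := t - 1) (by simpa using hd)).2
  unfold Peak at *
  omega

/-- Among the peaks satisfying a periodic condition there is a lowest one. -/
theorem exists_lowest_peak (h : CW n X L) (hn : 1 ≤ n) {c : ℤ → Prop}
    (hc : ∀ s t, (2 * n : ℤ) ∣ s - t → c s → c t) (hne : ∃ t, Peak L t ∧ c t) :
    ∃ p : ℤ, 0 ≤ p ∧ p < 2 * n ∧ Peak L p ∧ c p ∧ ∀ t, Peak L t → c t → L p ≤ L t := by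
  classical
  have hmod (s : ℤ) : (2 * n : ℤ) ∣ s - s % (2 * n) := Int.dvd_self_sub_emod
  have hrange (s : ℤ) : 0 ≤ s % (2 * n) ∧ s % (2 * n) < 2 * n :=
    ⟨Int.emod_nonneg _ (by omega), Int.emod_lt_of_pos _ (by omega)⟩
  obtain ⟨t, ht, htc⟩ := hne
  obtain ⟨p, hp, hmin⟩ := Finset.exists_min_image
    ((Finset.Ico (0 : ℤ) (2 * n)).filter fun t => Peak L t ∧ c t) L
    ⟨t % (2 * n), by
      simp only [Finset.mem_filter, Finset.mem_Ico]
      exact ⟨hrange t, h.peak_congr (hmod t) ht, hc _ _ (hmod t) htc⟩⟩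
  simp only [Finset.mem_filter, Finset.mem_Ico] at hp hmin
  refine ⟨p, hp.1.1, hp.1.2, hp.2.1, hp.2.2, fun s hs hsc => ?_⟩
  rw [(h.eq_of_dvd (hmod s)).2]
  exact hmin _ ⟨hrange s, h.peak_congr (hmod s) hs, hc _ _ (hmod s) hsc⟩

/-- If every turn is normal, the walk is a pair of monotone paths. -/
theorem regular_structure (h : CW n X L) (hn : 1 ≤ n) (ht : ∀ t, Turn X L t) :
    ∃ p : ℤ, 0 ≤ p ∧ p < 2 * n ∧
      ∀ k : ℤ, 0 ≤ k → k ≤ n → L (p + k) = L p - k ∧ L (p - k) = L p - k := by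
  obtain ⟨t, -, -, htp⟩ := h.exists_peak hn
  obtain ⟨p, p0, p1, hp, -, hlow⟩ := h.exists_lowest_peak hn (c := fun _ => True)
    (fun _ _ _ _ => trivial) ⟨t, htp, trivial⟩
  refine ⟨p, p0, p1, ?_⟩
  obtain ⟨m, hm1, hmn, hd, hor⟩ := exists_two_sided_descent h.stepL hn hp
  by_cases hmn' : m = n
  · rwa [hmn'] at hd
  exfalso
  rcases hor with h0 | h0 | h0
  · exact hmn' h0
  · exact h.no_full_ascent hm1 (by omega) hd (fun k hk0 hk => by
      have e := (hd m (by omega) le_rfl).1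
      rw [← e]
      refine run_up h.stepL (a := p + m) (K := m) (by omega) (fun k h1 h2 h3 hP => ?_) k hk0 hk
      have := hlow _ hP trivial
      omega) (ht _) (ht _)
  · refine h.refl.no_full_ascent (p := -p) hm1 (by omega) (fun k h1 h2 => ?_)
      (fun k hk0 hk => ?_) (ht _).refl ?_
    · simp only [show -(-p + k) = p - k by ring, show -(-p - k) = p + k by ring, neg_neg]
      exact (hd k h1 h2).symm
    · have e := (hd m (by omega) le_rfl).2
      simp only [show -(-p + m + k) = p - m - k by ring, neg_neg]
      rw [← e]
      refine run_up_back h.stepL (a := p - m) (K := m) (by omega) (fun k h1 h2 h3 hP => ?_) k hk0 hk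
      have := hlow _ hP trivial
      omega
    · rw [show -p + m = -(p - m) by ring]; exact (ht _).refl

end CW
end ThreeChoice

namespace ThreeChoice

/-- Closed walks whose root is an exceptional peak, all other turns being normal. -/
structure Exc (n : ℕ) (X L : ℤ → ℤ) : Prop extends CW n X L where
  turn : ∀ t, ¬ (2 * n : ℤ) ∣ t → Turn X L t
  L0 : L 0 = 0
  Ln : L (-1) = -1
  Lp : L 1 = -1
  Xn : X (-1) = X 0 - 1
  Xp : X 1 = X 0

theorem peak_refl {L : ℤ → ℤ} {t : ℤ} : Peak (fun t => L (-t)) t ↔ Peak L (-t) := by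
  unfold Peak
  beta_reduce
  rw [show -(t - 1) = -t + 1 by ring, show -(t + 1) = -t - 1 by ring]
  exact and_comm

namespace Exc
variable {n : ℕ} {X L : ℤ → ℤ}

theorem refl (h : Exc n X L) : Exc n (fun t => L (-t) - X (-t)) (fun t => L (-t)) where
  toCW := h.toCW.refl
  turn t ht := by
    have := (h.turn (-t) (by rwa [Int.dvd_neg])).refl
    rwa [neg_neg] at this
  L0 := h.L0
  Ln := h.Lp
  Lp := h.Ln
  Xn := by
    have := h.Xp; have := h.Lp; have := h.L0
    simp only [neg_neg, neg_zero]; omega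
  Xp := by
    have := h.Xn; have := h.Ln; have := h.L0
    simp only [neg_zero]; omega

theorem peak_zero (h : Exc n X L) : Peak L 0 := by
  have := h.Lp; have := h.L0; have := h.Ln
  constructor
  · rw [zero_sub]; omega
  · rw [zero_add]; omega

theorem at_dvd (h : Exc n X L) {t : ℤ} (ht : (2 * n : ℤ) ∣ t) :
    L t = 0 ∧ L (t + 1) = -1 ∧ L (t - 1) = -1 := by
  have h1 := (h.eq_of_dvd (s := t) (t := 0) (by simpa using ht)).2
  have h2 := (h.eq_of_dvd (s := t + 1) (t := 1) (by simpa using ht)).2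
  have h3 := (h.eq_of_dvd (s := t - 1) (t := -1) (by simpa using ht)).2
  have := h.Lp; have := h.L0; have := h.Ln
  omega

theorem turn_of_L (h : Exc n X L) {t : ℤ} (ht : L (t + 1) = L t + 1 ∨ L (t - 1) = L t + 1 ∨ L t ≠ 0) :
    Turn X L t := h.turn t fun hd => by
  have := h.at_dvd hd; omega

theorem exists_normal_peak (h : Exc n X L) (hn : 2 ≤ n) : ∃ t, Peak L t ∧ ¬ (2 * n : ℤ) ∣ t := by
  by_contra! hcon
  obtain ⟨m, hm1, hmn, hd, hor⟩ := exists_two_sided_descent h.stepL (n := n) (by omega) h.peak_zero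
  simp only [zero_add, zero_sub, h.L0] at hd hor
  have hside (X L : ℤ → ℤ) (h : Exc n X L) (hcon : ∀ t, Peak L t → (2 * n : ℤ) ∣ t)
      (hd : ∀ k, 0 ≤ k → k ≤ m → L k = -k ∧ L (-k) = -k)
      (hv : L (m + 1) = -m + 1) (hmn : m < n) : False := by
    have e := (hd m (by omega) le_rfl).1
    have := run_up h.stepL (a := m) (K := 2 * n) (by omega) (fun k h1 h2 h3 hP => by
      have hdv := hcon _ hP
      have := (h.at_dvd hdv).1
      obtain rfl : k = m := by omega
      exact not_dvd_of_lt (by omega) (by omega) (by omega) hdv) (2 * n) (by omega) le_rfl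
    rw [h.per_L] at this
    omega
  by_cases hmn' : m = n
  · subst hmn'
    have s1 : Strand X L (-n) 0 (fun l => 0 + l) := h.strand_up fun l a b => by
      have := (hd (-l) (by omega) (by omega)).2
      rw [neg_neg] at this; rw [zero_add]; exact this
    have s2 : Strand X L (-n) 0 (fun l => 0 - l) := h.strand_dn fun l a b => by
      have := (hd (-l) (by omega) (by omega)).1
      rw [neg_neg] at this; rw [zero_sub]; exact this
    have o : X (0 + (-n + 1)) < X (0 - (-n + 1)) :=
      h.order (s1.sub (lo' := -n + 1) (hi' := -1) (by omega) (by omega))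
        (s2.sub (by omega) (by omega)) (fun l a b => not_dvd_of_lt (by omega) (by omega) (by omega))
        (-1) (-n + 1) (by omega) (by omega) (by
          have := h.Xn; have := h.Xp
          rw [zero_add, show (0 : ℤ) - -1 = 1 by ring]; omega)
    have e := (hd n (by omega) le_rfl).1
    have e1 := (hd (n - 1) (by omega) (by omega)).1
    have e2 := (hd (n - 1) (by omega) (by omega)).2
    have p := h.eq_of_dvd (s := (n : ℤ) + 1) (t := -(n - 1)) ⟨1, by ring⟩
    have t := (h.turn_of_L (t := n) (by omega)).2 (by omega) (by omega)
    rw [show 0 + (-(n : ℤ) + 1) = -(n - 1) by ring, show 0 - (-(n : ℤ) + 1) = n - 1 by ring] at o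
    omega
  rcases hor with h0 | h0 | h0
  · exact hmn' h0
  · exact hside X L h hcon hd h0 (by omega)
  · refine hside _ _ h.refl (fun t hP => ?_) (fun k h1 h2 => by simpa using (hd k h1 h2).symm)
      (by rwa [neg_add']) (by omega)
    have := hcon (-t) (peak_refl.1 hP)
    rwa [Int.dvd_neg] at this
end Exc
end ThreeChoice

namespace ThreeChoice
namespace Exc
variable {n : ℕ} {X L : ℤ → ℤ}

set_option maxHeartbeats 1000000 in
/-- The two ways around the central spiral cannot end at different peaks. -/
theorem not_two_peaks (h : Exc n X L) {p i j w d hb : ℤ} (hi : 1 ≤ i) (hiw : i < w)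
    (hwn : w < n) (hd : d = w - i) (hp : p = -w - i) (hj : 1 ≤ j) (hjn : j < n)
    (hbw : w ≤ hb) (hbn : hb < n)
    (hda : ∀ k, 0 ≤ k → k ≤ w → L (p + k) = d - k)
    (hub : ∀ k, 0 ≤ k → k ≤ hb → L (p - k) = d - k)
    (hua : ∀ k, 0 ≤ k → k ≤ i → L (-k) = -k)
    (hdj : ∀ k, 0 ≤ k → k ≤ j → L k = -k)
    (huj : ∀ k, 0 ≤ k → k ≤ j + d → L (j + k) = k - j)
    (hdb : ∀ k, 0 ≤ k → k ≤ hb → L (p - hb - k) = d - hb + k)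
    (hpp : ¬ (2 * n : ℤ) ∣ 2 * j + d - p) (hr : ¬ (2 * n : ℤ) ∣ p - 2 * hb + d) : False := by
  have sUb : Strand X L (d - hb) d (fun l => (p - d) + l) := h.strand_up fun l a b => by
    have := hub (d - l) (by omega) (by omega)
    rw [show p - d + l = p - (d - l) by ring]; omega
  have sDa : Strand X L (-i) d (fun l => (p + d) - l) := h.strand_dn fun l a b => by
    have := hda (d - l) (by omega) (by omega)
    rw [show p + d - l = p + (d - l) by ring]; omega
  have sUa : Strand X L (-i) 0 (fun l => 0 + l) := h.strand_up fun l a b => by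
    have := hua (-l) (by omega) (by omega)
    rw [neg_neg] at this; rw [zero_add]; exact this
  have sDj : Strand X L (-j) 0 (fun l => 0 - l) := h.strand_dn fun l a b => by
    have := hdj (-l) (by omega) (by omega)
    rw [neg_neg] at this; rw [zero_sub]; exact this
  have sUj : Strand X L (-j) d (fun l => 2 * j + l) := h.strand_up fun l a b => by
    have := huj (j + l) (by omega) (by omega)
    rw [show 2 * j + l = j + (j + l) by ring]; omega
  have sDb : Strand X L (d - hb) d (fun l => (p - 2 * hb + d) - l) := h.strand_dn fun l a b => by
    have := hdb (l - d + hb) (by omega) (by omega)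
    rw [show p - 2 * hb + d - l = p - hb - (l - d + hb) by ring]; omega
  have lUb := sUb.1; have lDa := sDa.1; have lUa := sUa.1
  have lDj := sDj.1; have lUj := sUj.1; have lDb := sDb.1
  beta_reduce at lUb lDa lUa lDj lUj lDb
  -- the two sides of the valley before `p`
  have e1 := lDb (d - hb + 1) (by omega) (by omega)
  have e2 := lUb (d - hb + 1) (by omega) (by omega)
  have e3 := lUb (d - hb) (by omega) (by omega)
  rw [show p - 2 * hb + d - (d - hb + 1) = p - hb - 1 by ring] at e1
  rw [show p - d + (d - hb + 1) = p - hb + 1 by ring] at e2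
  rw [show p - d + (d - hb) = p - hb by ring] at e3
  have tb := (h.turn_of_L (t := p - hb) (by omega)).2 (by omega) (by omega)
  have o1 := h.order (sDb.sub (lo' := d - hb + 1) (hi' := d) (by omega) (by omega))
    (sUb.sub (by omega) (by omega)) (fun l a b => not_dvd_of_lt (by omega) (by omega) (by omega))
    (d - hb + 1) d (by omega) (by omega) (by
      rw [show p - 2 * hb + d - (d - hb + 1) = p - hb - 1 by ring,
        show p - d + (d - hb + 1) = p - hb + 1 by ring]; omega)
  have o2 := h.order (sDb.sub (lo' := -i) (hi' := d) (by omega) (by omega)) sDa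
    (fun l a b => not_dvd_of_lt (by omega) (by omega) (by omega)) d (-i) (by omega) (by omega)
    (by rwa [show p - d + d = p + d - d by ring] at o1)
  have o3 := h.order (sDb.sub (lo' := -i) (hi' := 0) (by omega) (by omega)) sUa
    (fun l a b => by
      rcases eq_or_lt_of_le a with rfl | a'
      · exact not_dvd_of_lt (by omega) (by omega) (by omega)
      · refine h.not_dvd_of_prev ?_
        have e1 := lDb (l + 1) (by omega) (by omega)
        have e2 := lUa (l - 1) (by omega) (by omega)
        rw [show p - 2 * hb + d - l - 1 = p - 2 * hb + d - (l + 1) by ring, add_sub_assoc 0 l 1]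
        omega) (-i) (-1) (by omega) (by omega)
    (by rwa [show p + d - -i = 0 + -i by omega] at o2)
  have o4 : X (p - 2 * hb + d - -1) < X (0 - -1) := by
    have := h.Xn; have := h.Xp
    rw [show (0 : ℤ) + -1 = -1 by ring] at o3
    rw [show (0 : ℤ) - -1 = 1 by ring]
    omega
  have o5 := h.order (sDb.sub (lo' := max (d - hb) (-j)) (hi' := -1) (by omega) (by omega))
    (sDj.sub (by omega) (by omega)) (fun l a b => by
      rwa [show p - 2 * hb + d - l - (0 - l) = p - 2 * hb + d by ring])
    (-1) (max (d - hb) (-j)) (by omega) (by omega) o4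
  -- the peak `p`
  have e4 := lUb (d - 1) (by omega) (by omega)
  have e5 := lUb d (by omega) (by omega)
  have e6 := lDa (d - 1) (by omega) (by omega)
  rw [show p - d + (d - 1) = p - 1 by ring] at e4
  rw [show p - d + d = p by ring] at e5
  rw [show p + d - (d - 1) = p + 1 by ring] at e6
  have tp := (h.turn_of_L (t := p) (by omega)).1 (by omega) (by omega)
  have o6 := h.order (sDa.sub (lo' := -i) (hi' := d - 1) (by omega) (by omega))
    (sUb.sub (by omega) (by omega)) (fun l a b => not_dvd_of_lt (by omega) (by omega) (by omega))
    (d - 1) (-i) (by omega) (by omega) (by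
      rw [show p - d + (d - 1) = p - 1 by ring, show p + d - (d - 1) = p + 1 by ring]; omega)
  have o6' := h.order sUa (sUb.sub (lo' := -i) (hi' := 0) (by omega) (by omega))
    (fun l a b => not_dvd_of_lt (by omega) (by omega) (by omega)) (-i) 0 (by omega) (by omega)
    (by rwa [show p + d - -i = 0 + -i by omega] at o6)
  have o7 := h.order (sDj.sub (lo' := max (d - hb) (-j)) (hi' := 0) (by omega) (by omega))
    (sUb.sub (by omega) (by omega)) (fun l a b => by
      by_cases hl : l = -j
      · subst hl
        rwa [show 0 - -j - (p - d + -j) = 2 * j + d - p by ring]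
      · refine h.not_dvd_of_next ?_
        have e1 := lDj (l - 1) (by omega) (by omega)
        have e2 := lUb (l + 1) (by omega) (by omega)
        rw [show 0 - l + 1 = 0 - (l - 1) by ring, add_assoc]
        omega) 0 (max (d - hb) (-j)) (by omega) (by omega) o6'
  have o8 : d - hb < -j := by
    by_contra! hc
    rw [max_eq_left hc] at o5 o7
    rw [show p - 2 * hb + d - (d - hb) = p - d + (d - hb) by ring] at o5
    omega
  rw [max_eq_right o8.le] at o7
  have o9 := h.order sUj (sUb.sub (lo' := -j) (hi' := d) (by omega) (by omega)) (fun l a b => by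
      rwa [show 2 * j + l - (p - d + l) = 2 * j + d - p by ring]) (-j) d (by omega) (by omega)
    (by rwa [show 0 - -j = 2 * j + -j by ring] at o7)
  -- the valley `j`
  have e7 := lUj (-j + 1) (by omega) (by omega)
  have e8 := lDj (-j) (by omega) (by omega)
  have e9 := lDj (-j + 1) (by omega) (by omega)
  rw [show 2 * j + (-j + 1) = j + 1 by ring] at e7
  rw [show 0 - -j = j by ring] at e8
  rw [show 0 - (-j + 1) = j - 1 by ring] at e9
  have tj := (h.turn_of_L (t := j) (by omega)).2 (by omega) (by omega)
  have o10 := h.order (sDj.sub (lo' := -j + 1) (hi' := 0) (by omega) (by omega))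
    (sUj.sub (by omega) (by omega)) (fun l a b => not_dvd_of_lt (by omega) (by omega) (by omega))
    (-j + 1) 0 (by omega) (by omega) (by
      rw [show 2 * j + (-j + 1) = j + 1 by ring, show 0 - (-j + 1) = j - 1 by ring]; omega)
  -- the valley `-i`
  have f7 := lDa (-i + 1) (by omega) (by omega)
  have f8 := lUa (-i) (by omega) (by omega)
  have f9 := lUa (-i + 1) (by omega) (by omega)
  rw [show p + d - (-i + 1) = -i - 1 by omega] at f7
  rw [show 0 + -i = -i by ring] at f8
  rw [show 0 + (-i + 1) = -i + 1 by ring] at f9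
  have ti := (h.turn_of_L (t := -i) (by omega)).2 (by omega) (by omega)
  have o11 := h.order (sDa.sub (lo' := -i + 1) (hi' := 0) (by omega) (by omega))
    (sUa.sub (by omega) (by omega)) (fun l a b => not_dvd_of_lt (by omega) (by omega) (by omega))
    (-i + 1) 0 (by omega) (by omega) (by
      rw [show p + d - (-i + 1) = -i - 1 by omega, show 0 + (-i + 1) = -i + 1 by ring]; omega)
  have o12 := h.order (sDa.sub (lo' := 0) (hi' := d) (by omega) (by omega))
    (sUj.sub (by omega) (by omega)) (fun l a b => by
      rcases eq_or_lt_of_le b with rfl | b'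
      · intro hd
        apply hpp
        rw [← Int.dvd_neg]
        convert hd using 1
        ring
      · refine h.not_dvd_of_next ?_
        have e1 := lDa (l - 1) (by omega) (by omega)
        have e2 := lUj (l + 1) (by omega) (by omega)
        rw [show p + d - l + 1 = p + d - (l - 1) by ring, add_assoc]
        omega) 0 d (by omega) (by omega) (by
      rw [zero_add] at o11; rw [sub_zero] at o10; exact o11.trans o10)
  rw [show p + d - d = p - d + d by ring] at o12
  exact lt_asymm o9 o12
end Exc
end ThreeChoice

namespace ThreeChoice

/-- The level profile of a walk with an exceptional peak at the root. -/
def Profile (L : ℤ → ℤ) (i j m : ℤ) : Prop :=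
  (∀ k, 0 ≤ k → k ≤ j → L k = -k) ∧ (∀ k, 0 ≤ k → k ≤ i → L (-k) = -k) ∧
  (∀ k, 0 ≤ k → k ≤ j + m → L (j + k) = k - j) ∧ (∀ k, 0 ≤ k → k ≤ i + m → L (-i - k) = k - i)

theorem Profile.refl {L : ℤ → ℤ} {i j m : ℤ} (h : Profile (fun t => L (-t)) i j m) :
    Profile L j i m := by
  obtain ⟨h1, h2, h3, h4⟩ := h
  refine ⟨fun k a b => ?_, fun k a b => ?_, fun k a b => ?_, fun k a b => ?_⟩
  · simpa using h2 k a b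
  · simpa using h1 k a b
  · have := h4 k a b
    beta_reduce at this
    rwa [show -(-i - k) = i + k by ring] at this
  · have := h3 k a b
    beta_reduce at this
    rwa [show -(j + k) = -j - k by ring] at this

namespace Exc
variable {n : ℕ} {X L : ℤ → ℤ}

theorem not_root_of_next (h : Exc n X L) {t : ℤ} (ht : L (t + 1) ≠ -1 ∨ L (t - 1) ≠ -1 ∨ L t ≠ 0) :
    ¬ (2 * n : ℤ) ∣ t := fun hd => by
  have := h.at_dvd hd; omega

set_option maxHeartbeats 1000000 in
theorem profile_of_lowest (h : Exc n X L) {p i w d : ℤ} (hi : 1 ≤ i) (hiw : i < w)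
    (hwn : w < n) (hd : d = w - i) (hp : p = -w - i)
    (hpl : ∀ k, 0 ≤ k → k ≤ w → L (p + k) = d - k ∧ L (p - k) = d - k)
    (hua : ∀ k, 0 ≤ k → k ≤ i → L (-k) = -k)
    (hlow : ∀ t, Peak L t → ¬ (2 * n : ℤ) ∣ t → d ≤ L t) :
    ∃ j, 1 ≤ j ∧ i + j + d = n ∧ Profile L i j d := by
  have L0 := h.L0; have L1 := h.Lp; have Ln := h.Ln
  obtain ⟨j, hj, hdj, hjv⟩ := run_down_exists h.stepL (N := 2 * n) (by omega) h.per_L (a := 0)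
    (by rw [zero_add]; omega)
  simp only [zero_add, L0, zero_sub] at hdj hjv
  have ej := hdj j (by omega) le_rfl
  have huj0 := run_up h.stepL (a := j) (K := j) (by omega) (fun k h1 h2 h3 hP => by
    have := hlow _ hP (h.not_root_of_next (by omega))
    omega)
  have ep := (hpl 0 le_rfl (by omega)).1
  rw [add_zero, sub_zero] at ep
  have epn : L (p + 2 * n) = d := by rw [h.per_L, ep]
  have hjn : j < n := by
    by_contra! hc
    rcases le_or_gt (p + 2 * n) j with hle | hgt
    · have := hdj (p + 2 * n) (by omega) hle
      omega
    · have := huj0 (p + 2 * n - j) (by omega) (by omega)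
      rw [show j + (p + 2 * n - j) = p + 2 * n by ring] at this
      omega
  have huj : ∀ k, 0 ≤ k → k ≤ j + d → L (j + k) = k - j := by
    intro k hk0 hk
    have := run_up h.stepL (a := j) (K := j + d) (by omega) (fun k h1 h2 h3 hP => by
      have : ¬ (2 * n : ℤ) ∣ j + k := by
        by_cases hk : k = j
        · exact not_dvd_of_lt (by omega) (by omega) (by omega)
        · exact h.not_root_of_next (by omega)
      have := hlow _ hP this
      omega) k hk0 hk
    omega
  by_cases hpp : (2 * n : ℤ) ∣ 2 * j + d - p
  · have e : 2 * j + d - p = 2 * n := by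
      obtain ⟨c, hc⟩ := hpp
      have hc0 : 0 < c := by nlinarith
      by_contra hne
      have hc1 : c ≠ 1 := by rintro rfl; omega
      have hc2 : 2 ≤ c := by omega
      have hge := mul_le_mul_of_nonneg_left hc2 (show (0 : ℤ) ≤ 2 * n by omega)
      rw [← hc] at hge
      by_cases c1 : p + 2 * n ≤ p + w
      · have := (hpl (2 * n) (by omega) (by omega)).1
        omega
      by_cases c2 : p + 2 * n ≤ 0
      · have := hua (-(p + 2 * n)) (by omega) (by omega)
        rw [neg_neg] at this
        omega
      by_cases c3 : p + 2 * n ≤ j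
      · have := hdj (p + 2 * n) (by omega) (by omega)
        omega
      have := huj (p + 2 * n - j) (by omega) (by omega)
      rw [show j + (p + 2 * n - j) = p + 2 * n by ring] at this
      omega
    refine ⟨j, hj, by omega, hdj, hua, huj, fun k a b => ?_⟩
    have := (hpl (w - k) (by omega) (by omega)).1
    rw [show p + (w - k) = -i - k by omega] at this
    omega
  exfalso
  obtain ⟨hb, hb1, hub, hbv⟩ := run_down_exists (L := fun t => L (-t)) h.refl.stepL (N := 2 * n)
    (by omega) h.refl.per_L (a := -p) (by
      have := (hpl 1 (by omega) (by omega)).2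
      rw [show -(-p + 1) = p - 1 by ring, neg_neg]
      omega)
  rw [show -(-p + hb + 1) = p - hb - 1 by ring, neg_neg, ep] at hbv
  replace hub : ∀ k, 0 ≤ k → k ≤ hb → L (p - k) = d - k := fun k a b => by
    have := hub k a b
    rwa [show -(-p + k) = p - k by ring, neg_neg, ep] at this
  have hbw : w ≤ hb := by
    by_contra! hc
    have := (hpl (hb + 1) (by omega) (by omega)).2
    rw [← sub_sub] at this
    omega
  have eb := hub hb (by omega) le_rfl
  have eb1 := hub (hb - 1) (by omega) (by omega)
  rw [show p - (hb - 1) = p - hb + 1 by ring] at eb1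
  have hdb0 := run_up_back h.stepL (a := p - hb) (K := hb - d) (by omega) (fun k h1 h2 h3 hP => by
    have := hlow _ hP (h.not_root_of_next (by omega))
    omega)
  have hr : ¬ (2 * n : ℤ) ∣ p - 2 * hb + d := by
    intro hdv
    have hs : ∀ k, L (p - 2 * hb + d + k) = L k := fun k =>
      (h.eq_of_dvd (by rwa [add_sub_cancel_right])).2
    apply hpp
    have hbj : hb - d = j := by
      rcases lt_trichotomy (hb - d) j with hlt | heq | hgt
      · have e1 := hs (hb - d + 1)
        rw [show p - 2 * hb + d + (hb - d + 1) = p - hb + 1 by ring,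
          hdj (hb - d + 1) (by omega) (by omega)] at e1
        omega
      · exact heq
      · have e1 := hs (j + 1)
        have := hdb0 (hb - d - (j + 1)) (by omega) (by omega)
        rw [show p - hb - (hb - d - (j + 1)) = p - 2 * hb + d + (j + 1) by ring] at this
        omega
    rw [← Int.dvd_neg]
    convert hdv using 1
    omega
  have hdb : ∀ k, 0 ≤ k → k ≤ hb → L (p - hb - k) = d - hb + k := by
    intro k hk0 hk
    have := run_up_back h.stepL (a := p - hb) (K := hb) (by omega) (fun k h1 h2 h3 hP => by
      have : ¬ (2 * n : ℤ) ∣ p - hb - k := by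
        by_cases hk : k = hb - d
        · subst hk
          rwa [show p - hb - (hb - d) = p - 2 * hb + d by ring]
        · exact h.not_root_of_next (by omega)
      have := hlow _ hP this
      omega) k hk0 hk
    omega
  have hbn : hb < n := by
    by_contra! hc
    obtain ⟨r0, r1, r2⟩ := h.at_dvd (t := -(2 * n : ℤ)) (by simp)
    rcases le_or_gt (-(2 * n : ℤ)) (p - hb) with hle | hgt
    · have e1 := hdb (p - hb + 2 * n) (by omega) (by omega)
      have e2 := hdb (p - hb + 2 * n + 1) (by omega) (by omega)
      rw [show p - hb - (p - hb + 2 * n) = -(2 * n : ℤ) by ring] at e1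
      rw [show p - hb - (p - hb + 2 * n + 1) = -(2 * n : ℤ) - 1 by ring] at e2
      omega
    · have e1 := hub (p + 2 * n) (by omega) (by omega)
      have e2 := hub (p + 2 * n - 1) (by omega) (by omega)
      rw [show p - (p + 2 * n) = -(2 * n : ℤ) by ring] at e1
      rw [show p - (p + 2 * n - 1) = -(2 * n : ℤ) + 1 by ring] at e2
      omega
  exact h.not_two_peaks hi hiw hwn hd hp hj hjn hbw hbn (fun k a b => (hpl k a b).1) hub hua hdj huj
    hdb hpp hr

theorem profile_of_right_valley (h : Exc n X L) {p w : ℤ} (hp0 : 0 < p) (hp : p < 2 * n)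
    (hw : 1 ≤ w) (hwn : w < n)
    (hpl : ∀ k, 0 ≤ k → k ≤ w → L (p + k) = L p - k ∧ L (p - k) = L p - k)
    (hv : L (p + w + 1) = L p - w + 1)
    (hlow : ∀ t, Peak L t → ¬ (2 * n : ℤ) ∣ t → L p ≤ L t) :
    ∃ i j m : ℤ, 1 ≤ i ∧ 1 ≤ j ∧ 1 ≤ m ∧ i + j + m = n ∧ Profile L i j m := by
  have ew := (hpl w (by omega) le_rfl).1
  by_cases hfull : ∀ k, 0 < k → k < w → L (p + w + k) = L (p + w) + k → ¬ Peak L (p + w + k)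
  · exfalso
    have := run_up h.stepL (a := p + w) (K := w) (by omega) hfull
    refine h.no_full_ascent hw hwn hpl (fun k a b => by rw [this k a b]; omega)
      (h.turn _ (not_dvd_of_lt (by omega) (by omega) (by omega))) (h.turn_of_L (by omega))
  · push Not at hfull
    obtain ⟨i, hi0, hiw, hiL, hiP⟩ := hfull
    have hdv : (2 * n : ℤ) ∣ p + w + i := by
      by_contra hc
      have := hlow _ hiP hc
      omega
    have hroot := h.at_dvd hdv
    have hs : ∀ k, L (p + k) = L (-w - i + k) := fun k =>
      (h.eq_of_dvd (by rwa [show p + k - (-w - i + k) = p + w + i by ring])).2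
    have hs0 := hs 0
    rw [add_zero, add_zero] at hs0
    have hup := run_up h.stepL (a := p + w) (K := i) (by omega) (fun k h1 h2 h3 hP => by
      have := hlow _ hP (h.not_root_of_next (by omega))
      omega)
    obtain ⟨j, h1, h2, h3⟩ := h.profile_of_lowest (p := -w - i) (i := i) (w := w) (d := w - i)
      (by omega) hiw hwn rfl rfl (fun k a b => by
        have := hpl k a b
        rw [sub_eq_add_neg p k] at this
        rw [sub_eq_add_neg (-w - i), ← hs, ← hs]; omega)
      (fun k a b => by
        have e1 := hup (i - k) (by omega) (by omega)
        rw [add_assoc, hs, show -w - i + (w + (i - k)) = -k by ring] at e1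
        omega) (fun t a b => by
        have := hlow t a b; omega)
    exact ⟨i, j, w - i, by omega, h1, by omega, h2, h3⟩

theorem exists_profile (h : Exc n X L) (hn : 2 ≤ n) :
    ∃ i j m : ℤ, 1 ≤ i ∧ 1 ≤ j ∧ 1 ≤ m ∧ i + j + m = n ∧ Profile L i j m := by
  obtain ⟨p, hp0, hpn, hP, hc, hlow⟩ := h.exists_lowest_peak (n := n) (by omega)
    (c := fun t => ¬ (2 * n : ℤ) ∣ t) (fun s t hd hs ht => hs (by
      have := dvd_add hd ht
      rwa [sub_add_cancel] at this)) (h.exists_normal_peak hn)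
  have hp0' : 0 < p := lt_of_le_of_ne hp0 (fun e => hc (by rw [← e]; exact dvd_zero _))
  obtain ⟨w, hw1, hwn, hd, hor⟩ := exists_two_sided_descent h.stepL (n := n) (by omega) hP
  have hwn' : w < n := by
    refine lt_of_le_of_ne hwn ?_
    rintro rfl
    rcases le_or_gt p n with hle | hgt
    · obtain ⟨r0, r1, r2⟩ := h.at_dvd (t := 0) (dvd_zero _)
      have e1 := (hd p (by omega) (by omega)).2
      have e2 := (hd (p - 1) (by omega) (by omega)).2
      rw [sub_self] at e1
      rw [show p - (p - 1) = 0 + 1 by ring] at e2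
      omega
    · obtain ⟨r0, r1, r2⟩ := h.at_dvd (t := 2 * n) dvd_rfl
      have e1 := (hd (2 * n - p) (by omega) (by omega)).1
      have e2 := (hd (2 * n - p - 1) (by omega) (by omega)).1
      rw [show p + (2 * n - p) = 2 * (n : ℤ) by ring] at e1
      rw [show p + (2 * n - p - 1) = 2 * (n : ℤ) - 1 by ring] at e2
      omega
  rcases hor with h0 | h0 | h0
  · omega
  · exact h.profile_of_right_valley hp0' hpn hw1 hwn' hd h0 hlow
  · have hs : ∀ t, L (-(2 * n - p + t)) = L (p - t) := fun t =>
      (h.eq_of_dvd ⟨-1, by ring⟩).2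
    have hs0 := hs 0
    rw [add_zero, sub_zero] at hs0
    obtain ⟨i, j, m, h1, h2, h3, h4, h5⟩ := h.refl.profile_of_right_valley (p := 2 * n - p) (w := w)
      (by omega) (by omega) hw1  hwn'
      (fun k a b => by
        rw [hs, sub_eq_add_neg (2 * (n : ℤ) - p) k, hs, hs0, sub_neg_eq_add]
        exact (hd k a b).symm) (by
        rw [add_assoc, hs, hs0, ← sub_sub]; exact h0) (fun t a b => by
        rw [hs0]
        exact hlow _ (peak_refl.1 a) (by rwa [Int.dvd_neg]))
    exact ⟨j, i, m, h2, h1, h3, by omega, h5.refl⟩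
end Exc
end ThreeChoice

namespace ThreeChoice

/-- The number of pairs of paths at distance `g` that first meet after `m` steps. -/
def v : ℕ → ℤ → ℕ
  | 0, g => if g = 0 then 1 else 0
  | m + 1, g => if 0 < g then v m (g - 1) + 2 * v m g + v m (g + 1) else 0

/-- Shift of a vector by a vector of zeros and ones. -/
def dec (s : Fin 4 → ℤ) (ε : Fin 4 → Fin 2) : Fin 4 → ℤ := fun r => s r - (ε r : ℕ)

/-- The number of quadruples of paths from `s` such that the first two meet after `i` steps,
the last two after `j` steps, and the middle ones stay apart. -/
def q : ℕ → ℕ → (Fin 4 → ℤ) → ℕ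
  | 0, j, s => if s 0 = s 1 ∧ s 1 < s 2 then v j (s 3 - s 2) else 0
  | i + 1, 0, s => if s 1 < s 2 ∧ s 2 = s 3 then v (i + 1) (s 1 - s 0) else 0
  | i + 1, j + 1, s =>
    if s 0 < s 1 ∧ s 1 < s 2 ∧ s 2 < s 3 then ∑ ε : Fin 4 → Fin 2, q i j (dec s ε) else 0

theorem encard_cons {A ι : Type*} [Fintype ι] (a : A) (b : ι → A) (hb : Function.Injective b)
    (W : ι → Set (ℕ → A)) (hW : ∀ i, ∀ F ∈ W i, F 0 = b i) :
    {F : ℕ → A | F 0 = a ∧ ∃ i, (fun k => F (k + 1)) ∈ W i}.encard = ∑ i, (W i).encard := by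
  have hinj : Function.Injective fun (F : ℕ → A) (k : ℕ) => (k.casesOn a F : A) := by
    intro F G h
    funext k
    exact congrFun h (k + 1)
  have : {F : ℕ → A | F 0 = a ∧ ∃ i, (fun k => F (k + 1)) ∈ W i} =
      ⋃ i, (fun (F : ℕ → A) (k : ℕ) => (k.casesOn a F : A)) '' W i := by
    ext F
    simp only [Set.mem_ofPred_eq, Set.mem_iUnion, Set.mem_image]
    constructor
    · rintro ⟨h0, i, hi⟩
      refine ⟨i, _, hi, ?_⟩
      funext k
      cases k
      · exact h0.symm
      · rfl
    · rintro ⟨i, G, hG, rfl⟩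
      exact ⟨rfl, i, hG⟩
  rw [this, Set.encard_iUnion_of_finite, finsum_eq_sum_of_fintype]
  · exact Finset.sum_congr rfl fun i _ => hinj.encard_image _
  · intro i j hij
    rw [Function.onFun, Set.disjoint_left]
    rintro _ ⟨F, hF, rfl⟩ ⟨G, hG, hFG⟩
    obtain rfl := hinj hFG
    exact hij (hb ((hW i _ hF).symm.trans (hW j _ hG)))

/-- Two paths with decrements `0` and `1` which first meet after `m` steps. -/
structure Pair (m : ℕ) (f g : ℕ → ℤ) : Prop where
  stepf : ∀ k < m, f (k + 1) = f k ∨ f (k + 1) = f k - 1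
  stepg : ∀ k < m, g (k + 1) = g k ∨ g (k + 1) = g k - 1
  constf : ∀ k, m ≤ k → f (k + 1) = f k
  constg : ∀ k, m ≤ k → g (k + 1) = g k
  lt : ∀ k < m, f k < g k
  eq : f m = g m

theorem Pair.zero_iff {f g : ℕ → ℤ} :
    Pair 0 f g ↔ f 0 = g 0 ∧ (∀ k, f k = f 0) ∧ ∀ k, g k = g 0 := by
  constructor
  · intro h
    refine ⟨h.eq, fun k => ?_, fun k => ?_⟩
    · induction k with
      | zero => rfl
      | succ k ih => rw [h.constf k (Nat.zero_le k), ih]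
    · induction k with
      | zero => rfl
      | succ k ih => rw [h.constg k (Nat.zero_le k), ih]
  · rintro ⟨h0, h1, h2⟩
    exact ⟨by simp, by simp, fun k _ => by rw [h1, h1 k], fun k _ => by rw [h2, h2 k], by simp, h0⟩

theorem Pair.succ_iff {m : ℕ} {f g : ℕ → ℤ} :
    Pair (m + 1) f g ↔ f 0 < g 0 ∧ (f 1 = f 0 ∨ f 1 = f 0 - 1) ∧ (g 1 = g 0 ∨ g 1 = g 0 - 1) ∧
      Pair m (fun k => f (k + 1)) (fun k => g (k + 1)) := by
  constructor
  · intro h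
    exact ⟨h.lt 0 (by omega), h.stepf 0 (by omega), h.stepg 0 (by omega),
      fun k hk => h.stepf (k + 1) (by omega), fun k hk => h.stepg (k + 1) (by omega),
      fun k hk => h.constf (k + 1) (by omega), fun k hk => h.constg (k + 1) (by omega),
      fun k hk => h.lt (k + 1) (by omega), h.eq⟩
  · rintro ⟨h0, h1, h2, h⟩
    refine ⟨fun k hk => ?_, fun k hk => ?_, fun k hk => ?_, fun k hk => ?_, fun k hk => ?_, h.eq⟩
    all_goals cases k with
      | zero => first | assumption | omega
      | succ k => first
        | exact h.stepf k (by omega) | exact h.stepg k (by omega) | exact h.constf k (by omega)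
        | exact h.constg k (by omega) | exact h.lt k (by omega)

theorem Pair.f_eq {m : ℕ} {f g : ℕ → ℤ} (h : Pair m f g) (k : ℕ) : f k = f (min k m) := by
  induction k with
  | zero => simp
  | succ k ih =>
    rcases le_or_gt m k with hk | hk
    · rw [h.constf k hk, ih, min_eq_right hk, min_eq_right (by omega)]
    · rw [min_eq_left hk]

theorem Pair.g_eq {m : ℕ} {f g : ℕ → ℤ} (h : Pair m f g) (k : ℕ) : g k = g (min k m) := by
  induction k with
  | zero => simp
  | succ k ih =>
    rcases le_or_gt m k with hk | hk
    · rw [h.constg k hk, ih, min_eq_right hk, min_eq_right (by omega)]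
    · rw [min_eq_left hk]

/-- The pairs of paths with given starting points. -/
def pairSet (m : ℕ) (α β : ℤ) : Set (ℕ → ℤ × ℤ) :=
  {p | p 0 = (α, β) ∧ Pair m (fun k => (p k).1) (fun k => (p k).2)}

theorem encard_pairSet (m : ℕ) (α β : ℤ) : (pairSet m α β).encard = v m (β - α) := by
  induction m generalizing α β with
  | zero =>
    by_cases h : α = β
    · have : pairSet 0 α β = {fun _ => (α, β)} := by
        ext p
        rw [pairSet, Set.mem_ofPred_eq, Pair.zero_iff, Set.mem_singleton_iff]
        constructor
        · rintro ⟨h0, -, h1, h2⟩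
          funext k
          rw [h0] at h1 h2
          exact Prod.ext (h1 k) (h2 k)
        · rintro rfl
          simp [h]
      rw [this]
      simp [v, h]
    · have : pairSet 0 α β = ∅ := by
        rw [Set.eq_empty_iff_forall_notMem]
        rintro p ⟨h0, hp⟩
        have := hp.eq
        rw [h0] at this
        exact h this
      rw [this]
      have : β - α ≠ 0 := by omega
      simp [v, this]
  | succ m ih =>
    by_cases h : α < β
    · have : pairSet (m + 1) α β = {p | p 0 = (α, β) ∧ ∃ ε : Fin 2 × Fin 2, (fun k => p (k + 1)) ∈
          pairSet m (α - (ε.1 : ℕ)) (β - (ε.2 : ℕ))} := by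
        ext p
        simp only [pairSet, Set.mem_ofPred_eq, Pair.succ_iff, Prod.exists, Fin.exists_fin_two]
        refine and_congr_right fun h0 => ?_
        simp [h0, Prod.ext_iff, h]
        tauto
      rw [this, encard_cons (A := ℤ × ℤ) (α, β)
        (fun ε : Fin 2 × Fin 2 => (α - ((ε.1 : ℕ) : ℤ), β - ((ε.2 : ℕ) : ℤ)))]
      · simp only [ih, Fintype.sum_prod_type, Fin.sum_univ_two, v]
        rw [if_pos (by omega)]
        simp only [Fin.val_zero, Fin.val_one, Nat.cast_zero, Nat.cast_one, sub_zero]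
        rw [show β - 1 - α = β - α - 1 by ring, show β - (α - 1) = β - α + 1 by ring,
          show β - 1 - (α - 1) = β - α by ring]
        push_cast
        ring
      · rintro ⟨a, b⟩ ⟨c, d⟩ h
        simp only [Prod.mk.injEq] at h ⊢
        omega
      · rintro ε F ⟨h, -⟩
        exact h
    · have : pairSet (m + 1) α β = ∅ := by
        rw [Set.eq_empty_iff_forall_notMem]
        rintro p ⟨h0, hp⟩
        have := hp.lt 0 (by omega)
        rw [h0] at this
        exact h this
      rw [this]
      have : ¬ (0 < β - α) := by omega
      simp [v, h]

/-- Two pairs of paths, the middle paths staying apart. -/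
structure Quad (i j : ℕ) (F : ℕ → Fin 4 → ℤ) : Prop where
  left : Pair i (fun k => F k 0) (fun k => F k 1)
  right : Pair j (fun k => F k 2) (fun k => F k 3)
  mid : ∀ k, k ≤ i → k ≤ j → F k 1 < F k 2

theorem vec4_ext {s t : Fin 4 → ℤ} : s = t ↔ s 0 = t 0 ∧ s 1 = t 1 ∧ s 2 = t 2 ∧ s 3 = t 3 := by
  rw [funext_iff]
  simp [Fin.forall_fin_succ]

/-- The quadruples of paths with a given starting point. -/
def quadSet (i j : ℕ) (s : Fin 4 → ℤ) : Set (ℕ → Fin 4 → ℤ) := {F | F 0 = s ∧ Quad i j F}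

theorem encard_quadSet_zero_left (j : ℕ) (s : Fin 4 → ℤ) :
    (quadSet 0 j s).encard = if s 0 = s 1 ∧ s 1 < s 2 then (v j (s 3 - s 2) : ℕ∞) else 0 := by
  split_ifs with h
  · rw [← encard_pairSet]
    have hinj : Function.Injective fun (p : ℕ → ℤ × ℤ) (k : ℕ) =>
        (![s 0, s 1, (p k).1, (p k).2] : Fin 4 → ℤ) := by
      intro p p' e
      funext k
      have := congrFun e k
      simp only [vec4_ext] at this
      simpa [Prod.ext_iff] using this
    rw [← hinj.encard_image]
    congr 1
    ext F
    constructor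
    · rintro ⟨h0, hF⟩
      have hl := Pair.zero_iff.1 hF.left
      rw [h0] at hl
      refine ⟨fun k => (F k 2, F k 3), ⟨by simp [h0], hF.right⟩, ?_⟩
      funext k
      rw [vec4_ext]
      simp [hl]
    · rintro ⟨p, ⟨h0, hp⟩, rfl⟩
      refine ⟨?_, ?_, ?_, ?_⟩
      · rw [vec4_ext]; simp [h0]
      · rw [Pair.zero_iff]; simp [h.1]
      · simpa using hp
      · intro k hk _
        obtain rfl : k = 0 := by omega
        simpa [h0] using h.2
  · rw [Set.encard_eq_zero, Set.eq_empty_iff_forall_notMem]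
    rintro F ⟨h0, hF⟩
    have := hF.left.eq
    have := hF.mid 0 le_rfl (Nat.zero_le j)
    rw [h0] at *
    tauto

theorem encard_quadSet_zero_right (i : ℕ) (s : Fin 4 → ℤ) :
    (quadSet i 0 s).encard = if s 1 < s 2 ∧ s 2 = s 3 then (v i (s 1 - s 0) : ℕ∞) else 0 := by
  split_ifs with h
  · rw [← encard_pairSet]
    have hinj : Function.Injective fun (p : ℕ → ℤ × ℤ) (k : ℕ) =>
        (![(p k).1, (p k).2, s 2, s 3] : Fin 4 → ℤ) := by
      intro p p' e
      funext k
      have := congrFun e k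
      simp only [vec4_ext] at this
      simpa [Prod.ext_iff] using this
    rw [← hinj.encard_image]
    congr 1
    ext F
    constructor
    · rintro ⟨h0, hF⟩
      have hl := Pair.zero_iff.1 hF.right
      rw [h0] at hl
      refine ⟨fun k => (F k 0, F k 1), ⟨by simp [h0], hF.left⟩, ?_⟩
      funext k
      rw [vec4_ext]
      simp [hl]
    · rintro ⟨p, ⟨h0, hp⟩, rfl⟩
      refine ⟨?_, ?_, ?_, ?_⟩
      · rw [vec4_ext]; simp [h0]
      · simpa using hp
      · rw [Pair.zero_iff]; simp [h.2]
      · intro k _ hk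
        obtain rfl : k = 0 := by omega
        simpa [h0] using h.1
  · rw [Set.encard_eq_zero, Set.eq_empty_iff_forall_notMem]
    rintro F ⟨h0, hF⟩
    have := hF.right.eq
    have := hF.mid 0 (Nat.zero_le i) le_rfl
    rw [h0] at *
    tauto

theorem quad_succ_iff {i j : ℕ} {F : ℕ → Fin 4 → ℤ} :
    Quad (i + 1) (j + 1) F ↔ (F 0 0 < F 0 1 ∧ F 0 1 < F 0 2 ∧ F 0 2 < F 0 3) ∧
      (∃ ε : Fin 4 → Fin 2, F 1 = dec (F 0) ε) ∧ Quad i j (fun k => F (k + 1)) := by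
  constructor
  · intro h
    have hl := Pair.succ_iff.1 h.left
    have hr := Pair.succ_iff.1 h.right
    refine ⟨⟨hl.1, h.mid 0 (by omega) (by omega), hr.1⟩, ?_, hl.2.2.2, hr.2.2.2,
      fun k h1 h2 => h.mid (k + 1) (by omega) (by omega)⟩
    refine ⟨fun r => if F 1 r = F 0 r then 0 else 1, ?_⟩
    rw [vec4_ext]
    simp only [dec]
    refine ⟨?_, ?_, ?_, ?_⟩ <;> split_ifs <;> simp <;> omega
  · rintro ⟨h0, ⟨ε, hε⟩, h⟩
    have hε' : ∀ r, F 1 r = F 0 r ∨ F 1 r = F 0 r - 1 := fun r => by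
      rw [hε, dec]; omega
    exact ⟨Pair.succ_iff.2 ⟨h0.1, hε' 0, hε' 1, h.left⟩, Pair.succ_iff.2 ⟨h0.2.2, hε' 2, hε' 3, h.right⟩,
      fun k h1 h2 => by
        cases k with
        | zero => exact h0.2.1
        | succ k => exact h.mid k (by omega) (by omega)⟩

theorem dec_injective (s : Fin 4 → ℤ) : Function.Injective (dec s) := by
  intro ε ε' h
  funext r
  have := congrFun h r
  unfold dec at this
  omega

theorem encard_quadSet (i j : ℕ) (s : Fin 4 → ℤ) : (quadSet i j s).encard = q i j s := by
  induction i generalizing j s with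
  | zero =>
    rw [encard_quadSet_zero_left, q]
    split_ifs <;> rfl
  | succ i ih =>
    cases j with
    | zero =>
      rw [encard_quadSet_zero_right, q]
      split_ifs <;> rfl
    | succ j =>
      rw [q]
      split_ifs with h
      · rw [Nat.cast_sum]
        simp only [← ih]
        rw [← encard_cons s (dec s) (dec_injective s) _ (fun ε F hF => hF.1)]
        congr 1
        ext F
        simp only [quadSet, Set.mem_ofPred_eq, quad_succ_iff]
        refine and_congr_right fun h0 => ?_
        rw [h0, zero_add]
        simp [h]
      · rw [Nat.cast_zero, Set.encard_eq_zero, Set.eq_empty_iff_forall_notMem]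
        rintro F ⟨h0, hF⟩
        apply h
        rw [← h0]
        exact (quad_succ_iff.1 hF).1
end ThreeChoice

namespace ThreeChoice

/-- One period of a closed self-avoiding walk. -/
structure Win (n : ℕ) (c : ℤ) (x l : ℤ → ℤ) : Prop where
  step : ∀ t, c ≤ t → t < c + 2 * n →
    (l (t + 1) = l t + 1 ∧ (x (t + 1) = x t ∨ x (t + 1) = x t + 1)) ∨
    (l (t + 1) = l t - 1 ∧ (x (t + 1) = x t ∨ x (t + 1) = x t - 1))
  close_x : x (c + 2 * n) = x c
  close_l : l (c + 2 * n) = l c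
  inj : ∀ s t, c ≤ s → s < c + 2 * n → c ≤ t → t < c + 2 * n → x s = x t → l s = l t → s = t

/-- Periodic extension. -/
def periodize (n : ℕ) (c : ℤ) (x : ℤ → ℤ) : ℤ → ℤ := fun t => x (c + (t - c) % (2 * n))

theorem periodize_apply {n : ℕ} {c : ℤ} {x : ℤ → ℤ} (hc : x (c + 2 * n) = x c) {t : ℤ} (h1 : c ≤ t)
    (h2 : t ≤ c + 2 * n) : periodize n c x t = x t := by
  unfold periodize
  rcases eq_or_lt_of_le h2 with rfl | h2
  · simp [hc]
  · rw [Int.emod_eq_of_lt (by omega) (by omega)]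
    congr 1
    ring

theorem exists_mem_window {n : ℕ} (hn : 1 ≤ n) (c t : ℤ) :
    ∃ s, c ≤ s ∧ s < c + 2 * n ∧ (2 * n : ℤ) ∣ t - s := by
  refine ⟨c + (t - c) % (2 * n), ?_, ?_, ?_⟩
  · have := Int.emod_nonneg (t - c) (b := 2 * n) (by omega)
    omega
  · have := Int.emod_lt_of_pos (t - c) (b := 2 * n) (by omega)
    omega
  · rw [← sub_sub]
    exact Int.dvd_self_sub_emod

theorem periodize_congr {n : ℕ} {c : ℤ} {x : ℤ → ℤ} {s t : ℤ} (h : (2 * n : ℤ) ∣ t - s) :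
    periodize n c x t = periodize n c x s := by
  unfold periodize
  have : (t - c) % (2 * n) = (s - c) % (2 * n) := by
    refine (Int.modEq_iff_dvd.2 ?_).symm
    rwa [sub_sub_sub_cancel_right]
  rw [this]

theorem Win.cw {n : ℕ} {c : ℤ} {x l : ℤ → ℤ} (hn : 1 ≤ n) (h : Win n c x l) :
    CW n (periodize n c x) (periodize n c l) where
  per_X t := periodize_congr (by simp)
  per_L t := periodize_congr (by simp)
  step t := by
    obtain ⟨s, h1, h2, hd⟩ := exists_mem_window hn c t
    have hd' : (2 * n : ℤ) ∣ t + 1 - (s + 1) := by simpa using hd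
    rw [periodize_congr hd, periodize_congr hd, periodize_congr hd', periodize_congr hd',
      periodize_apply h.close_x h1 h2.le, periodize_apply h.close_l h1 h2.le,
      periodize_apply h.close_x (by omega) (by omega),
      periodize_apply h.close_l (by omega) (by omega)]
    exact h.step s h1 h2
  inj s t hx hl := by
    obtain ⟨s', h1, h2, hd⟩ := exists_mem_window hn c s
    obtain ⟨t', h3, h4, hd'⟩ := exists_mem_window hn c t
    rw [periodize_congr hd, periodize_congr hd', periodize_apply h.close_x h1 h2.le,
      periodize_apply h.close_x h3 h4.le] at hx
    rw [periodize_congr hd, periodize_congr hd', periodize_apply h.close_l h1 h2.le,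
      periodize_apply h.close_l h3 h4.le] at hl
    obtain rfl := h.inj s' t' h1 h2 h3 h4 hx hl
    have := dvd_sub hd hd'
    rwa [sub_sub_sub_cancel_right] at this

theorem Turn.congr {n : ℕ} {X L : ℤ → ℤ} (h : CW n X L) {s t : ℤ} (hd : (2 * n : ℤ) ∣ t - s)
    (hT : Turn X L s) : Turn X L t := by
  have h1 := h.eq_of_dvd hd
  have h2 := h.eq_of_dvd (s := t + 1) (t := s + 1) (by simpa using hd)
  have h3 := h.eq_of_dvd (s := t - 1) (t := s - 1) (by simpa using hd)
  unfold Turn at *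
  rw [h1.1, h1.2, h2.1, h2.2, h3.1, h3.2]
  exact hT

/-- Periodic functions agreeing on a window are equal. -/
theorem CW.ext_window {n : ℕ} {X L X' L' : ℤ → ℤ} (hn : 1 ≤ n) (h : CW n X L) (h' : CW n X' L')
    (c : ℤ) (he : ∀ t, c ≤ t → t < c + 2 * n → X t = X' t ∧ L t = L' t) : X = X' ∧ L = L' := by
  constructor <;> funext t
  all_goals
    obtain ⟨s, h1, h2, hd⟩ := exists_mem_window hn c t
    have e1 := h.eq_of_dvd hd
    have e2 := h'.eq_of_dvd hd
    have e3 := he s h1 h2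
    omega

/-- The walks obtained from three-choice polygons. -/
def walks (n : ℕ) : Set ((ℤ → ℤ) × (ℤ → ℤ)) :=
  {p | CW n p.1 p.2 ∧ p.1 0 = 0 ∧ p.2 0 = 0 ∧ ∀ t, ¬ (2 * n : ℤ) ∣ t → Turn p.1 p.2 t}

/-- Time-indexed vertices of a polygon. -/
def vtx {n : ℕ} (w : Fin (2 * n + 1) → ℤ × ℤ) (t : ℤ) : ℤ × ℤ := w (Fin.ofNat _ t.toNat)

theorem vtx_eq {n : ℕ} (w : Fin (2 * n + 1) → ℤ × ℤ) {t : ℤ} (h : t.toNat < 2 * n + 1) :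
    vtx w t = w ⟨t.toNat, h⟩ := by
  unfold vtx
  congr 1
  ext
  simp [Fin.ofNat, Nat.mod_eq_of_lt h]

theorem walkStep_eq {n : ℕ} (w : Fin (2 * n + 1) → ℤ × ℤ) {t : ℤ} (h0 : 0 ≤ t) (h : t.toNat < 2 * n) :
    walkStep (2 * n) w ⟨t.toNat, h⟩ = vtx w (t + 1) - vtx w t := by
  rw [walkStep, vtx_eq w (by omega), vtx_eq w (by omega)]
  congr 2
  ext
  simp
  omega

/-- The three-choice condition at one vertex, in terms of coordinates. -/
theorem polygon_iff {n : ℕ} (w : Fin (2 * n + 1) → ℤ × ℤ) :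
    IsThreeChoicePolygon n w ↔ vtx w 0 = (0, 0) ∧ vtx w (2 * n) = (0, 0) ∧
      (∀ t : ℤ, 0 ≤ t → t < 2 * n →
        vtx w (t + 1) - vtx w t ∈ ({(1, 0), (-1, 0), (0, 1), (0, -1)} : Set (ℤ × ℤ))) ∧
      (∀ s t : ℤ, 0 ≤ s → s < 2 * n → 0 ≤ t → t < 2 * n → vtx w s = vtx w t → s = t) ∧
      (∀ t : ℤ, 0 < t → t < 2 * n →
        (vtx w t - vtx w (t - 1) = (1, 0) → vtx w (t + 1) - vtx w t = (1, 0) ∨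
          vtx w (t + 1) - vtx w t = (0, 1)) ∧
        (vtx w t - vtx w (t - 1) = (-1, 0) → vtx w (t + 1) - vtx w t = (-1, 0) ∨
          vtx w (t + 1) - vtx w t = (0, -1))) := by
  unfold IsThreeChoicePolygon
  have hl : vtx w (2 * n) = w (Fin.last (2 * n)) := by
    rw [vtx_eq w (by omega)]
    congr 1
  have h0 : vtx w 0 = w 0 := by
    rw [vtx_eq w (by simp)]
    rfl
  have hcs (i : Fin (2 * n)) : w i.castSucc = vtx w (i : ℕ) := by
    rw [vtx_eq w (by rw [Int.toNat_natCast]; omega)]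
    congr 1
  have hst (i : Fin (2 * n)) : walkStep (2 * n) w i = vtx w ((i : ℕ) + 1) - vtx w (i : ℕ) := by
    rw [← walkStep_eq w (by omega) (by simp)]
    congr 1
  rw [hl, h0]
  refine and_congr_right fun _ => and_congr_right fun _ => and_congr ?_ (and_congr ?_ ?_)
  · constructor
    · intro h t a b
      rw [← walkStep_eq w a (by omega)]
      exact h _
    · intro h i
      rw [hst]
      exact h _ (by omega) (by omega)
  · constructor
    · intro h s t a b c d e
      have := h ⟨s.toNat, by omega⟩ ⟨t.toNat, by omega⟩ (by
        rw [hcs, hcs]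
        simpa [a, c] using e)
      simp only [Fin.mk.injEq] at this
      omega
    · intro h i j e
      rw [hcs, hcs] at e
      have := h _ _ (by omega) (by omega) (by omega) (by omega) e
      ext
      omega
  · unfold ThreeChoiceCond
    constructor
    · intro h t a b
      have := h ⟨(t - 1).toNat, by omega⟩ ⟨t.toNat, by omega⟩ (by simp; omega)
      rw [walkStep_eq w (by omega), walkStep_eq w (by omega), sub_add_cancel] at this
      exact this
    · intro h i j e
      rw [hst, hst]
      have := h (j : ℕ) (by omega) (by omega)
      rw [show ((j : ℕ) : ℤ) - 1 = (i : ℕ) by omega] at this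
      rw [show ((i : ℕ) : ℤ) + 1 = (j : ℕ) by omega]
      exact this

theorem mem_steps {a b : ℤ × ℤ} : a - b ∈ ({(1, 0), (-1, 0), (0, 1), (0, -1)} : Set (ℤ × ℤ)) ↔
    (a.1 = b.1 + 1 ∧ a.2 = b.2) ∨ (a.1 = b.1 - 1 ∧ a.2 = b.2) ∨ (a.1 = b.1 ∧ a.2 = b.2 + 1) ∨
      (a.1 = b.1 ∧ a.2 = b.2 - 1) := by
  simp only [Set.mem_insert_iff, Set.mem_singleton_iff, Prod.ext_iff, Prod.fst_sub, Prod.snd_sub]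
  omega

theorem encard_eq_of_bijOn {α β : Type*} {s : Set α} {t : Set β} {f : α → β} (h : Set.BijOn f s t) :
    s.encard = t.encard := by
  rw [← h.image_eq, h.injOn.encard_image]

/-- The periodic extension of a polygon. -/
def walkOf {n : ℕ} (w : Fin (2 * n + 1) → ℤ × ℤ) : (ℤ → ℤ) × (ℤ → ℤ) :=
  (periodize n 0 fun t => (vtx w t).1, periodize n 0 fun t => (vtx w t).1 + (vtx w t).2)

theorem walkOf_apply {n : ℕ} {w : Fin (2 * n + 1) → ℤ × ℤ} (hw : IsThreeChoicePolygon n w) {t : ℤ}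
    (h0 : 0 ≤ t) (h1 : t ≤ 2 * n) :
    (walkOf w).1 t = (vtx w t).1 ∧ (walkOf w).2 t = (vtx w t).1 + (vtx w t).2 := by
  obtain ⟨e0, e1, -⟩ := (polygon_iff w).1 hw
  exact ⟨periodize_apply (x := fun t => (vtx w t).1) (by simp [e0, e1]) h0 (by simpa using h1),
    periodize_apply (x := fun t => (vtx w t).1 + (vtx w t).2) (by simp [e0, e1]) h0
      (by simpa using h1)⟩

theorem walkOf_mem {n : ℕ} (hn : 2 ≤ n) {w : Fin (2 * n + 1) → ℤ × ℤ}
    (hw : IsThreeChoicePolygon n w) : walkOf w ∈ walks n := by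
  obtain ⟨e0, e1, hs, hi, hc⟩ := (polygon_iff w).1 hw
  have hW : Win n 0 (fun t => (vtx w t).1) (fun t => (vtx w t).1 + (vtx w t).2) := by
    refine ⟨fun t a b => ?_, by simp [e0, e1], by simp [e0, e1], fun s t a b c d e f => ?_⟩
    · have := mem_steps.1 (hs t a (by omega))
      omega
    · exact hi s t a (by omega) c (by omega) (Prod.ext e (by omega))
  have hcw : CW n (walkOf w).1 (walkOf w).2 := hW.cw (by omega)
  refine ⟨hcw, ?_, ?_, fun t ht => ?_⟩
  · rw [(walkOf_apply hw le_rfl (by omega)).1, e0]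
  · rw [(walkOf_apply hw le_rfl (by omega)).2, e0]; rfl
  · obtain ⟨s, h1, h2, hd⟩ := exists_mem_window (n := n) (by omega) 0 t
    have hs0 : s ≠ 0 := by
      rintro rfl
      exact ht (by simpa using hd)
    refine Turn.congr hcw hd ?_
    obtain ⟨a1, a2⟩ := walkOf_apply hw (t := s) (by omega) (by omega)
    obtain ⟨b1, b2⟩ := walkOf_apply hw (t := s - 1) (by omega) (by omega)
    obtain ⟨c1, c2⟩ := walkOf_apply hw (t := s + 1) (by omega) (by omega)
    have hne : ¬ ((vtx w (s - 1)).1 = (vtx w (s + 1)).1 ∧ (vtx w (s - 1)).2 = (vtx w (s + 1)).2) := by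
      intro h
      refine not_dvd_of_lt (n := n) (x := s - 1 - (s + 1)) (by omega) (by omega) (by omega)
        (hcw.inj _ _ (by omega) (by omega))
    have t1 := mem_steps.1 (hs (s - 1) (by omega) (by omega))
    have t2 := mem_steps.1 (hs s (by omega) (by omega))
    rw [sub_add_cancel] at t1
    have t3 := hc s (by omega) (by omega)
    simp only [Prod.ext_iff, Prod.fst_sub, Prod.snd_sub] at t3
    unfold Turn
    rw [a1, a2, b1, b2, c1, c2]
    clear hd hW hi hs hc
    omega

theorem encard_polygons {n : ℕ} (hn : 2 ≤ n) :
    {w : Fin (2 * n + 1) → ℤ × ℤ | IsThreeChoicePolygon n w}.encard = (walks n).encard := by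
  refine encard_eq_of_bijOn (f := walkOf) ⟨fun w hw => walkOf_mem hn hw, ?_, ?_⟩
  · intro w hw w' hw' he
    funext i
    have e1 := walkOf_apply hw (t := (i : ℕ)) (by omega) (by omega)
    have e2 := walkOf_apply hw' (t := (i : ℕ)) (by omega) (by omega)
    rw [he] at e1
    have hv (w : Fin (2 * n + 1) → ℤ × ℤ) : vtx w (i : ℕ) = w i := by
      rw [vtx_eq w (by rw [Int.toNat_natCast]; omega)]
      congr 1
    rw [hv] at e1 e2
    exact Prod.ext (by omega) (by omega)
  · rintro ⟨X, L⟩ ⟨h, hX, hL, hT⟩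
    simp only at h hX hL hT
    have hv (t : ℤ) (h0 : 0 ≤ t) (h1 : t ≤ 2 * n) :
        vtx (fun i : Fin (2 * n + 1) => (X (i : ℕ), L (i : ℕ) - X (i : ℕ))) t = (X t, L t - X t) := by
      rw [vtx_eq _ (by omega)]
      simp [h0]
    have h2n := h.eq_of_dvd (s := 2 * n) (t := 0) (by simp)
    have hw : IsThreeChoicePolygon n
        (fun i : Fin (2 * n + 1) => (X (i : ℕ), L (i : ℕ) - X (i : ℕ))) := by
      refine (polygon_iff _).2 ⟨?_, ?_, fun t a b => ?_, fun s t a b c d e => ?_, fun t a b => ?_⟩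
      · rw [hv _ (by omega) (by omega)]; simp [hX, hL]
      · rw [hv _ (by omega) (by omega)]; simp [hX, hL, h2n]
      · rw [hv _ (by omega) (by omega), hv _ (by omega) (by omega), mem_steps]
        have := h.step t
        dsimp only
        omega
      · rw [hv _ (by omega) (by omega), hv _ (by omega) (by omega), Prod.ext_iff] at e
        have := h.inj s t (by exact e.1) (by have := e.1; have := e.2; dsimp only at *; omega)
        by_contra hne
        exact not_dvd_of_lt (by omega) (by omega) (by omega) this
      · rw [hv _ (by omega) (by omega), hv _ (by omega) (by omega), hv _ (by omega) (by omega)]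
        have t1 := hT t (not_dvd_of_lt (by omega) (by omega) (by omega))
        have t2 := h.step t
        have t3 := h.step (t - 1)
        rw [sub_add_cancel] at t3
        simp only [Prod.ext_iff, Prod.fst_sub, Prod.snd_sub]
        unfold Turn at t1
        clear hT
        omega
    refine ⟨_, Set.mem_ofPred.2 hw, ?_⟩
    have := CW.ext_window (n := n) (by omega) (walkOf_mem hn hw).1 h 0 (fun t a b => by
      have e := walkOf_apply hw (t := t) (by omega) (by omega)
      rw [hv _ (by omega) (by omega)] at e
      dsimp only at e
      omega)
    exact Prod.ext this.1 this.2
end ThreeChoice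

namespace ThreeChoice

theorem encard_eq_sum_fiber {α ι : Type*} (s : Finset ι) (Z : Set α) (P : ι → α → Prop)
    (hex : ∀ z ∈ Z, ∃ i ∈ s, P i z)
    (huniq : ∀ z ∈ Z, ∀ i ∈ s, ∀ j ∈ s, P i z → P j z → i = j) :
    Z.encard = ∑ i ∈ s, {z | z ∈ Z ∧ P i z}.encard := by
  have : Z = ⋃ i : s, {z | z ∈ Z ∧ P i z} := by
    ext z
    simp only [Set.mem_iUnion, Set.mem_ofPred_eq, Subtype.exists]
    constructor
    · intro hz
      obtain ⟨i, hi, hP⟩ := hex z hz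
      exact ⟨i, hi, hz, hP⟩
    · rintro ⟨i, -, hz, -⟩
      exact hz
  conv_lhs => rw [this]
  rw [Set.encard_iUnion_of_finite, finsum_eq_sum_of_fintype, Finset.univ_eq_attach,
    Finset.sum_attach s fun i => {z | z ∈ Z ∧ P i z}.encard]
  rintro ⟨i, hi⟩ ⟨j, hj⟩ hij
  rw [Function.onFun, Set.disjoint_left]
  rintro z ⟨hz, h1⟩ ⟨-, h2⟩
  exact hij (Subtype.ext (huniq z hz i hi j hj h1 h2))

theorem CW.shift {n : ℕ} {X L : ℤ → ℤ} (h : CW n X L) (a b c : ℤ) :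
    CW n (fun t => X (t + a) - b) (fun t => L (t + a) - c) where
  per_X t := by rw [add_right_comm, h.per_X]
  per_L t := by rw [add_right_comm, h.per_L]
  step t := by
    have := h.step (t + a)
    rw [add_right_comm]
    omega
  inj s t hx hl := by
    have := h.inj (s + a) (t + a) (by omega) (by omega)
    rwa [add_sub_add_right_eq_sub] at this

theorem Turn.shift {X L : ℤ → ℤ} {t : ℤ} (a b c : ℤ) (h : Turn X L (t + a)) :
    Turn (fun t => X (t + a) - b) (fun t => L (t + a) - c) t := by
  unfold Turn at *
  dsimp only
  rw [show t - 1 + a = t + a - 1 by ring, show t + 1 + a = t + a + 1 by ring]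
  omega

/-- Regular walks with their peak at the origin. -/
def peaked (n : ℕ) : Set ((ℤ → ℤ) × (ℤ → ℤ)) :=
  {p | CW n p.1 p.2 ∧ p.1 0 = 0 ∧ p.2 0 = 0 ∧ (∀ t, Turn p.1 p.2 t) ∧
    ∀ k : ℤ, 0 ≤ k → k ≤ n → p.2 k = -k ∧ p.2 (-k) = -k}

/-- Regular walks. -/
def regular (n : ℕ) : Set ((ℤ → ℤ) × (ℤ → ℤ)) :=
  {p | CW n p.1 p.2 ∧ p.1 0 = 0 ∧ p.2 0 = 0 ∧ ∀ t, Turn p.1 p.2 t}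

theorem encard_regular_fiber (n : ℕ) (a : ℤ) :
    {p | p ∈ regular n ∧ ∀ k : ℤ, 0 ≤ k → k ≤ n →
      p.2 (a + k) = p.2 a - k ∧ p.2 (a - k) = p.2 a - k}.encard = (peaked n).encard := by
  refine encard_eq_of_bijOn
    (f := fun p => (fun t => p.1 (t + a) - p.1 a, fun t => p.2 (t + a) - p.2 a)) ⟨?_, ?_, ?_⟩
  · rintro ⟨X, L⟩ ⟨⟨h, hX, hL, hT⟩, hk⟩
    refine ⟨h.shift _ _ _, by simp, by simp, fun t => (hT _).shift _ _ _, fun k k0 k1 => ?_⟩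
    have := hk k k0 k1
    dsimp only at *
    rw [add_comm k, neg_add_eq_sub]
    omega
  · rintro ⟨X, L⟩ ⟨⟨h, hX, hL, hT⟩, hk⟩ ⟨X', L'⟩ ⟨⟨h', hX', hL', hT'⟩, hk'⟩ e
    simp only [Prod.mk.injEq, funext_iff] at e hX hX' hL hL' ⊢
    constructor <;> intro t
    · have := e.1 (t - a)
      have := e.1 (-a)
      simp only [sub_add_cancel, neg_add_cancel] at *
      omega
    · have := e.2 (t - a)
      have := e.2 (-a)
      simp only [sub_add_cancel, neg_add_cancel] at *
      omega
  · rintro ⟨X, L⟩ ⟨h, hX, hL, hT, hk⟩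
    dsimp only at *
    refine ⟨(fun t => X (t + -a) - X (-a), fun t => L (t + -a) - L (-a)),
      ⟨⟨h.shift _ _ _, by simp, by simp, fun t => (hT _).shift _ _ _⟩, fun k k0 k1 => ?_⟩, ?_⟩
    · have := hk k k0 k1
      dsimp only
      rw [show a + k + -a = k by ring, show a - k + -a = -k by ring, add_neg_cancel]
      omega
    · simp only [add_neg_cancel_right, add_neg_cancel, hX, hL]
      simp

theorem encard_regular (n : ℕ) (hn : 1 ≤ n) :
    (regular n).encard = 2 * n * (peaked n).encard := by
  rw [encard_eq_sum_fiber (Finset.range (2 * n)) (regular n) (fun i p => ∀ k : ℤ, 0 ≤ k → k ≤ n →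
      p.2 ((i : ℤ) + k) = p.2 i - k ∧ p.2 ((i : ℤ) - k) = p.2 i - k)]
  · rw [Finset.sum_congr rfl fun (i : ℕ) _ => encard_regular_fiber n (i : ℤ)]
    simp
  · rintro ⟨X, L⟩ ⟨h, hX, hL, hT⟩
    obtain ⟨p, h0, h1, hp⟩ := h.regular_structure hn hT
    refine ⟨p.toNat, by rw [Finset.mem_range]; omega, ?_⟩
    rwa [Int.toNat_of_nonneg h0]
  · rintro ⟨X, L⟩ ⟨h, hX, hL, hT⟩ i hi j hj h1 h2
    dsimp only at *
    rw [Finset.mem_range] at hi hj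
    wlog hij : i ≤ j generalizing i j
    · exact (this j hj i hi h2 h1 (by omega)).symm
    rcases le_or_gt (j - i) n with hd | hd
    · have a := (h1 (j - i) (by omega) (by omega)).1
      have b := (h2 (j - i) (by omega) (by omega)).2
      rw [show (i : ℤ) + (j - i) = j by ring] at a
      rw [show (j : ℤ) - (j - i) = i by ring] at b
      omega
    · have a := (h1 (i + 2 * n - j) (by omega) (by omega)).2
      have b := (h2 (i + 2 * n - j) (by omega) (by omega)).1
      rw [show (i : ℤ) - (i + 2 * n - j) = j - 2 * n by ring] at a
      rw [show (j : ℤ) + (i + 2 * n - j) = i + 2 * n by ring, h.per_L] at b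
      have := h.per_L (j - 2 * n)
      rw [sub_add_cancel] at this
      omega

/-- The two sides of a regular walk. -/
def sides (n : ℕ) (p : (ℤ → ℤ) × (ℤ → ℤ)) (k : ℕ) : ℤ × ℤ :=
  (p.1 (1 + (min k (n - 1) : ℕ)), p.1 (-1 - (min k (n - 1) : ℕ)))

/-- One period of the regular walk with given sides. -/
def ofSides (P : ℕ → ℤ × ℤ) (t : ℤ) : ℤ :=
  if t < 0 then (P (-1 - t).toNat).2 else if t = 0 then 0 else (P (t - 1).toNat).1

theorem win_ofSides {n : ℕ} (hn : 2 ≤ n) {P : ℕ → ℤ × ℤ} (hP : P ∈ pairSet (n - 1) (-1) 0) :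
    Win n (-n) (ofSides P) (fun t => -|t|) := by
  obtain ⟨h0, hP⟩ := hP
  refine ⟨fun t a b => ?_, ?_, ?_, fun s t a b c d e f => ?_⟩
  · rcases lt_trichotomy t (-1) with h | rfl | h
    · unfold ofSides
      rw [abs_of_neg (by omega), abs_of_neg (by omega), if_pos (by omega), if_pos (by omega)]
      have := hP.stepg (-1 - (t + 1)).toNat (by omega)
      rw [show (-1 - (t + 1)).toNat + 1 = (-1 - t).toNat by omega] at this
      omega
    · simp [ofSides, h0]
    · rcases eq_or_lt_of_le (show 0 ≤ t by omega) with rfl | h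
      · simp [ofSides, h0]
      · unfold ofSides
        rw [abs_of_pos (by omega), abs_of_pos (by omega), if_neg (by omega), if_neg (by omega),
          if_neg (by omega), if_neg (by omega)]
        have := hP.stepf (t - 1).toNat (by omega)
        rw [show (t - 1).toNat + 1 = (t + 1 - 1).toNat by omega] at this
        omega
  · have := hP.eq
    unfold ofSides
    rw [if_neg (by omega), if_neg (by omega), if_pos (by omega),
      show (-(n : ℤ) + 2 * n - 1).toNat = n - 1 by omega,
      show (-1 - -(n : ℤ)).toNat = n - 1 by omega]
    exact this
  · rw [show -(n : ℤ) + 2 * n = n by ring, abs_neg]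
  · rw [neg_inj, abs_eq_abs] at f
    rcases f with rfl | rfl
    · rfl
    · rcases lt_trichotomy t 0 with h | rfl | h
      · have := hP.lt (-t - 1).toNat (by omega)
        unfold ofSides at e
        rw [if_neg (by omega), if_neg (by omega), if_pos (by omega)] at e
        rw [show -1 - t = -t - 1 by ring] at e
        omega
      · simp
      · have := hP.lt (t - 1).toNat (by omega)
        unfold ofSides at e
        rw [if_pos (by omega), if_neg (by omega), if_neg (by omega)] at e
        rw [show -1 - -t = t - 1 by ring] at e
        omega

theorem encard_peaked (n : ℕ) (hn : 2 ≤ n) : (peaked n).encard = v (n - 1) 1 := by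
  have := encard_pairSet (n - 1) (-1) 0
  rw [sub_neg_eq_add, zero_add] at this
  rw [← this]
  refine encard_eq_of_bijOn (f := sides n) ⟨?_, ?_, ?_⟩
  · rintro ⟨X, L⟩ ⟨h, hX, hL, hT, hk⟩
    dsimp only at *
    have h1 := hk 1 (by omega) (by omega)
    have hT0 := hT 0
    unfold Turn at hT0
    simp [hL, hX, h1] at hT0
    have sl : Strand X L (-n) (-1) (fun l => 0 + l) := by
      refine h.strand_up fun l a b => ?_
      have := hk (-l) (by omega) (by omega)
      rw [neg_neg] at this
      rw [zero_add]; omega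
    have sr : Strand X L (-n) (-1) (fun l => 0 - l) := by
      refine h.strand_dn fun l a b => ?_
      have := hk (-l) (by omega) (by omega)
      rw [zero_sub]; omega
    refine ⟨?_, fun k hk => ?_, fun k hk => ?_, fun k hk => ?_, fun k hk => ?_, fun k hk => ?_, ?_⟩
    · simp [sides]
      omega
    · simp only [sides]
      rw [min_eq_left (by omega), min_eq_left (by omega)]
      have := sr.2 (-1 - ((k : ℤ) + 1)) (by omega) (by omega)
      dsimp only at this
      rw [show 0 - (-1 - ((k : ℤ) + 1) + 1) = 1 + k by ring,
        show 0 - (-1 - ((k : ℤ) + 1)) = 1 + (k + 1) by ring] at this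
      push_cast
      omega
    · simp only [sides]
      rw [min_eq_left (by omega), min_eq_left (by omega)]
      have := sl.2 (-1 - ((k : ℤ) + 1)) (by omega) (by omega)
      dsimp only at this
      rw [show 0 + (-1 - ((k : ℤ) + 1) + 1) = -1 - k by ring,
        show 0 + (-1 - ((k : ℤ) + 1)) = -1 - (k + 1) by ring] at this
      push_cast
      omega
    · simp only [sides]
      rw [min_eq_right (by omega), min_eq_right (by omega)]
    · simp only [sides]
      rw [min_eq_right (by omega), min_eq_right (by omega)]
    · simp only [sides]
      rw [min_eq_left (by omega)]
      have := h.order (sr.sub (lo' := -1 - k) (hi' := -1) (by omega) le_rfl)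
        (sl.sub (lo' := -1 - k) (hi' := -1) (by omega) le_rfl)
        (fun l a b => not_dvd_of_lt (by omega) (by omega) (by omega)) (-1) (-1 - k) (by omega) (by omega)
        (by simp; omega)
      rwa [show 0 - (-1 - (k : ℤ)) = 1 + k by ring, zero_add] at this
    · simp only [sides, min_self]
      refine (h.eq_of_dvd ?_).1
      refine ⟨1, ?_⟩
      push_cast [show 1 ≤ n by omega]
      ring
  · rintro ⟨X, L⟩ ⟨h, hX, hL, hT, hk⟩ ⟨X', L'⟩ ⟨h', hX', hL', hT', hk'⟩ e
    dsimp only at *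
    rw [Prod.mk.injEq]
    refine CW.ext_window (by omega) h h' (-n) fun t a b => ?_
    rw [funext_iff] at e
    simp only [sides, Prod.mk.injEq] at e
    rcases lt_trichotomy t 0 with ht | rfl | ht
    · have := (e (-1 - t).toNat).2
      have h3 := hk (-t) (by omega) (by omega)
      have h4 := hk' (-t) (by omega) (by omega)
      rw [min_eq_left (by omega), show -1 - (((-1 - t).toNat : ℕ) : ℤ) = t by omega] at this
      rw [neg_neg] at h3 h4
      omega
    · omega
    · have := (e (t - 1).toNat).1
      have h3 := hk t (by omega) (by omega)
      have h4 := hk' t (by omega) (by omega)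
      rw [min_eq_left (by omega), show 1 + (((t - 1).toNat : ℕ) : ℤ) = t by omega] at this
      omega
  · intro P hP
    have hw := win_ofSides hn hP
    have hc := hw.cw (by omega)
    have hx (t : ℤ) (a : -n ≤ t) (b : t ≤ n) :=
      periodize_apply hw.close_x (t := t) a (show t ≤ -(n : ℤ) + 2 * n by omega)
    have hl (t : ℤ) (a : -n ≤ t) (b : t ≤ n) :=
      periodize_apply (x := fun t => -|t|) hw.close_l (t := t) a (show t ≤ -(n : ℤ) + 2 * n by omega)
    obtain ⟨h0, hP⟩ := hP
    refine ⟨(periodize n (-n) (ofSides P), periodize n (-n) fun t => -|t|),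
      ⟨hc, ?_, ?_, fun t => ?_, fun k a b => ?_⟩, ?_⟩
    · dsimp only
      rw [hx _ (by omega) (by omega)]
      simp [ofSides]
    · dsimp only
      rw [hl _ (by omega) (by omega)]
      simp
    · obtain ⟨s, h1, h2, hd⟩ := exists_mem_window (n := n) (by omega) (-n) t
      refine Turn.congr hc hd ?_
      rcases eq_or_lt_of_le h1 with rfl | h1
      · have e1 := hc.eq_of_dvd (s := -(n : ℤ) - 1) (t := n - 1) ⟨-1, by ring⟩
        unfold Turn
        rw [e1.1, e1.2, hx _ (by omega) (by omega), hx _ (by omega) (by omega),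
          hx _ (by omega) (by omega), hl _ (by omega) (by omega), hl _ (by omega) (by omega),
          hl _ (by omega) (by omega), abs_of_pos (by omega), abs_of_neg (by omega),
          abs_of_neg (by omega)]
        unfold ofSides
        rw [if_neg (by omega), if_neg (by omega), if_pos (by omega), if_pos (by omega)]
        have a1 := hP.eq
        have a2 := hP.lt (n - 2) (by omega)
        have a3 := hP.stepf (n - 2) (by omega)
        have a4 := hP.stepg (n - 2) (by omega)
        rw [show n - 2 + 1 = n - 1 by omega] at a3 a4
        rw [show ((n : ℤ) - 1 - 1).toNat = n - 2 by omega,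
          show (-1 - -(n : ℤ)).toNat = n - 1 by omega,
          show (-1 - (-(n : ℤ) + 1)).toNat = n - 2 by omega]
        clear hw hc hx hl e1
        omega
      · unfold Turn
        rw [hx _ (by omega) (by omega), hx _ (by omega) (by omega),
          hx _ (by omega) (by omega), hl _ (by omega) (by omega), hl _ (by omega) (by omega),
          hl _ (by omega) (by omega)]
        rcases lt_trichotomy s 0 with hs | rfl | hs
        · rw [abs_of_neg (a := s) (by omega), abs_of_neg (a := s - 1) (by omega),
            abs_of_nonpos (a := s + 1) (by omega)]
          omega
        · simp [ofSides, h0]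
        · rw [abs_of_pos (a := s) (by omega), abs_of_pos (a := s + 1) (by omega),
            abs_of_nonneg (a := s - 1) (by omega)]
          omega
    · dsimp only
      rw [hl _ (by omega) (by omega), hl _ (by omega) (by omega), abs_of_nonneg a, abs_neg,
        abs_of_nonneg a]
      simp
    · funext k
      simp only [sides]
      rw [hx _ (by omega) (by omega), hx _ (by omega) (by omega)]
      unfold ofSides
      rw [if_neg (by omega), if_neg (by omega), if_pos (by omega)]
      have e1 := hP.f_eq k
      have e2 := hP.g_eq k
      rw [show (1 + ((min k (n - 1) : ℕ) : ℤ) - 1).toNat = min k (n - 1) by omega,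
        show (-1 - (-1 - ((min k (n - 1) : ℕ) : ℤ))).toNat = min k (n - 1) by omega, ← e1, ← e2]
end ThreeChoice

namespace ThreeChoice

/-- Walks with an exceptional peak at the origin. -/
def excWalks (n : ℕ) : Set ((ℤ → ℤ) × (ℤ → ℤ)) := {p | Exc n p.1 p.2 ∧ p.1 0 = 0}

/-- Central symmetry of walks. -/
def negate (p : (ℤ → ℤ) × (ℤ → ℤ)) : (ℤ → ℤ) × (ℤ → ℤ) := (fun t => -p.1 t, fun t => -p.2 t)

theorem negate_injective : Function.Injective negate := by
  intro p p' h
  simp only [negate, Prod.mk.injEq, funext_iff, neg_inj] at h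
  exact Prod.ext (funext h.1) (funext h.2)

theorem CW.negate {n : ℕ} {X L : ℤ → ℤ} (h : CW n X L) : CW n (fun t => -X t) (fun t => -L t) where
  per_X t := by rw [h.per_X]
  per_L t := by rw [h.per_L]
  step t := by
    have := h.step t
    omega
  inj s t hx hl := h.inj s t (neg_inj.1 hx) (neg_inj.1 hl)

theorem Turn.negate {X L : ℤ → ℤ} {t : ℤ} (h : Turn X L t) :
    Turn (fun t => -X t) (fun t => -L t) t := by
  unfold Turn at *
  dsimp only
  omega

theorem Exc.not_turn {n : ℕ} {X L : ℤ → ℤ} (h : Exc n X L) : ¬ Turn X L 0 := by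
  have := h.L0; have := h.Ln; have := h.Lp; have := h.Xn; have := h.Xp
  unfold Turn
  simp only [zero_sub, zero_add]
  omega

theorem walks_eq {n : ℕ} (hn : 2 ≤ n) : walks n = regular n ∪ (excWalks n ∪ negate '' excWalks n) := by
  have aux {X L : ℤ → ℤ} (h : CW n X L) (hX : X 0 = 0) (hL : L 0 = 0)
      (hT : ∀ t, ¬ (2 * n : ℤ) ∣ t → Turn X L t) (hn : ¬ Turn X L 0) (h1 : L 1 = -1) :
      (X, L) ∈ excWalks n := by
    have s1 := h.step 0
    have s2 := h.step (-1)
    have hne : ¬ (X (-1) = X 1 ∧ L (-1) = L 1) := fun e =>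
      not_dvd_of_lt (n := n) (by omega) (by omega) (by omega) (h.inj _ _ e.1 e.2)
    unfold Turn at hn
    rw [neg_add_cancel] at s2
    simp only [zero_sub, zero_add] at hn s1
    refine ⟨⟨h, hT, hL, ?_, ?_, ?_, ?_⟩, hX⟩ <;> clear hT <;> dsimp only at * <;> omega
  ext ⟨X, L⟩
  constructor
  · rintro ⟨h, hX, hL, hT⟩
    dsimp only at *
    by_cases h0 : Turn X L 0
    · refine Or.inl ⟨h, hX, hL, fun t => ?_⟩
      by_cases hd : (2 * n : ℤ) ∣ t
      · exact Turn.congr h (s := 0) (by simpa using hd) h0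
      · exact hT t hd
    · right
      have s1 := h.stepL 0
      rw [zero_add] at s1
      rcases s1 with s1 | s1
      · right
        refine ⟨ThreeChoice.negate (X, L), aux h.negate ?_ ?_ (fun t ht => (hT t ht).negate)
          (fun hT0 => h0 ?_) ?_, ?_⟩
        · simp [hX]
        · simp [hL]
        · simpa using hT0.negate
        · simp only; omega
        · simp [ThreeChoice.negate]
      · left
        exact aux h hX hL hT h0 (by omega)
  · rintro (⟨h, hX, hL, hT⟩ | ⟨h, hX⟩ | ⟨⟨X', L'⟩, ⟨h, hX⟩, he⟩)
    · exact ⟨h, hX, hL, fun t _ => hT t⟩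
    · exact ⟨h.toCW, hX, h.L0, h.turn⟩
    · rw [← he]
      refine ⟨h.toCW.negate, ?_, ?_, fun t ht => (h.turn t ht).negate⟩
      · simpa [negate] using hX
      · simpa [negate] using h.L0

theorem encard_walks {n : ℕ} (hn : 2 ≤ n) :
    (walks n).encard = 2 * n * v (n - 1) 1 + 2 * (excWalks n).encard := by
  rw [walks_eq hn, Set.encard_union_eq, Set.encard_union_eq, negate_injective.encard_image,
    encard_regular n (by omega), encard_peaked n hn, two_mul (excWalks n).encard]
  · rw [Set.disjoint_left]
    rintro _ ⟨h, -⟩ ⟨p, ⟨h', -⟩, rfl⟩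
    have := h.Lp
    have := h'.Lp
    simp only [negate] at *
    omega
  · rw [Set.disjoint_left]
    rintro p ⟨-, -, -, h⟩ (⟨h', -⟩ | ⟨p, ⟨h', -⟩, rfl⟩)
    · exact h'.not_turn (h 0)
    · apply h'.not_turn
      simpa [negate] using (h 0).negate
end ThreeChoice

namespace ThreeChoice

/-- The pieces of a walk with an exceptional peak at the origin: the four strands below the
origin level and the two strands above it. -/
structure Pieces (i j m : ℕ) (P : ℕ → ℤ × ℤ) (F : ℕ → Fin 4 → ℤ) : Prop where
  top : Pair m (fun k => (P k).1) (fun k => (P k).2)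
  left : Pair (i + 1) (fun k => F k 0) (fun k => F k 1)
  right : Pair (j + 1) (fun k => F k 2) (fun k => F k 3)
  mid : ∀ k, 1 ≤ k → k ≤ i + 1 → k ≤ j + 1 → F k 1 < F k 2
  fst : (P 0).1 = -F 0 3
  snd : (P 0).2 = -F 0 0
  root₁ : F 0 1 = 0
  root₂ : F 0 2 = 0
  next₁ : F 1 1 = -1
  next₂ : F 1 2 = 0

/-- The quadruples of strands below the origin level with given starting points. -/
def lowSet (i j p r : ℕ) : Set (ℕ → Fin 4 → ℤ) :=
  {F | F 0 = ![-1 - (p : ℤ), 0, 0, 1 + (r : ℤ)] ∧ ∃ ε : Fin 2 × Fin 2, (fun k => F (k + 1)) ∈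
    quadSet i j ![-1 - (p : ℤ) - ((ε.1 : ℕ) : ℤ), -1, 0, 1 + (r : ℤ) - ((ε.2 : ℕ) : ℤ)]}

/-- The number of quadruples of strands below the origin level with given starting points. -/
def low (i j p r : ℕ) : ℕ :=
  ∑ ε : Fin 2 × Fin 2, q i j ![-1 - (p : ℤ) - ((ε.1 : ℕ) : ℤ), -1, 0, 1 + (r : ℤ) - ((ε.2 : ℕ) : ℤ)]

theorem encard_lowSet (i j p r : ℕ) : (lowSet i j p r).encard = low i j p r := by
  unfold lowSet low
  rw [encard_cons (A := Fin 4 → ℤ) _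
    (fun ε : Fin 2 × Fin 2 => ![-1 - (p : ℤ) - ((ε.1 : ℕ) : ℤ), -1, 0, 1 + (r : ℤ) - ((ε.2 : ℕ) : ℤ)])]
  · simp only [encard_quadSet]
    push_cast
    rfl
  · rintro ⟨a, b⟩ ⟨c, d⟩ h
    rw [vec4_ext] at h
    simp at h
    simp only [Prod.mk.injEq]
    omega
  · rintro ε F ⟨h, -⟩
    exact h

theorem pieces_iff {i j m p r : ℕ} {P : ℕ → ℤ × ℤ} {F : ℕ → Fin 4 → ℤ} :
    P ∈ pairSet m (-(1 + r)) (1 + p) ∧ F ∈ lowSet i j p r ↔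
      Pieces i j m P F ∧ F 0 0 = -1 - p ∧ F 0 3 = 1 + r := by
  constructor
  · rintro ⟨⟨h0, hP⟩, hF0, ε, hF1, hF⟩
    rw [vec4_ext] at hF0 hF1
    simp at hF0 hF1
    refine ⟨⟨hP, ?_, ?_, ?_, ?_, ?_, ?_, ?_, ?_, ?_⟩, hF0.1, hF0.2.2.2⟩
    · exact Pair.succ_iff.2 ⟨by omega, by omega, by omega, hF.left⟩
    · exact Pair.succ_iff.2 ⟨by omega, by omega, by omega, hF.right⟩
    · intro k h1 h2 h3
      obtain ⟨k, rfl⟩ := Nat.exists_eq_add_of_le' h1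
      exact hF.mid k (by omega) (by omega)
    · rw [h0]; dsimp only; omega
    · rw [h0]; dsimp only; omega
    all_goals omega
  · rintro ⟨h, h0, h3⟩
    refine ⟨⟨Prod.ext ?_ ?_, h.top⟩, ?_, (if F 1 0 = F 0 0 then 0 else 1, if F 1 3 = F 0 3 then 0 else 1),
      ?_, ?_, ?_, ?_⟩
    · rw [h.fst, h3]
    · rw [h.snd, h0]; ring
    · rw [vec4_ext]
      simp [h0, h3, h.root₁, h.root₂]
    · have a := (Pair.succ_iff.1 h.left).2.1
      have b := (Pair.succ_iff.1 h.right).2.2.1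
      rw [vec4_ext]
      simp [h.next₁, h.next₂]
      constructor <;> split_ifs <;> simp <;> omega
    · exact (Pair.succ_iff.1 h.left).2.2.2
    · exact (Pair.succ_iff.1 h.right).2.2.2
    · intro k h1 h2
      exact h.mid (k + 1) (by omega) (by omega) (by omega)

theorem Pair.anti {m : ℕ} {f g : ℕ → ℤ} (h : Pair m f g) :
    (∀ k, f 0 - k ≤ f k ∧ f k ≤ f 0) ∧ ∀ k, g 0 - k ≤ g k ∧ g k ≤ g 0 := by
  constructor <;> intro k <;> induction k with
    | zero => simp
    | succ k ih =>
      rcases le_or_gt m k with hk | hk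
      · have := h.constf k hk
        have := h.constg k hk
        omega
      · have := h.stepf k hk
        have := h.stepg k hk
        omega

theorem Pieces.bounds {i j m : ℕ} {P : ℕ → ℤ × ℤ} {F : ℕ → Fin 4 → ℤ} (h : Pieces i j m P F) :
    -1 - i ≤ F 0 0 ∧ F 0 0 ≤ -1 ∧ 1 ≤ F 0 3 ∧ F 0 3 ≤ 1 + j := by
  have a := h.left.lt 0 (by omega)
  have b := h.right.lt 0 (by omega)
  have c := (Pair.succ_iff.1 h.left).2.2.2
  have d := (Pair.succ_iff.1 h.right).2.2.2
  have c1 := c.anti.2 i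
  have c2 := c.eq
  have c3 := h.left.anti.1 (i + 1)
  have d1 := h.right.anti.2 (j + 1)
  have d2 := d.eq
  have d3 := d.anti.1 j
  have := h.root₁
  have := h.root₂
  have := h.next₁
  have := h.next₂
  simp only [zero_add, Nat.cast_add, Nat.cast_one] at *
  omega

theorem encard_pieces (i j m N : ℕ) (hi : i < N) (hj : j < N) :
    {z : (ℕ → ℤ × ℤ) × (ℕ → Fin 4 → ℤ) | Pieces i j m z.1 z.2}.encard =
      ((∑ p ∈ Finset.range N, ∑ r ∈ Finset.range N, v m (p + r + 2) * low i j p r : ℕ) : ℕ∞) := by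
  simp only [Nat.cast_sum]
  rw [← Finset.sum_product' (f := fun p r : ℕ => ((v m ((p : ℤ) + (r : ℤ) + 2) * low i j p r : ℕ) : ℕ∞)),
    encard_eq_sum_fiber (Finset.range N ×ˢ Finset.range N) _
    (fun κ z => z.2 0 0 = -1 - (κ.1 : ℤ) ∧ z.2 0 3 = 1 + (κ.2 : ℤ))]
  · refine Finset.sum_congr rfl fun κ _ => ?_
    have : {z : (ℕ → ℤ × ℤ) × (ℕ → Fin 4 → ℤ) | z ∈ {z : (ℕ → ℤ × ℤ) × (ℕ → Fin 4 → ℤ) |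
        Pieces i j m z.1 z.2} ∧ z.2 0 0 = -1 - (κ.1 : ℤ) ∧ z.2 0 3 = 1 + (κ.2 : ℤ)} =
        pairSet m (-(1 + κ.2)) (1 + κ.1) ×ˢ lowSet i j κ.1 κ.2 := by
      ext z
      exact pieces_iff.symm
    rw [this, Set.encard_prod, encard_pairSet, encard_lowSet,
      show 1 + (κ.1 : ℤ) - -(1 + κ.2) = κ.1 + κ.2 + 2 by ring]
    push_cast
    rfl
  · rintro ⟨P, F⟩ h
    obtain ⟨a, b, c, d⟩ := Pieces.bounds h
    dsimp only at a b c d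
    refine ⟨((-1 - F 0 0).toNat, (F 0 3 - 1).toNat), ?_, ?_⟩
    · rw [Finset.mem_product, Finset.mem_range, Finset.mem_range]
      dsimp only
      omega
    · dsimp only
      omega
  · rintro z - κ - κ' - ⟨h1, h2⟩ ⟨h3, h4⟩
    exact Prod.ext (by omega) (by omega)
end ThreeChoice

namespace ThreeChoice

/-- The two upper strands of a walk. -/
def upper (i j m : ℕ) (X : ℤ → ℤ) (k : ℕ) : ℤ × ℤ :=
  (-X (2 * (j + 1) + (min k m : ℕ)), -X (-(2 * (i + 1)) - (min k m : ℕ)))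

/-- The four lower strands of a walk. -/
def lower (i j : ℕ) (X : ℤ → ℤ) (k : ℕ) : Fin 4 → ℤ :=
  ![X (-(2 * (i + 1)) + (min k (i + 1) : ℕ)), X (0 - (min k (i + 1) : ℕ)),
    X (0 + (min k (j + 1) : ℕ)), X (2 * (j + 1) - (min k (j + 1) : ℕ))]

theorem pair_of_fun {m : ℕ} {f g : ℤ → ℤ}
    (hf : ∀ k : ℤ, 0 ≤ k → k < m → f (k + 1) = f k ∨ f (k + 1) = f k - 1)
    (hg : ∀ k : ℤ, 0 ≤ k → k < m → g (k + 1) = g k ∨ g (k + 1) = g k - 1)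
    (hlt : ∀ k : ℤ, 0 ≤ k → k < m → f k < g k) (heq : f m = g m) :
    Pair m (fun k => f (min k m : ℕ)) (fun k => g (min k m : ℕ)) where
  stepf k hk := by
    rw [min_eq_left (by omega), min_eq_left (by omega)]
    exact hf k (by omega) (by omega)
  stepg k hk := by
    rw [min_eq_left (by omega), min_eq_left (by omega)]
    exact hg k (by omega) (by omega)
  constf k hk := by rw [min_eq_right (by omega), min_eq_right (by omega)]
  constg k hk := by rw [min_eq_right (by omega), min_eq_right (by omega)]
  lt k hk := by
    rw [min_eq_left (by omega)]
    exact hlt k (by omega) (by omega)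
  eq := by rwa [min_self]

theorem Exc.pieces {n i j m : ℕ} {X L : ℤ → ℤ} (h : Exc n X L) (hX : X 0 = 0) (hn : i + j + 2 + m = n)
    (hp : Profile L (i + 1) (j + 1) m) : Pieces i j m (upper i j m X) (lower i j X) := by
  obtain ⟨h1, h2, h3, h4⟩ := hp
  have hXn := h.Xn
  have hXp := h.Xp
  rw [hX] at hXn hXp
  have s0 : Strand X L (-(i + 1)) m (fun l => -(2 * (i + 1)) - l) := by
    refine h.strand_dn fun l a b => ?_
    have := h4 (l + (i + 1)) (by omega) (by omega)
    rw [show -((i : ℤ) + 1) - (l + (i + 1)) = -(2 * (i + 1)) - l by ring] at this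
    omega
  have s1 : Strand X L (-(i + 1)) 0 (fun l => 0 + l) := by
    refine h.strand_up fun l a b => ?_
    have := h2 (-l) (by omega) (by omega)
    rw [neg_neg] at this
    rwa [zero_add]
  have s2 : Strand X L (-(j + 1)) 0 (fun l => 0 - l) := by
    refine h.strand_dn fun l a b => ?_
    have := h1 (-l) (by omega) (by omega)
    rwa [neg_neg, ← zero_sub] at this
  have s3 : Strand X L (-(j + 1)) m (fun l => 2 * (j + 1) + l) := by
    refine h.strand_up fun l a b => ?_
    have := h3 (l + (j + 1)) (by omega) (by omega)
    rw [show (j : ℤ) + 1 + (l + (j + 1)) = 2 * (j + 1) + l by ring] at this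
    omega
  have vl : X (-(i + 1) - 1) = X (-(i + 1)) ∧ X (-(i + 1) + 1) = X (-(i + 1)) + 1 := by
    have e1 := h4 0 le_rfl (by omega)
    have e2 := h4 1 (by omega) (by omega)
    have e3 := h2 i (by omega) (by omega)
    rw [sub_zero] at e1
    rw [show -(i : ℤ) = -(i + 1) + 1 by ring] at e3
    have hT := h.turn_of_L (t := -((i : ℤ) + 1)) (by omega)
    exact hT.2 (by omega) (by omega)
  have vr : X (j + 1 - 1) = X (j + 1) ∧ X (j + 1 + 1) = X (j + 1) + 1 := by
    have e1 := h3 0 le_rfl (by omega)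
    have e2 := h3 1 (by omega) (by omega)
    have e3 := h1 j (by omega) (by omega)
    rw [add_zero] at e1
    have hT := h.turn_of_L (t := (j : ℤ) + 1) (by omega)
    exact hT.2 (by rw [add_sub_cancel_right]; omega) (by omega)
  have o01 (l : ℤ) (a : -i ≤ l) (b : l ≤ 0) : X (-(2 * (i + 1)) - l) < X (0 + l) :=
    h.order (s0.sub (lo' := -i) (hi' := 0) (by omega) (by omega))
      (s1.sub (lo' := -i) (hi' := 0) (by omega) (by omega))
      (fun l _ _ => not_dvd_of_lt (by omega) (by omega) (by omega)) (-i) l (by omega) (by omega) (by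
        rw [show -(2 * ((i : ℤ) + 1)) - -i = -(i + 1) - 1 by ring,
          show 0 + -(i : ℤ) = -(i + 1) + 1 by ring]
        omega)
  have o23 (l : ℤ) (a : -j ≤ l) (b : l ≤ 0) : X (0 - l) < X (2 * (j + 1) + l) :=
    h.order (s2.sub (lo' := -j) (hi' := 0) (by omega) (by omega))
      (s3.sub (lo' := -j) (hi' := 0) (by omega) (by omega))
      (fun l _ _ => not_dvd_of_lt (by omega) (by omega) (by omega)) (-j) l (by omega) (by omega) (by
        rw [show 2 * ((j : ℤ) + 1) + -j = j + 1 + 1 by ring,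
          show 0 - -(j : ℤ) = j + 1 - 1 by ring]
        omega)
  have o12 (l : ℤ) (a : -(i + 1) ≤ l) (a' : -(j + 1) ≤ l) (b : l ≤ -1) : X (0 + l) < X (0 - l) :=
    h.order (s1.sub (lo' := l) (hi' := -1) (by omega) (by omega))
      (s2.sub (lo' := l) (hi' := -1) (by omega) (by omega))
      (fun l _ _ => not_dvd_of_lt (by omega) (by omega) (by omega)) (-1) l (by omega) (by omega) (by
        simp [hXn, hXp])
  have o03 (l : ℤ) (a : 0 ≤ l) (b : l < m) : X (-(2 * (i + 1)) - l) < X (2 * (j + 1) + l) :=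
    h.order (s0.sub (lo' := 0) (hi' := m - 1) (by omega) (by omega))
      (s3.sub (lo' := 0) (hi' := m - 1) (by omega) (by omega))
      (fun l _ _ => not_dvd_of_lt (by omega) (by omega) (by omega)) 0 l (by omega) (by omega) (by
        have e1 := o01 0 (by omega) le_rfl
        have e2 := o23 0 (by omega) le_rfl
        simp only [add_zero, sub_zero] at *
        omega)
  refine ⟨?_, ?_, ?_, fun k a b c => ?_, ?_, ?_, ?_, ?_, ?_, ?_⟩
  · refine pair_of_fun (f := fun k => -X (2 * (j + 1) + k)) (g := fun k => -X (-(2 * (i + 1)) - k))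
      (fun k a b => ?_) (fun k a b => ?_) (fun k a b => ?_) ?_
    · have := s3.2 k (by omega) (by omega)
      dsimp only at *
      omega
    · have := s0.2 k (by omega) (by omega)
      dsimp only at *
      omega
    · have := o03 k (by omega) (by omega)
      omega
    · rw [(h.eq_of_dvd (s := 2 * ((j : ℤ) + 1) + m) (t := -(2 * ((i : ℤ) + 1)) - m) ⟨1, by push_cast [← hn]; ring⟩).1]
  · refine pair_of_fun (f := fun k => X (-(2 * (i + 1)) + k)) (g := fun k => X (0 - k))
      (fun k a b => ?_) (fun k a b => ?_) (fun k a b => ?_) ?_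
    · have := s0.2 (-(k + 1)) (by omega) (by omega)
      dsimp only at *
      rw [show -(2 * ((i : ℤ) + 1)) - (-(k + 1) + 1) = -(2 * (i + 1)) + k by ring, sub_neg_eq_add] at this
      omega
    · have := s1.2 (-(k + 1)) (by omega) (by omega)
      dsimp only at *
      rw [show 0 + (-(k + 1) + 1) = 0 - k by ring, show 0 + -(k + 1) = 0 - (k + 1) by ring] at this
      omega
    · have := o01 (-k) (by omega) (by omega)
      rwa [sub_neg_eq_add, ← sub_eq_add_neg] at this
    · push_cast
      congr 1
      ring
  · refine pair_of_fun (f := fun k => X (0 + k)) (g := fun k => X (2 * (j + 1) - k))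
      (fun k a b => ?_) (fun k a b => ?_) (fun k a b => ?_) ?_
    · have := s2.2 (-(k + 1)) (by omega) (by omega)
      dsimp only at *
      rw [show 0 - (-(k + 1) + 1) = 0 + k by ring, sub_neg_eq_add] at this
      omega
    · have := s3.2 (-(k + 1)) (by omega) (by omega)
      dsimp only at *
      rw [show 2 * ((j : ℤ) + 1) + (-(k + 1) + 1) = 2 * (j + 1) - k by ring, ← sub_eq_add_neg] at this
      omega
    · have := o23 (-k) (by omega) (by omega)
      rwa [sub_neg_eq_add, ← sub_eq_add_neg] at this
    · push_cast
      congr 1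
      ring
  · have := o12 (-k) (by omega) (by omega) (by omega)
    simp only [lower, Matrix.cons_val]
    rw [min_eq_left b, min_eq_left c]
    rwa [sub_neg_eq_add, ← sub_eq_add_neg] at this
  all_goals simp [upper, lower, hX, hXn, hXp]

theorem upper_lower_injOn {n i j m : ℕ} (hn : i + j + 2 + m = n) :
    Set.InjOn (fun p => (upper i j m p.1, lower i j p.1))
      {p | p ∈ excWalks n ∧ Profile p.2 (i + 1) (j + 1) m} := by
  rintro ⟨X, L⟩ ⟨⟨h, hX⟩, h1, h2, h3, h4⟩ ⟨X', L'⟩ ⟨⟨h', hX'⟩, h1', h2', h3', h4'⟩ e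
  simp only [Prod.mk.injEq, funext_iff (f := upper _ _ _ _), funext_iff (f := lower _ _ _)] at e
  obtain ⟨eu, el⟩ := e
  simp only [upper, lower, vec4_ext, Prod.mk.injEq, neg_inj, Matrix.cons_val] at eu el h1 h2 h3 h4 h1' h2' h3' h4'
  rw [Prod.mk.injEq]
  refine CW.ext_window (by omega) h.toCW h'.toCW (-(2 * (i + 1)) - m) fun t a b => ?_
  have hA : t ≤ -(2 * (i + 1)) ∨ (-(2 * (i + 1)) < t ∧ t ≤ -(i + 1)) ∨ (-(i + 1) < t ∧ t ≤ 0) ∨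
    (0 < t ∧ t ≤ j + 1) ∨ (j + 1 < t ∧ t ≤ 2 * (j + 1)) ∨ 2 * (j + 1) < t := by omega
  rcases hA with hA | hA | hA | hA | hA | hA
  · obtain ⟨k, rfl⟩ : ∃ k : ℕ, t = -(2 * (i + 1)) - k := ⟨(-(2 * (i + 1)) - t).toNat, by omega⟩
    have e1 := h4 (i + 1 + k) (by omega) (by omega)
    have e2 := h4' (i + 1 + k) (by omega) (by omega)
    have e3 := (eu k).2
    rw [show -((i : ℤ) + 1) - (i + 1 + k) = -(2 * (i + 1)) - k by ring] at e1 e2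
    rw [min_eq_left (by omega)] at e3
    omega
  · obtain ⟨k, rfl⟩ : ∃ k : ℕ, t = -(2 * (i + 1)) + k := ⟨(2 * (i + 1) + t).toNat, by omega⟩
    have e1 := h4 (i + 1 - k) (by omega) (by omega)
    have e2 := h4' (i + 1 - k) (by omega) (by omega)
    have e3 := (el k).1
    rw [show -((i : ℤ) + 1) - (i + 1 - k) = -(2 * (i + 1)) + k by ring] at e1 e2
    rw [min_eq_left (by omega)] at e3
    omega
  · obtain ⟨k, rfl⟩ : ∃ k : ℕ, t = 0 - k := ⟨(-t).toNat, by omega⟩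
    have e1 := h2 k (by omega) (by omega)
    have e2 := h2' k (by omega) (by omega)
    have e3 := (el k).2.1
    rw [min_eq_left (by omega)] at e3
    rw [← zero_sub] at e1 e2
    omega
  · obtain ⟨k, rfl⟩ : ∃ k : ℕ, t = 0 + k := ⟨t.toNat, by omega⟩
    have e1 := h1 k (by omega) (by omega)
    have e2 := h1' k (by omega) (by omega)
    have e3 := (el k).2.2.1
    rw [min_eq_left (by omega)] at e3
    rw [zero_add] at *
    omega
  · obtain ⟨k, rfl⟩ : ∃ k : ℕ, t = 2 * (j + 1) - k := ⟨(2 * (j + 1) - t).toNat, by omega⟩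
    have e1 := h3 (j + 1 - k) (by omega) (by omega)
    have e2 := h3' (j + 1 - k) (by omega) (by omega)
    have e3 := (el k).2.2.2
    rw [show (j : ℤ) + 1 + (j + 1 - k) = 2 * (j + 1) - k by ring] at e1 e2
    rw [min_eq_left (by omega)] at e3
    omega
  · obtain ⟨k, rfl⟩ : ∃ k : ℕ, t = 2 * (j + 1) + k := ⟨(t - 2 * (j + 1)).toNat, by omega⟩
    have e1 := h3 (j + 1 + k) (by omega) (by omega)
    have e2 := h3' (j + 1 + k) (by omega) (by omega)
    have e3 := (eu k).1
    rw [show (j : ℤ) + 1 + (j + 1 + k) = 2 * (j + 1) + k by ring] at e1 e2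
    rw [min_eq_left (by omega)] at e3
    omega
end ThreeChoice

namespace ThreeChoice

/-- The abscissa of the walk assembled from its pieces. -/
def glueX (i j : ℕ) (P : ℕ → ℤ × ℤ) (F : ℕ → Fin 4 → ℤ) (t : ℤ) : ℤ :=
  if t ≤ -(2 * (i + 1)) then -(P (-(2 * (i + 1)) - t).toNat).2
  else if t ≤ -(i + 1) then F (t + 2 * (i + 1)).toNat 0
  else if t ≤ 0 then F (-t).toNat 1
  else if t ≤ j + 1 then F t.toNat 2
  else if t ≤ 2 * (j + 1) then F (2 * (j + 1) - t).toNat 3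
  else -(P (t - 2 * (j + 1)).toNat).1

/-- The level of the walk assembled from its pieces. -/
def glueL (i j : ℕ) (t : ℤ) : ℤ :=
  if t ≤ -(i + 1) then -t - 2 * (i + 1)
  else if t ≤ 0 then t
  else if t ≤ j + 1 then -t
  else t - 2 * (j + 1)

namespace Pieces
variable {i j m : ℕ} {P : ℕ → ℤ × ℤ} {F : ℕ → Fin 4 → ℤ}

theorem glueX₀ (k : ℕ) : glueX i j P F (-(2 * (i + 1)) - k) = -(P k).2 := by
  rw [glueX, if_pos (by omega)]
  congr 3
  omega

theorem glueX₁ (h : Pieces i j m P F) {k : ℕ} (hk : k ≤ i + 1) : glueX i j P F (-(2 * (i + 1)) + k) = F k 0 := by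
  rcases Nat.eq_zero_or_pos k with rfl | hk'
  · rw [glueX, if_pos (by omega), show (-(2 * ((i : ℤ) + 1)) - (-(2 * (i + 1)) + (0 : ℕ))).toNat = 0 by omega,
      h.snd, neg_neg]
  · rw [glueX, if_neg (by omega), if_pos (by omega)]
    congr 1
    omega

theorem glueX₂ (h : Pieces i j m P F) {k : ℕ} (hk : k ≤ i + 1) : glueX i j P F (-k) = F k 1 := by
  rcases Nat.eq_or_lt_of_le hk with rfl | hk'
  · rw [glueX, if_neg (by omega), if_pos (by omega), ← h.left.eq]
    congr 1
    omega
  · rw [glueX, if_neg (by omega), if_neg (by omega), if_pos (by omega)]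
    congr 1
    omega

theorem glueX₃ (h : Pieces i j m P F) {k : ℕ} (hk : k ≤ j + 1) : glueX i j P F k = F k 2 := by
  rcases Nat.eq_zero_or_pos k with rfl | hk'
  · rw [glueX, if_neg (by omega), if_neg (by omega), if_pos (by omega), h.root₂, ← h.root₁]
    congr 1
  · rw [glueX, if_neg (by omega), if_neg (by omega), if_neg (by omega), if_pos (by omega)]
    congr 1

theorem glueX₄ (h : Pieces i j m P F) {k : ℕ} (hk : k ≤ j + 1) : glueX i j P F (2 * (j + 1) - k) = F k 3 := by
  rcases Nat.eq_or_lt_of_le hk with rfl | hk'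
  · rw [glueX, if_neg (by omega), if_neg (by omega), if_neg (by omega), if_pos (by omega), ← h.right.eq]
    congr 1
    omega
  · rw [glueX, if_neg (by omega), if_neg (by omega), if_neg (by omega), if_neg (by omega),
      if_pos (by omega)]
    congr 1
    omega

theorem glueX₅ (h : Pieces i j m P F) (k : ℕ) : glueX i j P F (2 * (j + 1) + k) = -(P k).1 := by
  rcases Nat.eq_zero_or_pos k with rfl | hk'
  · have := h.glueX₄ (k := 0) (by omega)
    rw [h.fst, neg_neg, ← this]
    congr 1
  · rw [glueX, if_neg (by omega), if_neg (by omega), if_neg (by omega), if_neg (by omega),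
      if_neg (by omega)]
    congr 3
    omega

theorem m_pos (h : Pieces i j m P F) : 1 ≤ m := by
  by_contra! hm
  obtain rfl : m = 0 := by omega
  have h1 : (P 0).1 = (P 0).2 := h.top.eq
  have h2 := h.left.lt 0 (by omega)
  have h3 := h.right.lt 0 (by omega)
  have := h.fst; have := h.snd; have := h.root₁; have := h.root₂
  omega

/-- The strand to which a time belongs. -/
theorem cases_of_mem (h : Pieces i j m P F) {t : ℤ} (h1 : -(2 * (i + 1)) - m ≤ t) (h2 : t < 2 * (j + 1) + m) :
    (∃ k : ℕ, 1 ≤ k ∧ k ≤ m ∧ t = -(2 * (i + 1)) - k ∧ glueX i j P F t = -(P k).2 ∧ glueL i j t = k) ∨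
    (∃ k : ℕ, k ≤ i + 1 ∧ t = -(2 * (i + 1)) + k ∧ glueX i j P F t = F k 0 ∧ glueL i j t = -k) ∨
    (∃ k : ℕ, k < i + 1 ∧ t = -k ∧ glueX i j P F t = F k 1 ∧ glueL i j t = -k) ∨
    (∃ k : ℕ, 1 ≤ k ∧ k ≤ j + 1 ∧ t = k ∧ glueX i j P F t = F k 2 ∧ glueL i j t = -k) ∨
    (∃ k : ℕ, k < j + 1 ∧ t = 2 * (j + 1) - k ∧ glueX i j P F t = F k 3 ∧ glueL i j t = -k) ∨
    (∃ k : ℕ, 1 ≤ k ∧ k < m ∧ t = 2 * (j + 1) + k ∧ glueX i j P F t = -(P k).1 ∧ glueL i j t = k) := by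
  have hA : t < -(2 * (i + 1)) ∨ (-(2 * (i + 1)) ≤ t ∧ t ≤ -(i + 1)) ∨ (-(i + 1) < t ∧ t ≤ 0) ∨
    (0 < t ∧ t ≤ j + 1) ∨ (j + 1 < t ∧ t ≤ 2 * (j + 1)) ∨ 2 * (j + 1) < t := by omega
  rcases hA with hA | hA | hA | hA | hA | hA
  · obtain ⟨k, rfl⟩ : ∃ k : ℕ, t = -(2 * (i + 1)) - k := ⟨(-(2 * (i + 1)) - t).toNat, by omega⟩
    refine Or.inl ⟨k, by omega, by omega, rfl, glueX₀ k, ?_⟩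
    unfold glueL; split_ifs <;> omega
  · obtain ⟨k, rfl⟩ : ∃ k : ℕ, t = -(2 * (i + 1)) + k := ⟨(2 * (i + 1) + t).toNat, by omega⟩
    refine Or.inr (Or.inl ⟨k, by omega, rfl, h.glueX₁ (by omega), ?_⟩)
    unfold glueL; split_ifs <;> omega
  · obtain ⟨k, rfl⟩ : ∃ k : ℕ, t = -k := ⟨(-t).toNat, by omega⟩
    refine Or.inr (Or.inr (Or.inl ⟨k, by omega, rfl, h.glueX₂ (by omega), ?_⟩))
    unfold glueL; split_ifs <;> omega
  · obtain ⟨k, rfl⟩ : ∃ k : ℕ, t = k := ⟨t.toNat, by omega⟩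
    refine Or.inr (Or.inr (Or.inr (Or.inl ⟨k, by omega, by omega, rfl, h.glueX₃ (by omega), ?_⟩)))
    unfold glueL; split_ifs <;> omega
  · obtain ⟨k, rfl⟩ : ∃ k : ℕ, t = 2 * (j + 1) - k := ⟨(2 * (j + 1) - t).toNat, by omega⟩
    refine Or.inr (Or.inr (Or.inr (Or.inr (Or.inl ⟨k, by omega, rfl, h.glueX₄ (by omega), ?_⟩))))
    unfold glueL; split_ifs <;> omega
  · obtain ⟨k, rfl⟩ : ∃ k : ℕ, t = 2 * (j + 1) + k := ⟨(t - 2 * (j + 1)).toNat, by omega⟩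
    refine Or.inr (Or.inr (Or.inr (Or.inr (Or.inr ⟨k, by omega, by omega, rfl, h.glueX₅ k, ?_⟩))))
    unfold glueL; split_ifs <;> omega

theorem glue_step (h : Pieces i j m P F) {t : ℤ} (h1 : -(2 * (i + 1)) - m ≤ t) (h2 : t < 2 * (j + 1) + m) :
    (glueL i j (t + 1) = glueL i j t + 1 ∧ (glueX i j P F (t + 1) = glueX i j P F t ∨
      glueX i j P F (t + 1) = glueX i j P F t + 1)) ∨
    (glueL i j (t + 1) = glueL i j t - 1 ∧ (glueX i j P F (t + 1) = glueX i j P F t ∨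
      glueX i j P F (t + 1) = glueX i j P F t - 1)) := by
  have hA : t < -(2 * (i + 1)) ∨ (-(2 * (i + 1)) ≤ t ∧ t < -(i + 1)) ∨ (-(i + 1) ≤ t ∧ t < 0) ∨
    (0 ≤ t ∧ t < j + 1) ∨ (j + 1 ≤ t ∧ t < 2 * (j + 1)) ∨ 2 * (j + 1) ≤ t := by omega
  rcases hA with hA | hA | hA | hA | hA | hA
  · obtain ⟨k, rfl⟩ : ∃ k : ℕ, t = -(2 * (i + 1)) - (k + 1 : ℕ) := ⟨(-(2 * (i + 1)) - t - 1).toNat, by omega⟩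
    have := h.top.stepg k (by omega)
    right
    rw [show -(2 * ((i : ℤ) + 1)) - (k + 1 : ℕ) + 1 = -(2 * (i + 1)) - k by push_cast; ring, glueX₀, glueX₀]
    refine ⟨?_, by omega⟩
    unfold glueL; split_ifs <;> omega
  · obtain ⟨k, rfl⟩ : ∃ k : ℕ, t = -(2 * (i + 1)) + k := ⟨(2 * (i + 1) + t).toNat, by omega⟩
    have := h.left.stepf k (by omega)
    right
    rw [show -(2 * ((i : ℤ) + 1)) + k + 1 = -(2 * (i + 1)) + (k + 1 : ℕ) by push_cast; ring,
      h.glueX₁ (by omega), h.glueX₁ (by omega)]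
    refine ⟨?_, by omega⟩
    unfold glueL; split_ifs <;> omega
  · obtain ⟨k, rfl⟩ : ∃ k : ℕ, t = -(k + 1 : ℕ) := ⟨(-t - 1).toNat, by omega⟩
    have := h.left.stepg k (by omega)
    left
    rw [show -((k + 1 : ℕ) : ℤ) + 1 = -k by push_cast; ring, h.glueX₂ (by omega), h.glueX₂ (by omega)]
    refine ⟨?_, by omega⟩
    unfold glueL; split_ifs <;> omega
  · obtain ⟨k, rfl⟩ : ∃ k : ℕ, t = k := ⟨t.toNat, by omega⟩
    have := h.right.stepf k (by omega)
    right
    rw [show (k : ℤ) + 1 = (k + 1 : ℕ) by push_cast; ring, h.glueX₃ (by omega), h.glueX₃ (by omega)]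
    refine ⟨?_, by omega⟩
    unfold glueL; split_ifs <;> omega
  · obtain ⟨k, rfl⟩ : ∃ k : ℕ, t = 2 * (j + 1) - (k + 1 : ℕ) := ⟨(2 * (j + 1) - t - 1).toNat, by omega⟩
    have := h.right.stepg k (by omega)
    left
    rw [show 2 * ((j : ℤ) + 1) - (k + 1 : ℕ) + 1 = 2 * (j + 1) - k by push_cast; ring,
      h.glueX₄ (by omega), h.glueX₄ (by omega)]
    refine ⟨?_, by omega⟩
    unfold glueL; split_ifs <;> omega
  · obtain ⟨k, rfl⟩ : ∃ k : ℕ, t = 2 * (j + 1) + k := ⟨(t - 2 * (j + 1)).toNat, by omega⟩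
    have := h.top.stepf k (by omega)
    left
    rw [show 2 * ((j : ℤ) + 1) + k + 1 = 2 * (j + 1) + (k + 1 : ℕ) by push_cast; ring, h.glueX₅, h.glueX₅]
    refine ⟨?_, by omega⟩
    unfold glueL; split_ifs <;> omega

theorem glue_inj (h : Pieces i j m P F) {s t : ℤ} (h1 : -(2 * (i + 1)) - m ≤ s) (h2 : s < 2 * (j + 1) + m)
    (h3 : -(2 * (i + 1)) - m ≤ t) (h4 : t < 2 * (j + 1) + m)
    (hx : glueX i j P F s = glueX i j P F t) (hl : glueL i j s = glueL i j t) : s = t := by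
  have a1 (k : ℕ) (hk : k < i + 1) : F k 0 < F k 1 := h.left.lt k hk
  have a2 (k : ℕ) (hk : k < j + 1) : F k 2 < F k 3 := h.right.lt k hk
  have a3 := h.left.eq
  have a4 := h.right.eq
  have b1 (k : ℕ) (hk : k ≤ i + 1) : F k 0 ≤ F k 1 := by
    rcases Nat.eq_or_lt_of_le hk with rfl | hk
    · exact h.left.eq.le
    · exact (a1 k hk).le
  have b2 (k : ℕ) (hk : k ≤ j + 1) : F k 2 ≤ F k 3 := by
    rcases Nat.eq_or_lt_of_le hk with rfl | hk
    · exact h.right.eq.le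
    · exact (a2 k hk).le
  have c1 (k : ℕ) (hk : k < m) : (P k).1 < (P k).2 := h.top.lt k hk
  have c2 := h.mid
  have r1 := h.root₁
  have r2 := h.root₂
  have a10 := a1 0 (by omega)
  have a20 := a2 0 (by omega)
  have key (k k' : ℕ) (hk : k ≤ i + 1) (hk' : k' ≤ j + 1) (e : k = k') (h0 : 1 ≤ k) : F k 1 < F k' 2 := by
    subst e
    exact c2 k h0 hk hk'
  rcases h.cases_of_mem h1 h2 with ⟨k, hs⟩ | ⟨k, hs⟩ | ⟨k, hs⟩ | ⟨k, hs⟩ | ⟨k, hs⟩ | ⟨k, hs⟩ <;>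
  rcases h.cases_of_mem h3 h4 with ⟨l, ht⟩ | ⟨l, ht⟩ | ⟨l, ht⟩ | ⟨l, ht⟩ | ⟨l, ht⟩ | ⟨l, ht⟩ <;>
  first
  | omega
  | (obtain rfl : k = l := by omega
     have u1 := a1 k; have u2 := a2 k; have u3 := b1 k; have u4 := b2 k; have u5 := c1 k
     have u6 := c2 k
     rcases Nat.eq_zero_or_pos k with rfl | hk <;> omega)

theorem win (h : Pieces i j m P F) {n : ℕ} (hn : i + j + 2 + m = n) :
    Win n (-(2 * (i + 1)) - m) (glueX i j P F) (glueL i j) where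
  step t h1 h2 := h.glue_step h1 (by omega)
  close_x := by
    have : (P m).1 = (P m).2 := h.top.eq
    rw [show -(2 * ((i : ℤ) + 1)) - m + 2 * n = 2 * (j + 1) + m by push_cast [← hn]; ring, h.glueX₅, glueX₀]
    rw [this]
  close_l := by
    unfold glueL; split_ifs <;> omega
  inj s t h1 h2 h3 h4 := h.glue_inj h1 (by omega) h3 (by omega)

theorem glue_turn (h : Pieces i j m P F) {t : ℤ} (h1 : -(2 * (i + 1)) - m < t) (h2 : t < 2 * (j + 1) + m) (h0 : t ≠ 0) :
    Turn (glueX i j P F) (glueL i j) t := by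
  have hA : t = -((i + 1 : ℕ) : ℤ) ∨ t = (j + 1 : ℕ) ∨
      glueL i j (t - 1) + glueL i j (t + 1) = 2 * glueL i j t := by
    unfold glueL; split_ifs <;> omega
  rcases hA with rfl | rfl | hA
  · have e1 := h.glueX₁ (k := i) (by omega)
    have e2 := h.glueX₂ (k := i) (by omega)
    have e3 := h.glueX₂ (k := i + 1) (by omega)
    rw [show -(2 * ((i : ℤ) + 1)) + i = -((i + 1 : ℕ) : ℤ) - 1 by push_cast; ring] at e1
    rw [show -(i : ℤ) = -((i + 1 : ℕ) : ℤ) + 1 by push_cast; ring] at e2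
    have f1 := h.left.lt i (by omega)
    have f2 := h.left.stepf i (by omega)
    have f3 := h.left.stepg i (by omega)
    have f4 := h.left.eq
    refine ⟨fun e => ?_, fun _ _ => by omega⟩
    exfalso
    revert e
    unfold glueL; split_ifs <;> omega
  · have e1 := h.glueX₃ (k := j) (by omega)
    have e2 := h.glueX₄ (k := j) (by omega)
    have e3 := h.glueX₃ (k := j + 1) (by omega)
    rw [show (j : ℤ) = ((j + 1 : ℕ) : ℤ) - 1 by push_cast; ring] at e1
    rw [show 2 * ((j : ℤ) + 1) - j = ((j + 1 : ℕ) : ℤ) + 1 by push_cast; ring] at e2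
    have f1 := h.right.lt j (by omega)
    have f2 := h.right.stepf j (by omega)
    have f3 := h.right.stepg j (by omega)
    have f4 := h.right.eq
    refine ⟨fun e => ?_, fun _ _ => by omega⟩
    exfalso
    revert e
    unfold glueL; split_ifs <;> omega
  · constructor <;> intros <;> omega

end Pieces
end ThreeChoice

namespace ThreeChoice

theorem Pieces.exc {n i j m : ℕ} {P : ℕ → ℤ × ℤ} {F : ℕ → Fin 4 → ℤ} (h : Pieces i j m P F)
    (hn : i + j + 2 + m = n) :
    Exc n (periodize n (-(2 * (i + 1)) - m) (glueX i j P F))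
      (periodize n (-(2 * (i + 1)) - m) (glueL i j)) := by
  have w := h.win hn
  have hm := h.m_pos
  have ax {t : ℤ} (h1 : -(2 * ((i : ℤ) + 1)) - m ≤ t) (h2 : t ≤ 2 * (j + 1) + m) :=
    periodize_apply w.close_x (t := t) h1 (by omega)
  have al {t : ℤ} (h1 : -(2 * ((i : ℤ) + 1)) - m ≤ t) (h2 : t ≤ 2 * (j + 1) + m) :=
    periodize_apply w.close_l (t := t) h1 (by omega)
  have x0 := h.glueX₂ (k := 0) (by omega)
  have x1 := h.glueX₃ (k := 1) (by omega)
  have x2 := h.glueX₂ (k := 1) (by omega)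
  have := h.root₁; have := h.next₁; have := h.next₂
  rw [Nat.cast_zero, neg_zero] at x0
  rw [Nat.cast_one] at x1 x2
  refine ⟨w.cw (by omega), fun t ht => ?_, ?_, ?_, ?_, ?_, ?_⟩
  · obtain ⟨s, h1, h2, hd⟩ := exists_mem_window (n := n) (by omega) (-(2 * ((i : ℤ) + 1)) - m) t
    have hs : s ≠ 0 := by
      rintro rfl
      exact ht (by simpa using hd)
    refine Turn.congr (w.cw (by omega)) hd ?_
    rcases h1.eq_or_lt with rfl | h1
    · have p1 := (w.cw (by omega)).eq_of_dvd (s := -(2 * ((i : ℤ) + 1)) - m - 1) (t := 2 * (j + 1) + m - 1)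
        ⟨-1, by push_cast [← hn]; ring⟩
      obtain ⟨l, rfl⟩ := Nat.exists_eq_add_of_le' hm
      have e1 := h.glueX₅ l
      have e2 := Pieces.glueX₀ (i := i) (j := j) (P := P) (F := F) l
      have e3 := Pieces.glueX₀ (i := i) (j := j) (P := P) (F := F) (l + 1)
      rw [show 2 * ((j : ℤ) + 1) + l = 2 * (j + 1) + (l + 1 : ℕ) - 1 by push_cast; ring] at e1
      rw [show -(2 * ((i : ℤ) + 1)) - l = -(2 * (i + 1)) - (l + 1 : ℕ) + 1 by push_cast; ring] at e2
      have f1 := h.top.lt l (by omega)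
      have f2 := h.top.stepf l (by omega)
      have f3 := h.top.stepg l (by omega)
      have f4 : (P (l + 1)).1 = (P (l + 1)).2 := h.top.eq
      unfold Turn
      rw [p1.1, p1.2, ax (by omega) (by omega), ax (by omega) (by omega), ax (by omega) (by omega),
        al (by omega) (by omega), al (by omega) (by omega), al (by omega) (by omega)]
      refine ⟨fun _ _ => by omega, fun e => ?_⟩
      exfalso
      revert e
      unfold glueL; split_ifs <;> omega
    · have := h.glue_turn h1 (by omega) hs
      unfold Turn at *
      rw [ax (by omega) (by omega), ax (by omega) (by omega), ax (by omega) (by omega),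
        al (by omega) (by omega), al (by omega) (by omega), al (by omega) (by omega)]
      exact this
  · rw [al (by omega) (by omega)]
    unfold glueL; split_ifs <;> omega
  · rw [al (by omega) (by omega)]
    unfold glueL; split_ifs <;> omega
  · rw [al (by omega) (by omega)]
    unfold glueL; split_ifs <;> omega
  · rw [ax (by omega) (by omega), ax (by omega) (by omega)]
    omega
  · rw [ax (by omega) (by omega), ax (by omega) (by omega)]
    omega

theorem bijOn_pieces {n i j m : ℕ} (hn : i + j + 2 + m = n) :
    Set.BijOn (fun p => (upper i j m p.1, lower i j p.1))
      {p | p ∈ excWalks n ∧ Profile p.2 (i + 1) (j + 1) m} {z | Pieces i j m z.1 z.2} := by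
  refine ⟨?_, upper_lower_injOn hn, ?_⟩
  · rintro ⟨X, L⟩ ⟨⟨h, hX⟩, hp⟩
    exact h.pieces hX hn hp
  · rintro ⟨P, F⟩ h
    change Pieces i j m P F at h
    have w := h.win hn
    have ax {t : ℤ} (h1 : -(2 * ((i : ℤ) + 1)) - m ≤ t) (h2 : t ≤ 2 * (j + 1) + m) :=
      periodize_apply w.close_x (t := t) h1 (by omega)
    have al {t : ℤ} (h1 : -(2 * ((i : ℤ) + 1)) - m ≤ t) (h2 : t ≤ 2 * (j + 1) + m) :=
      periodize_apply w.close_l (t := t) h1 (by omega)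
    refine ⟨(periodize n (-(2 * (i + 1)) - m) (glueX i j P F),
      periodize n (-(2 * (i + 1)) - m) (glueL i j)), ⟨⟨h.exc hn, ?_⟩, ?_, ?_, ?_, ?_⟩, ?_⟩
    · dsimp only
      have := h.glueX₂ (k := 0) (by omega)
      rw [Nat.cast_zero, neg_zero, h.root₁] at this
      rw [ax (by omega) (by omega), this]
    · intro k a b
      dsimp only
      rw [al (by omega) (by omega)]
      unfold glueL; split_ifs <;> omega
    · intro k a b
      dsimp only
      rw [al (by omega) (by omega)]
      unfold glueL; split_ifs <;> omega
    · intro k a b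
      dsimp only
      rw [al (by omega) (by omega)]
      unfold glueL; split_ifs <;> omega
    · intro k a b
      dsimp only
      rw [al (by omega) (by omega)]
      unfold glueL; split_ifs <;> omega
    · refine Prod.ext (funext fun k => ?_) (funext fun k => ?_)
      · dsimp only [upper]
        rw [ax (by omega) (by omega), ax (by omega) (by omega), h.glueX₅, Pieces.glueX₀, neg_neg, neg_neg]
        exact Prod.ext (h.top.f_eq k).symm (h.top.g_eq k).symm
      · dsimp only [lower]
        rw [ax (by omega) (by omega), ax (by omega) (by omega), ax (by omega) (by omega),
          ax (by omega) (by omega), h.glueX₁ (by omega), zero_sub, h.glueX₂ (by omega), zero_add,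
          h.glueX₃ (by omega), h.glueX₄ (by omega), vec4_ext]
        exact ⟨(h.left.f_eq k).symm, (h.left.g_eq k).symm, (h.right.f_eq k).symm, (h.right.g_eq k).symm⟩

theorem Profile.left_le {L : ℤ → ℤ} {i j m i' j' m' : ℤ} (h : Profile L i j m) (h' : Profile L i' j' m')
    (hm : 1 ≤ m') (h0 : 0 ≤ i') : i ≤ i' := by
  by_contra! hlt
  have h1 := h.2.1 (i' + 1) (by omega) (by omega)
  have h2 := h'.2.2.2 1 (by omega) (by omega)
  rw [show -i' - 1 = -(i' + 1) by ring] at h2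
  omega

theorem Profile.right_le {L : ℤ → ℤ} {i j m i' j' m' : ℤ} (h : Profile L i j m) (h' : Profile L i' j' m')
    (hm : 1 ≤ m') (h0 : 0 ≤ j') : j ≤ j' := by
  by_contra! hlt
  have h1 := h.1 (j' + 1) (by omega) (by omega)
  have h2 := h'.2.2.1 1 (by omega) (by omega)
  omega

/-- The number of walks with an exceptional peak at the origin. -/
theorem encard_excWalks {n N : ℕ} (hn : 2 ≤ n) (hN : n ≤ N) :
    (excWalks n).encard = ((∑ κ ∈ Finset.HasAntidiagonal.antidiagonal (n - 2),
      ∑ ι ∈ Finset.HasAntidiagonal.antidiagonal κ.1,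
      ∑ p ∈ Finset.range N, ∑ r ∈ Finset.range N, v κ.2 (p + r + 2) * low ι.1 ι.2 p r : ℕ) : ℕ∞) := by
  have key {i j m : ℕ} (h : i + j + 2 + m = n) :
      {z | z ∈ excWalks n ∧ (1 ≤ m ∧ Profile z.2 (i + 1) (j + 1) m)}.encard = ((∑ p ∈ Finset.range N,
        ∑ r ∈ Finset.range N, v m (p + r + 2) * low i j p r : ℕ) : ℕ∞) := by
    rw [← encard_pieces i j m N (by omega) (by omega), ← encard_eq_of_bijOn (bijOn_pieces h)]
    congr 1
    ext z
    refine ⟨fun hz => ⟨hz.1, hz.2.2⟩, fun hz => ⟨hz.1, ?_, hz.2⟩⟩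
    exact ((bijOn_pieces h).mapsTo hz).m_pos
  rw [encard_eq_sum_fiber ((Finset.HasAntidiagonal.antidiagonal (n - 2)).sigma fun κ => Finset.HasAntidiagonal.antidiagonal κ.1) (excWalks n)
    (fun ξ z => 1 ≤ ξ.1.2 ∧ Profile z.2 (ξ.2.1 + 1) (ξ.2.2 + 1) ξ.1.2)]
  · rw [Finset.sum_sigma]
    push_cast
    refine Finset.sum_congr rfl fun κ hκ => Finset.sum_congr rfl fun ι hι => ?_
    rw [Finset.HasAntidiagonal.mem_antidiagonal] at hκ hι
    have := key (i := ι.1) (j := ι.2) (m := κ.2) (by omega)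
    push_cast at this
    exact this
  · rintro ⟨X, L⟩ ⟨h, -⟩
    obtain ⟨i, j, m, hi, hj, hm, hs, hp⟩ := h.exists_profile hn
    lift i to ℕ using by omega
    lift j to ℕ using by omega
    lift m to ℕ using by omega
    obtain ⟨i, rfl⟩ := Nat.exists_eq_add_of_le' (show 1 ≤ i by omega)
    obtain ⟨j, rfl⟩ := Nat.exists_eq_add_of_le' (show 1 ≤ j by omega)
    refine ⟨⟨(i + j, m), (i, j)⟩, ?_, ?_, ?_⟩
    · simp only [Finset.mem_sigma, Finset.HasAntidiagonal.mem_antidiagonal]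
      exact ⟨by omega, trivial⟩
    · dsimp only
      omega
    · exact_mod_cast hp
  · rintro ⟨X, L⟩ - ⟨⟨a, m⟩, ⟨i, j⟩⟩ hs ⟨⟨a', m'⟩, ⟨i', j'⟩⟩ hs' ⟨hm, hp⟩ ⟨hm', hp'⟩
    simp only [Finset.mem_sigma, Finset.HasAntidiagonal.mem_antidiagonal] at hs hs'
    dsimp only at *
    have e1 := hp.left_le hp' (by omega) (by omega)
    have e2 := hp'.left_le hp (by omega) (by omega)
    have e3 := hp.right_le hp' (by omega) (by omega)
    have e4 := hp'.right_le hp (by omega) (by omega)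
    obtain rfl : i = i' := by omega
    obtain rfl : j = j' := by omega
    obtain rfl : a = a' := by omega
    obtain rfl : m = m' := by omega
    rfl
end ThreeChoice

namespace ThreeChoice
open PowerSeries

/-- The monomial attached to four exponents with only their differences taken into account. -/
noncomputable def mon (s : Fin 4 → ℤ) : LSeries := zs fun i => s i.castSucc - s 3

theorem mon_add (s t : Fin 4 → ℤ) : mon (s + t) = mon s * mon t := by
  rw [mon, mon, mon, ← zs_add]
  congr 1
  funext i
  simp only [Pi.add_apply]
  ring

theorem mon_zero : mon 0 = 1 := by
  rw [← zs_zero, mon]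
  congr 1

theorem mon_nsmul (k : ℕ) (s : Fin 4 → ℤ) : mon (k • s) = mon s ^ k := by
  induction k with
  | zero => rw [zero_smul, pow_zero, mon_zero]
  | succ k ih => rw [succ_nsmul, mon_add, ih, pow_succ]

theorem isPol_mon (s : Fin 4 → ℤ) : IsPol (mon s) := isPol_zs _

/-- The constant term, coefficientwise. -/
noncomputable def CT : LSeries →ₗ[ℚ] PowerSeries ℚ := CTR ∘ₗ LinearMap.mulLeft ℚ (zs (-1))

theorem CT_apply (f : LSeries) : CT f = CTR (zs (-1) * f) := rfl

theorem CT_emb_mul (d : PowerSeries ℚ) (f : LSeries) : CT (emb d * f) = d * CT f := by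
  rw [CT_apply, CT_apply, mul_left_comm, CTR, lmap_emb_mul]
  simp

theorem CT_mon (s : Fin 4 → ℤ) : CT (mon s) = if ∀ i, s i = s 3 then 1 else 0 := by
  rw [CT_apply, mon, ← zs_add]
  ext n
  rw [CTR, coeff_lmap, zs, coeff_C]
  have : ((-1 + fun i : Fin 3 => s i.castSucc - s 3) = -1) ↔ ∀ i, s i = s 3 := by
    rw [add_eq_left, funext_iff]
    simp only [Pi.zero_apply, sub_eq_zero]
    exact ⟨fun h => Fin.lastCases rfl h, fun h i => h _⟩
  split_ifs with h1 h2 h2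
  · rw [res_zpw, if_pos (this.2 h2), h1]; simp
  · rw [res_zpw, if_neg (this.not.2 h2)]; simp
  · rw [map_zero, coeff_one, if_neg h1]
  · simp

/-- The generating polynomial of the steps of four paths. -/
noncomputable def K : LSeries := ∑ ε : Fin 4 → Fin 2, mon fun r => ((ε r : ℕ) : ℤ)

theorem isPol_K : IsPol K :=
  Finset.sum_induction _ _ (fun _ _ => IsPol.add) (by simpa using IsPol.one.smul 0) fun _ _ => isPol_mon _

theorem mul_K (f : LSeries) : f * K = ∑ ε : Fin 4 → Fin 2, f * mon fun r => ((ε r : ℕ) : ℤ) :=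
  Finset.mul_sum ..

theorem CT_mul_K_pow (s : Fin 4 → ℤ) (f : LSeries) (k : ℕ) : CT (mon s * f * K ^ (k + 1)) =
    ∑ ε : Fin 4 → Fin 2, CT (mon (s + fun r => ((ε r : ℕ) : ℤ)) * f * K ^ k) := by
  rw [pow_succ, ← mul_assoc, mul_K, map_sum]
  refine Finset.sum_congr rfl fun ε _ => congrArg _ ?_
  rw [mon_add]
  ring

theorem CT_mon_perm (k : ℕ) (s : Fin 4 → ℤ) (σ : Equiv.Perm (Fin 4)) :
    CT (mon (s ∘ σ) * K ^ k) = CT (mon s * K ^ k) := by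
  induction k generalizing s with
  | zero =>
    rw [pow_zero, mul_one, mul_one, CT_mon, CT_mon]
    congr 1
    rw [eq_iff_iff]
    constructor
    · intro h i
      have h1 := h (σ.symm i)
      have h2 := h (σ.symm 3)
      simp only [Function.comp_apply, Equiv.apply_symm_apply] at h1 h2
      rw [h1, h2]
    · intro h i
      rw [Function.comp_apply, Function.comp_apply, h, h (σ 3)]
  | succ k ih =>
    have h1 := CT_mul_K_pow (s ∘ σ) 1 k
    have h2 := CT_mul_K_pow s 1 k
    simp only [mul_one] at h1 h2
    rw [h1, h2]
    refine Fintype.sum_equiv (σ.arrowCongr (Equiv.refl _)) _ _ fun ε => ?_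
    rw [← ih (s + _)]
    refine congrArg (fun t => CT (mon t * K ^ k)) (funext fun r => ?_)
    simp [Equiv.arrowCongr]

/-- Antisymmetrised monomials. -/
noncomputable def asym (e : Fin 4 → ℤ) : LSeries :=
  ∑ τ : Equiv.Perm (Fin 4), (Equiv.Perm.sign τ : ℤ) • mon (e ∘ τ)

theorem CT_asym (k : ℕ) (e s : Fin 4 → ℤ) : CT (mon (-s) * asym e * K ^ k) =
    ∑ τ : Equiv.Perm (Fin 4), (Equiv.Perm.sign τ : ℤ) • CT (mon (e ∘ τ - s) * K ^ k) := by
  rw [asym, Finset.mul_sum, Finset.sum_mul, map_sum]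
  refine Finset.sum_congr rfl fun τ _ => ?_
  rw [mul_smul_comm, smul_mul_assoc, map_zsmul, ← mon_add, neg_add_eq_sub]

theorem CT_asym_succ (k : ℕ) (e s : Fin 4 → ℤ) : CT (mon (-s) * asym e * K ^ (k + 1)) =
    ∑ ε, CT (mon (-dec s ε) * asym e * K ^ k) := by
  rw [CT_mul_K_pow]
  refine Finset.sum_congr rfl fun ε _ =>
    congrArg (fun t => CT (mon t * asym e * K ^ k)) (funext fun r => ?_)
  simp only [dec, Pi.add_apply, Pi.neg_apply]
  ring

theorem eq_zero_of_eq_neg {f : PowerSeries ℚ} (h : f = -f) : f = 0 := by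
  ext n
  have := congrArg (coeff n) h
  rw [map_neg] at this
  rw [map_zero]
  linarith

theorem CT_asym_eq_zero (k : ℕ) (e s : Fin 4 → ℤ) {i j : Fin 4} (hij : i ≠ j) (hs : s i = s j) :
    CT (mon (-s) * asym e * K ^ k) = 0 := by
  have hs' : s ∘ Equiv.swap i j = s := by
    funext r
    rw [Function.comp_apply, Equiv.swap_apply_def]
    split_ifs with h1 h2
    · rw [h1, hs]
    · rw [h2, hs]
    · rfl
  have key : CT (mon (-s) * asym e * K ^ k) = -CT (mon (-s) * asym e * K ^ k) := by
    rw [CT_asym, ← Finset.sum_neg_distrib]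
    refine Fintype.sum_equiv (Equiv.mulRight (Equiv.swap i j)) _ _ fun τ => ?_
    rw [Equiv.coe_mulRight, Equiv.Perm.sign_mul, Equiv.Perm.sign_swap hij, ← CT_mon_perm k _ (Equiv.swap i j)]
    rw [show (e ∘ τ - s) ∘ Equiv.swap i j = e ∘ (τ * Equiv.swap i j) - s by
      conv_rhs => rw [← hs']
      rfl]
    simp
  exact eq_zero_of_eq_neg key

/-- Strictly increasing quadruples. -/
def Inc (s : Fin 4 → ℤ) : Prop := s 0 < s 1 ∧ s 1 < s 2 ∧ s 2 < s 3

instance : DecidablePred Inc := fun _ => inferInstanceAs (Decidable (_ ∧ _ ∧ _))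

theorem Inc.strictMono {s : Fin 4 → ℤ} (h : Inc s) : StrictMono s := by
  obtain ⟨h0, h1, h2⟩ := h
  rw [Fin.strictMono_iff_lt_succ]
  intro i
  fin_cases i
  exacts [h0, h1, h2]

/-- The indicator of the translates of a quadruple. -/
noncomputable def ind (e s : Fin 4 → ℤ) : PowerSeries ℚ := if ∀ r, e r - s r = e 3 - s 3 then 1 else 0

theorem CT_asym_of_inc {e s : Fin 4 → ℤ} (he : Inc e) (hs : Inc s) :
    CT (mon (-s) * asym e * K ^ 0) = ind e s := by
  rw [CT_asym, Finset.sum_eq_single 1]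
  · simp only [Equiv.Perm.sign_one, pow_zero, mul_one, CT_mon, ind]
    simp
  · intro τ _ hτ
    rw [pow_zero, mul_one, CT_mon, if_neg, smul_zero]
    intro h
    refine hτ ?_
    have h1 : StrictMono (e ∘ τ) := by
      intro a b hab
      have := hs.strictMono hab
      have ha := h a
      have hb := h b
      simp only [Pi.sub_apply] at ha hb
      omega
    have h2 : StrictMono τ := fun a b hab => he.strictMono.lt_iff_lt.1 (h1 hab)
    exact Equiv.ext fun x => DFunLike.congr_fun (Subsingleton.elim
      (StrictMono.orderIsoOfSurjective τ h2 τ.surjective) (OrderIso.refl _)) x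
  · simp

/-- The transfer operator of four non-intersecting paths. -/
noncomputable def Tr : Module.End (PowerSeries ℚ) ((Fin 4 → ℤ) → PowerSeries ℚ) where
  toFun f s := if Inc s then ∑ ε, f (dec s ε) else 0
  map_add' f g := by
    funext s
    simp only [Pi.add_apply]
    split_ifs
    · rw [← Finset.sum_add_distrib]
    · simp
  map_smul' c f := by
    funext s
    simp only [Pi.smul_apply, RingHom.id_apply]
    split_ifs
    · rw [Finset.smul_sum]
    · simp

theorem Tr_apply (f : (Fin 4 → ℤ) → PowerSeries ℚ) (s : Fin 4 → ℤ) :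
    Tr f s = if Inc s then ∑ ε, f (dec s ε) else 0 := rfl

/-- Weakly increasing quadruples. -/
def WInc (s : Fin 4 → ℤ) : Prop := s 0 ≤ s 1 ∧ s 1 ≤ s 2 ∧ s 2 ≤ s 3

theorem dec_bounds (s : Fin 4 → ℤ) (ε) (r : Fin 4) : s r - 1 ≤ dec s ε r ∧ dec s ε r ≤ s r := by
  have := (ε r).isLt
  unfold dec
  omega

theorem Inc.dec {s : Fin 4 → ℤ} (h : Inc s) (ε) : WInc (dec s ε) := by
  have := dec_bounds s ε 0; have := dec_bounds s ε 1; have := dec_bounds s ε 2; have := dec_bounds s ε 3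
  unfold Inc at h
  unfold WInc
  omega

theorem CT_asym_of_not_inc (k : ℕ) (e : Fin 4 → ℤ) {s : Fin 4 → ℤ} (hs : WInc s) (h : ¬Inc s) :
    CT (mon (-s) * asym e * K ^ k) = 0 := by
  have h' : s 0 = s 1 ∨ s 1 = s 2 ∨ s 2 = s 3 := by
    unfold WInc at hs
    unfold Inc at h
    omega
  rcases h' with h' | h' | h' <;> exact CT_asym_eq_zero k e s (by decide) h'

theorem Tr_pow_ind_of_not_inc (k : ℕ) {e s : Fin 4 → ℤ} (he : Inc e) (hs : ¬Inc s) :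
    (Tr ^ k) (ind e) s = 0 := by
  cases k with
  | zero =>
    rw [pow_zero, Module.End.one_apply, ind, if_neg]
    intro h
    refine hs ?_
    have h0 := h 0
    have h1 := h 1
    have h2 := h 2
    unfold Inc at *
    omega
  | succ k => rw [pow_succ', Module.End.mul_apply, Tr_apply, if_neg hs]

/-- The non-intersecting paths formula. -/
theorem Tr_pow_ind (k : ℕ) {e s : Fin 4 → ℤ} (he : Inc e) (hs : WInc s) :
    (Tr ^ k) (ind e) s = CT (mon (-s) * asym e * K ^ k) := by
  induction k generalizing s with
  | zero =>
    by_cases h : Inc s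
    · exact (CT_asym_of_inc he h).symm
    · rw [Tr_pow_ind_of_not_inc 0 he h, CT_asym_of_not_inc 0 e hs h]
  | succ k ih =>
    by_cases h : Inc s
    · rw [pow_succ', Module.End.mul_apply, Tr_apply, if_pos h, CT_asym_succ]
      exact Finset.sum_congr rfl fun ε _ => ih (h.dec ε)
    · rw [Tr_pow_ind_of_not_inc _ he h, CT_asym_of_not_inc _ e hs h]

end ThreeChoice

namespace ThreeChoice
open PowerSeries

theorem coeff_uS_pow (m g : ℕ) : (v m g : ℚ) = coeff m (uS ^ g) := by
  induction m generalizing g with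
  | zero =>
    rw [coeff_zero_eq_constantCoeff_apply, map_pow, constantCoeff_uS]
    rcases g with _ | g
    · simp [v]
    · simp [v]; omega
  | succ m ih =>
    rcases g with _ | g
    · simp [v, coeff_one]
    · have h : uS ^ (g + 1) = X * (uS ^ g + 2 * uS ^ (g + 1) + uS ^ (g + 2)) := by
        linear_combination uS ^ g * uS_eq
      have h2 : (2 : PowerSeries ℚ) = C 2 := rfl
      rw [h, coeff_succ_X_mul, map_add, map_add, h2, coeff_C_mul, ← ih, ← ih, ← ih, v, if_pos (by omega)]
      push_cast
      rw [add_sub_cancel_right, add_assoc (g : ℤ) 1 1, one_add_one_eq_two]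

theorem coeff_uS_pow_toNat (m : ℕ) {g : ℤ} (hg : 0 ≤ g) : (v m g : ℚ) = coeff m (uS ^ g.toNat) := by
  rw [← coeff_uS_pow, Int.toNat_of_nonneg hg]

/-- The generating function of the numbers `q i j s`. -/
noncomputable def Phi (s : Fin 4 → ℤ) : PowerSeries ℚ :=
  PowerSeries.mk fun l => ∑ κ ∈ Finset.HasAntidiagonal.antidiagonal l, (q κ.1 κ.2 s : ℚ)

/-- The contribution of the quadruples with a coincidence. -/
noncomputable def bd (s : Fin 4 → ℤ) : PowerSeries ℚ :=
  if s 1 < s 2 then (if s 0 = s 1 then uS ^ (s 3 - s 2).toNat else 0) +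
    (if s 2 = s 3 then uS ^ (s 1 - s 0).toNat else 0) - (if s 0 = s 1 ∧ s 2 = s 3 then 1 else 0)
  else 0

theorem Phi_of_inc {s : Fin 4 → ℤ} (hs : Inc s) : Phi s = X ^ 2 * ∑ ε, Phi (dec s ε) := by
  have h0 (j) : q 0 j s = 0 := by
    rw [q, if_neg]; unfold Inc at hs; omega
  have h1 (i) : q i 0 s = 0 := by
    cases i with
    | zero => exact h0 0
    | succ i => rw [q, if_neg]; unfold Inc at hs; omega
  ext l
  rw [coeff_X_pow_mul', Phi, coeff_mk]
  rcases l with _ | _ | l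
  · simp [h0]
  · simp [Finset.Nat.antidiagonal_succ, h0, h1]
  · rw [Finset.Nat.antidiagonal_succ_succ', if_pos (by omega)]
    simp only [Finset.sum_cons, h0, h1, Finset.sum_map]
    simp only [Phi, map_sum, coeff_mk]
    rw [Finset.sum_comm]
    simp [q, if_pos (show s 0 < s 1 ∧ s 1 < s 2 ∧ s 2 < s 3 from hs)]

theorem Phi_of_not_inc {s : Fin 4 → ℤ} (hs : WInc s) (h : ¬Inc s) : Phi s = bd s := by
  have h2 (i j) : q (i + 1) (j + 1) s = 0 := by
    rw [q]; exact if_neg h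
  unfold WInc at hs
  unfold Inc at h
  ext l
  rw [Phi, coeff_mk]
  have key : ∑ κ ∈ Finset.HasAntidiagonal.antidiagonal l, (q κ.1 κ.2 s : ℚ) =
      q 0 l s + if l = 0 then 0 else (q l 0 s : ℚ) := by
    rcases l with _ | _ | l
    · simp
    · simp [Finset.Nat.antidiagonal_succ]
    · rw [Finset.Nat.antidiagonal_succ_succ']
      simp [h2]
  have hl : q 0 l s = if s 0 = s 1 ∧ s 1 < s 2 then v l (s 3 - s 2) else 0 := by rw [q]
  have hr (h : l ≠ 0) : q l 0 s = if s 1 < s 2 ∧ s 2 = s 3 then v l (s 1 - s 0) else 0 := by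
    obtain ⟨l, rfl⟩ := Nat.exists_eq_succ_of_ne_zero h
    rw [q]
  rw [key, bd]
  by_cases h12 : s 1 < s 2
  · rw [if_pos h12, map_sub, map_add, hl]
    by_cases h01 : s 0 = s 1
    · rw [if_pos ⟨h01, h12⟩, if_pos h01, ← coeff_uS_pow_toNat _ (by omega)]
      by_cases h23 : s 2 = s 3
      · rw [if_pos h23,
          if_pos (⟨h01, h23⟩ : s 0 = s 1 ∧ s 2 = s 3), ← coeff_uS_pow_toNat _ (by omega), h01, sub_self, coeff_one]
        by_cases h0 : l = 0
        · simp [h0, v]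
        · rw [if_neg h0, hr h0, if_pos ⟨h12, h23⟩, h01, sub_self]; simp [h0]
      · rw [if_neg h23, if_neg (c := s 0 = s 1 ∧ s 2 = s 3) (by tauto)]
        by_cases h0 : l = 0
        · rw [if_pos h0]; simp
        · rw [if_neg h0, hr h0, if_neg (by tauto)]; simp
    · have h23 : s 2 = s 3 := by omega
      rw [if_neg (by tauto), if_neg h01, if_pos h23,
        if_neg (c := s 0 = s 1 ∧ s 2 = s 3) (by tauto),
        ← coeff_uS_pow_toNat _ (by omega)]
      by_cases h0 : l = 0
      · rw [if_pos h0, h0, v, if_neg (by omega)]; simp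
      · rw [if_neg h0, hr h0, if_pos ⟨h12, h23⟩]; simp
  · rw [if_neg h12, hl, if_neg (by tauto)]
    by_cases h0 : l = 0
    · rw [if_pos h0]; simp
    · rw [if_neg h0, hr h0, if_neg (by tauto)]; simp

theorem Phi_of_wInc {s : Fin 4 → ℤ} (hs : WInc s) : Phi s = bd s + X ^ 2 * Tr Phi s := by
  rw [Tr_apply]
  by_cases h : Inc s
  · have hb : bd s = 0 := by
      obtain ⟨h0, h1, h2⟩ := h
      rw [bd, if_pos h1, if_neg h0.ne, if_neg h2.ne, if_neg (by omega)]
      simp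
    rw [if_pos h, Phi_of_inc h, hb, zero_add]
  · rw [if_neg h, Phi_of_not_inc hs h, mul_zero, add_zero]

theorem Tr_congr {f g : (Fin 4 → ℤ) → PowerSeries ℚ} (h : ∀ s, WInc s → f s = g s) : Tr f = Tr g := by
  funext s
  rw [Tr_apply, Tr_apply]
  split_ifs with hs
  · exact Finset.sum_congr rfl fun ε _ => h _ (hs.dec ε)
  · rfl

theorem Tr_Phi (M : ℕ) : Tr Phi = ∑ k ∈ Finset.range M, (X ^ 2 : PowerSeries ℚ) ^ k • (Tr ^ k) (Tr bd) +
    (X ^ 2 : PowerSeries ℚ) ^ M • (Tr ^ M) (Tr Phi) := by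
  have h : Tr Phi = Tr bd + (X ^ 2 : PowerSeries ℚ) • Tr (Tr Phi) := by
    rw [← map_smul, ← map_add]
    exact Tr_congr fun s hs => Phi_of_wInc hs
  induction M with
  | zero => simp
  | succ M ih =>
    conv_lhs => rw [ih, h]
    rw [Finset.sum_range_succ, add_assoc, map_add, map_smul, smul_add, smul_smul, ← pow_succ, pow_succ Tr]
    rfl

theorem Phi_sub_dvd (M : ℕ) {s : Fin 4 → ℤ} (hs : WInc s) :
    X ^ M ∣ Phi s - (bd s + X ^ 2 * ∑ k ∈ Finset.range M, (X ^ 2) ^ k * (Tr ^ k) (Tr bd) s) := by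
  have h := congrFun (Tr_Phi M) s
  rw [Phi_of_wInc hs, h]
  simp only [Pi.add_apply, Finset.sum_apply, Pi.smul_apply, smul_eq_mul]
  refine ⟨X ^ (M + 2) * (Tr ^ M) (Tr Phi) s, ?_⟩
  ring

end ThreeChoice

namespace ThreeChoice
open PowerSeries

theorem sum_fin4 {M : Type*} [AddCommMonoid M] (f : (Fin 4 → Fin 2) → M) :
    ∑ ε, f ε = ∑ a, ∑ b, ∑ c, ∑ d, f ![a, b, c, d] := by
  let φ : (Fin 4 → Fin 2) ≃ Fin 2 × Fin 2 × Fin 2 × Fin 2 :=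
    { toFun := fun ε => (ε 0, ε 1, ε 2, ε 3)
      invFun := fun p => ![p.1, p.2.1, p.2.2.1, p.2.2.2]
      left_inv := fun ε => by
        funext r
        fin_cases r <;> rfl
      right_inv := fun p => rfl }
  rw [← φ.symm.sum_comp, Fintype.sum_prod_type]
  refine Finset.sum_congr rfl fun a _ => ?_
  rw [Fintype.sum_prod_type]
  refine Finset.sum_congr rfl fun b _ => ?_
  rw [Fintype.sum_prod_type]
  rfl

theorem Tr_bd {s : Fin 4 → ℤ} (hs : Inc s) : Tr bd s =
    (if s 1 = s 0 + 1 then uS ^ (s 3 - s 2 - 1).toNat * (1 + uS) ^ 2 else 0) +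
    (if s 3 = s 2 + 1 then uS ^ (s 1 - s 0 - 1).toNat * (1 + uS) ^ 2 else 0) -
    if s 1 = s 0 + 1 ∧ s 3 = s 2 + 1 then 1 else 0 := by
  rw [Tr_apply, if_pos hs]
  obtain ⟨h0, h1, h2⟩ := hs
  obtain ⟨a, ha⟩ := Int.le.dest h0
  obtain ⟨g, hg⟩ := Int.le.dest h1
  obtain ⟨h, hh⟩ := Int.le.dest h2
  have hb (ε : Fin 4 → Fin 2) : bd (dec s ε) =
      (if (a : ℤ) + 1 + (ε 0 : ℕ) = (ε 1 : ℕ) then uS ^ ((h : ℤ) + 1 + (ε 2 : ℕ) - (ε 3 : ℕ)).toNat else 0) +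
      (if (h : ℤ) + 1 + (ε 2 : ℕ) = (ε 3 : ℕ) then uS ^ ((a : ℤ) + 1 + (ε 0 : ℕ) - (ε 1 : ℕ)).toNat else 0) -
      (if (a : ℤ) + 1 + (ε 0 : ℕ) = (ε 1 : ℕ) ∧ (h : ℤ) + 1 + (ε 2 : ℕ) = (ε 3 : ℕ) then 1 else 0) := by
    have e0 := (ε 0).isLt
    have e1 := (ε 1).isLt
    have e2 := (ε 2).isLt
    have e3 := (ε 3).isLt
    have i1 : dec s ε 0 = dec s ε 1 ↔ (a : ℤ) + 1 + (ε 0 : ℕ) = (ε 1 : ℕ) := by unfold dec; omega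
    have i2 : dec s ε 2 = dec s ε 3 ↔ (h : ℤ) + 1 + (ε 2 : ℕ) = (ε 3 : ℕ) := by unfold dec; omega
    have j1 : dec s ε 1 - dec s ε 0 = (a : ℤ) + 1 + (ε 0 : ℕ) - (ε 1 : ℕ) := by unfold dec; omega
    have j2 : dec s ε 3 - dec s ε 2 = (h : ℤ) + 1 + (ε 2 : ℕ) - (ε 3 : ℕ) := by unfold dec; omega
    rw [bd]
    simp only [i1, i2, j1, j2]
    split_ifs with h3
    all_goals first | rfl | (exfalso; unfold dec at h3; omega) | simp
  have k1 : s 1 = s 0 + 1 ↔ a = 0 := by omega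
  have k2 : s 3 = s 2 + 1 ↔ h = 0 := by omega
  have k3 : (s 3 - s 2 - 1).toNat = h := by omega
  have k4 : (s 1 - s 0 - 1).toNat = a := by omega
  simp only [hb, k1, k2, k3, k4, sum_fin4, Fin.sum_univ_two]
  simp only [Matrix.cons_val, Fin.val_zero, Fin.val_one, Nat.cast_zero, Nat.cast_one, add_zero, sub_zero]
  have t1 (a : ℕ) : ((a : ℤ) + 1).toNat = a + 1 := by omega
  have t2 (a : ℕ) : ((a : ℤ) + 1 - 1).toNat = a := by omega
  have t3 (a : ℕ) : ((a : ℤ) + 1 + 1 - 1).toNat = a + 1 := by omega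
  have t4 (a : ℕ) : ((a : ℤ) + 1 + 1).toNat = a + 2 := by omega
  have c1 (a : ℕ) : ((a : ℤ) + 1 = 0) ↔ False := iff_of_false (by omega) id
  have c2 (a : ℕ) : ((a : ℤ) + 1 + 1 = 0) ↔ False := iff_of_false (by omega) id
  have c3 (a : ℕ) : ((a : ℤ) + 1 = 1) ↔ a = 0 := by omega
  have c4 (a : ℕ) : ((a : ℤ) + 1 + 1 = 1) ↔ False := iff_of_false (by omega) id
  simp only [t1, t2, t3, t4, c1, c2, c3, c4, if_false, false_and, and_false]
  split_ifs with u1 u2 u3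
  all_goals first | omega | ring

/-- A quadruple with first gap one. -/
def eL (g h : ℕ) : Fin 4 → ℤ := ![0, 1, 2 + g, 3 + g + h]

/-- A quadruple with last gap one. -/
def eR (g h : ℕ) : Fin 4 → ℤ := ![0, 1 + h, 2 + g + h, 3 + g + h]

theorem inc_eL (g h : ℕ) : Inc (eL g h) := by
  simp only [Inc, eL, Matrix.cons_val]
  omega

theorem inc_eR (g h : ℕ) : Inc (eR g h) := by
  simp only [Inc, eR, Matrix.cons_val]
  omega

theorem ind_eL (g h : ℕ) (s : Fin 4 → ℤ) : ind (eL g h) s =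
    if s 1 - s 0 = 1 ∧ s 2 - s 1 = 1 + g ∧ s 3 - s 2 = 1 + h then 1 else 0 := by
  rw [ind]
  congr 1
  simp only [Fin.forall_fin_succ, eL, eq_iff_iff]
  simp
  omega

theorem ind_eR (g h : ℕ) (s : Fin 4 → ℤ) : ind (eR g h) s =
    if s 1 - s 0 = 1 + h ∧ s 2 - s 1 = 1 + g ∧ s 3 - s 2 = 1 then 1 else 0 := by
  rw [ind]
  congr 1
  simp only [Fin.forall_fin_succ, eR, eq_iff_iff]
  simp
  omega

/-- Truncation of the source term in terms of indicators. -/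
noncomputable def src (M : ℕ) : (Fin 4 → ℤ) → PowerSeries ℚ :=
  ∑ g ∈ Finset.range M, (∑ h ∈ Finset.range M, (uS ^ h * (1 + uS) ^ 2) • (ind (eL g h) + ind (eR g h))
    - ind (eL g 0))

theorem sum_range_ite_dvd (M a : ℕ) (c : PowerSeries ℚ) :
    X ^ M ∣ uS ^ a * c - ∑ h ∈ Finset.range M, (uS ^ h * c) * if a = h then 1 else 0 := by
  rw [Finset.sum_congr rfl fun h _ => mul_ite ..]
  simp only [mul_one, mul_zero, Finset.sum_ite_eq, Finset.mem_range]
  split_ifs with h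
  · simp
  · rw [sub_zero]
    refine Dvd.dvd.mul_right ?_ _
    rw [uS_eq, mul_pow]
    exact (pow_dvd_pow _ (by omega)).mul_right _

theorem Tr_bd_sub_src {M : ℕ} {s : Fin 4 → ℤ} (hM : s 2 - s 1 ≤ M) : X ^ M ∣ (Tr bd - src M) s := by
  by_cases hs : Inc s
  · have hM' := hM
    rw [Pi.sub_apply, Tr_bd hs]
    obtain ⟨h0, h1, h2⟩ := hs
    obtain ⟨a, ha⟩ := Int.le.dest h0
    obtain ⟨g, hg⟩ := Int.le.dest h1
    obtain ⟨h, hh⟩ := Int.le.dest h2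
    have k1 : s 1 = s 0 + 1 ↔ a = 0 := by omega
    have k2 : s 3 = s 2 + 1 ↔ h = 0 := by omega
    have k3 : (s 3 - s 2 - 1).toNat = h := by omega
    have k4 : (s 1 - s 0 - 1).toNat = a := by omega
    have l1 (h' : ℕ) (g' : ℕ) : ind (eL g' h') s = if g = g' then
        (if a = 0 then 1 else 0) * (if h = h' then 1 else 0) else 0 := by
      rw [ind_eL]
      split_ifs
      all_goals first | (exfalso; omega) | simp
    have l2 (h' : ℕ) (g' : ℕ) : ind (eR g' h') s = if g = g' then
        (if h = 0 then 1 else 0) * (if a = h' then 1 else 0) else 0 := by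
      rw [ind_eR]
      split_ifs
      all_goals first | (exfalso; omega) | simp
    have hs : src M s = ∑ h' ∈ Finset.range M, (uS ^ h' * (1 + uS) ^ 2) *
        ((if a = 0 then 1 else 0) * (if h = h' then 1 else 0) + (if h = 0 then 1 else 0) * (if a = h' then 1 else 0)) -
        (if a = 0 then 1 else 0) * (if h = 0 then 1 else 0) := by
      rw [src, Finset.sum_apply, Finset.sum_eq_single g]
      · simp only [Pi.sub_apply, Finset.sum_apply, Pi.smul_apply, Pi.add_apply, l1, l2, if_true, smul_eq_mul]
      · intro b _ hb
        simp only [Pi.sub_apply, Finset.sum_apply, Pi.smul_apply, Pi.add_apply, l1, l2, if_neg hb.symm]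
        simp
      · intro h
        exfalso
        rw [Finset.mem_range] at h
        omega
    rw [hs]
    simp only [k1, k2, k3, k4]
    have d1 := (sum_range_ite_dvd M h ((1 + uS) ^ 2)).mul_left (if a = 0 then 1 else 0)
    have d2 := (sum_range_ite_dvd M a ((1 + uS) ^ 2)).mul_left (if h = 0 then 1 else 0)
    refine (dvd_add d1 d2).trans (dvd_of_eq ?_)
    by_cases ea : a = 0 <;> by_cases eh : h = 0 <;>
      simp only [ea, eh, if_true, if_false, mul_add, Finset.sum_add_distrib, true_and, false_and,
        one_mul, zero_mul, mul_zero, Finset.sum_const_zero] <;> ring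
  · have h1 : Tr bd s = 0 := by rw [Tr_apply, if_neg hs]
    have h2 : src M s = 0 := by
      have h3 (e) (he : Inc e) : ind e s = 0 := Tr_pow_ind_of_not_inc 0 he hs
      simp only [src, Finset.sum_apply, Pi.sub_apply, Pi.smul_apply, Pi.add_apply,
        h3 _ (inc_eL _ _), h3 _ (inc_eR _ _)]
      simp
    rw [Pi.sub_apply, h1, h2, sub_zero]
    exact dvd_zero _

theorem Tr_pow_dvd {d : PowerSeries ℚ} {f : (Fin 4 → ℤ) → PowerSeries ℚ} {G : ℤ}
    (hf : ∀ s, s 2 - s 1 ≤ G → d ∣ f s) (k : ℕ) (s : Fin 4 → ℤ) (hs : s 2 - s 1 + k ≤ G) :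
    d ∣ (Tr ^ k) f s := by
  induction k generalizing s with
  | zero => exact hf s (by simpa using hs)
  | succ k ih =>
    rw [pow_succ', Module.End.mul_apply, Tr_apply]
    split_ifs
    · refine Finset.dvd_sum fun ε _ => ih _ ?_
      have h1 := dec_bounds s ε 1
      have h2 := dec_bounds s ε 2
      push_cast at hs
      omega
    · exact dvd_zero _

theorem Tr_pow_ind_eq_zero {e : Fin 4 → ℤ} {k : ℕ} {s : Fin 4 → ℤ} (h : s 2 - s 1 + k < e 2 - e 1) :
    (Tr ^ k) (ind e) s = 0 := by
  refine zero_dvd_iff.1 (Tr_pow_dvd (G := e 2 - e 1 - 1) (fun t ht => ?_) k s (by omega))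
  rw [ind, if_neg]
  intro h'
  have h1 := h' 1
  have h2 := h' 2
  omega

end ThreeChoice

namespace ThreeChoice
open PowerSeries

theorem sum_reindex_dvd (M : ℕ) (x : PowerSeries ℚ) (hx : X ∣ x) (a : ℕ → ℕ → PowerSeries ℚ)
    (ha : ∀ k g, k < g → a k g = 0) :
    X ^ M ∣ ∑ k ∈ Finset.range M, ∑ g ∈ Finset.range M, x ^ k * a k g -
      ∑ k ∈ Finset.range M, ∑ g ∈ Finset.range M, x ^ (k + g) * a (k + g) g := by
  rw [Finset.sum_comm, Finset.sum_comm (s := Finset.range M) (t := Finset.range M)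
    (f := fun k g => x ^ (k + g) * a (k + g) g), ← Finset.sum_sub_distrib]
  refine Finset.dvd_sum fun g hg => ?_
  have h1 : ∑ k ∈ Finset.range M, x ^ (k + g) * a (k + g) g =
      ∑ k ∈ Finset.range (M + g), x ^ k * a k g := by
    rw [add_comm M g, Finset.sum_range_add _ g M, Finset.sum_eq_zero (s := Finset.range g) (fun k hk => ?_), zero_add]
    · exact Finset.sum_congr rfl fun k _ => by rw [add_comm]
    · rw [ha _ _ (Finset.mem_range.1 hk), mul_zero]
  rw [h1, Finset.sum_range_add, ← sub_sub, sub_self, zero_sub, dvd_neg]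
  refine Finset.dvd_sum fun k _ => Dvd.dvd.mul_right ?_ _
  exact (pow_dvd_pow_of_dvd hx M).trans (pow_dvd_pow x (by omega))

/-- The geometric series. -/
noncomputable def geo (y : LSeries) : LSeries := invOfUnit (1 - y) 1

theorem mul_geo {y : LSeries} (h : X ∣ y) : (1 - y) * geo y = 1 :=
  mul_invOfUnit _ _ (by simp [X_dvd_iff.1 h])

theorem isUnit_one_sub {y : LSeries} (h : X ∣ y) : IsUnit (1 - y) :=
  IsUnit.of_mul_eq_one _ (mul_geo h)

theorem IsRat.geo {y : LSeries} (hy : IsRat y) (h : X ∣ y) : IsRat (geo y) :=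
  IsRat.of_mul_eq (IsPol.one.isRat.sub hy) (isUnit_one_sub h) IsPol.one.isRat (mul_geo h)

/-- Congruence modulo a power of the main variable. -/
noncomputable def md (M : ℕ) : LSeries →+* LSeries ⧸ Ideal.span {(X : LSeries) ^ M} :=
  Ideal.Quotient.mk _

theorem md_eq {M : ℕ} {f g : LSeries} : md M f = md M g ↔ X ^ M ∣ f - g := by
  rw [md, Ideal.Quotient.eq, Ideal.mem_span_singleton]

theorem md_geo (M : ℕ) {y : LSeries} (h : X ∣ y) :
    md M (geo y) = md M (∑ k ∈ Finset.range M, y ^ k) := by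
  rw [md_eq, ← (isUnit_one_sub h).dvd_mul_left, mul_sub, mul_geo h, mul_neg_geom_sum, sub_sub_cancel]
  exact pow_dvd_pow_of_dvd h M

theorem CT_congr {M : ℕ} {f g : LSeries} (h : md M f = md M g) : X ^ M ∣ CT f - CT g := by
  rw [← map_sub, CT_apply]
  exact lmap_X_pow_dvd _ _ ((md_eq.1 h).mul_left _)

theorem X_dvd_U : X ∣ U := by
  rw [U_eq]
  exact dvd_mul_right _ _

/-- The kernel of the four-path problem with end condition. -/
noncomputable def ker : LSeries := ∑ τ : Equiv.Perm (Fin 4), (Equiv.Perm.sign τ : ℤ) •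
  (mon (![0, 1, 2, 3] ∘ τ) * (geo (X ^ 2 * K) * geo (X ^ 2 * K * mon (![0, 0, 1, 1] ∘ τ)) *
    ((1 + U) ^ 2 * (geo (U * mon (![0, 0, 0, 1] ∘ τ)) + geo (U * mon (![0, 1, 1, 1] ∘ τ))) - 1)))

theorem mon_eL (τ : Equiv.Perm (Fin 4)) (g h : ℕ) : mon (eL g h ∘ τ) =
    mon (![0, 1, 2, 3] ∘ τ) * mon (![0, 0, 1, 1] ∘ τ) ^ g * mon (![0, 0, 0, 1] ∘ τ) ^ h := by
  rw [← mon_nsmul, ← mon_nsmul, ← mon_add, ← mon_add]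
  refine congrArg mon (funext fun r => ?_)
  simp only [Function.comp_apply, Pi.add_apply, Pi.smul_apply]
  generalize τ r = r
  fin_cases r <;> simp [eL]

theorem mon_eR (τ : Equiv.Perm (Fin 4)) (g h : ℕ) : mon (eR g h ∘ τ) =
    mon (![0, 1, 2, 3] ∘ τ) * mon (![0, 0, 1, 1] ∘ τ) ^ g * mon (![0, 1, 1, 1] ∘ τ) ^ h := by
  rw [← mon_nsmul, ← mon_nsmul, ← mon_add, ← mon_add]
  refine congrArg mon (funext fun r => ?_)
  simp only [Function.comp_apply, Pi.add_apply, Pi.smul_apply]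
  generalize τ r = r
  fin_cases r <;> simp [eR]

/-- Truncation of `ker`. -/
noncomputable def kerT (M : ℕ) : LSeries := ∑ k ∈ Finset.range M, ∑ g ∈ Finset.range M,
  (X ^ 2) ^ (k + g) * K ^ (k + g) * (∑ h ∈ Finset.range M, U ^ h * (1 + U) ^ 2 *
    (asym (eL g h) + asym (eR g h)) - asym (eL g 0))

theorem sum_asym_eL (M g : ℕ) : ∑ h ∈ Finset.range M, U ^ h * (1 + U) ^ 2 *
    (asym (eL g h) + asym (eR g h)) - asym (eL g 0) =
    ∑ τ : Equiv.Perm (Fin 4), (Equiv.Perm.sign τ : ℤ) • (mon (![0, 1, 2, 3] ∘ τ) *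
      mon (![0, 0, 1, 1] ∘ τ) ^ g *
      ((1 + U) ^ 2 * (∑ h ∈ Finset.range M, (U * mon (![0, 0, 0, 1] ∘ τ)) ^ h +
      ∑ h ∈ Finset.range M, (U * mon (![0, 1, 1, 1] ∘ τ)) ^ h) - 1)) := by
  simp only [asym, ← Finset.sum_add_distrib]
  simp only [Finset.mul_sum _ _ (U ^ _ * _)]
  rw [Finset.sum_comm, ← Finset.sum_sub_distrib]
  refine Finset.sum_congr rfl fun τ _ => ?_
  simp only [mon_eL, mon_eR, ← smul_add, mul_smul_comm, ← Finset.smul_sum, ← smul_sub, pow_zero, mul_one]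
  refine congrArg _ ?_
  rw [mul_sub, mul_one, Finset.mul_sum, Finset.mul_sum]
  refine congrArg (· - _) ?_
  refine Finset.sum_congr rfl fun h _ => ?_
  ring

theorem sum_geom_aux {ι : Type*} (T : Finset ι) (M : ℕ) (σ : ι → ℤ) (m a b : ι → LSeries) (Y Z : LSeries) :
    ∑ k ∈ Finset.range M, ∑ g ∈ Finset.range M, Y ^ (k + g) * Z ^ (k + g) *
      ∑ τ ∈ T, σ τ • (m τ * a τ ^ g * b τ) =
    ∑ τ ∈ T, σ τ • (m τ * ((∑ k ∈ Finset.range M, (Y * Z) ^ k) *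
      (∑ g ∈ Finset.range M, (Y * Z * a τ) ^ g) * b τ)) := by
  simp only [Finset.mul_sum _ _ (Y ^ _ * _)]
  rw [Finset.sum_congr rfl fun k _ => Finset.sum_comm, Finset.sum_comm]
  refine Finset.sum_congr rfl fun τ _ => ?_
  rw [Finset.sum_mul_sum, Finset.sum_mul, Finset.mul_sum, Finset.smul_sum]
  refine Finset.sum_congr rfl fun k _ => ?_
  rw [Finset.sum_mul, Finset.mul_sum, Finset.smul_sum]
  refine Finset.sum_congr rfl fun g _ => ?_
  rw [mul_smul_comm]
  refine congrArg _ ?_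
  ring

theorem kerT_eq (M : ℕ) : kerT M = ∑ τ : Equiv.Perm (Fin 4), (Equiv.Perm.sign τ : ℤ) •
    (mon (![0, 1, 2, 3] ∘ τ) * ((∑ k ∈ Finset.range M, (X ^ 2 * K) ^ k) *
      (∑ g ∈ Finset.range M, (X ^ 2 * K * mon (![0, 0, 1, 1] ∘ τ)) ^ g) *
      ((1 + U) ^ 2 * (∑ h ∈ Finset.range M, (U * mon (![0, 0, 0, 1] ∘ τ)) ^ h +
        ∑ h ∈ Finset.range M, (U * mon (![0, 1, 1, 1] ∘ τ)) ^ h) - 1))) := by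
  simp only [kerT, sum_asym_eL]
  exact sum_geom_aux _ _ _ _ _ _ _ _

theorem md_ker (M : ℕ) : md M ker = md M (kerT M) := by
  have hX : (X : LSeries) ∣ X ^ 2 := dvd_pow_self _ two_ne_zero
  rw [kerT_eq, ker, map_sum, map_sum]
  refine Finset.sum_congr rfl fun τ _ => ?_
  simp only [map_zsmul, map_mul, map_sub, map_add, map_one, map_pow]
  rw [md_geo M (hX.mul_right K), md_geo M ((hX.mul_right K).mul_right _),
    md_geo M (X_dvd_U.mul_right _), md_geo M (X_dvd_U.mul_right _)]

end ThreeChoice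

namespace ThreeChoice
open PowerSeries

theorem CT_kerT (M : ℕ) (s : Fin 4 → ℤ) : CT (mon (-s) * kerT M) =
    ∑ k ∈ Finset.range M, ∑ g ∈ Finset.range M, (X ^ 2) ^ (k + g) *
      (∑ h ∈ Finset.range M, uS ^ h * (1 + uS) ^ 2 * (CT (mon (-s) * asym (eL g h) * K ^ (k + g)) +
        CT (mon (-s) * asym (eR g h) * K ^ (k + g))) - CT (mon (-s) * asym (eL g 0) * K ^ (k + g))) := by
  have hX (n : ℕ) : (X ^ 2 : LSeries) ^ n = emb ((X ^ 2) ^ n) := by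
    rw [map_pow, map_pow, emb_X]
  have hU (h : ℕ) : U ^ h * (1 + U) ^ 2 = emb (uS ^ h * (1 + uS) ^ 2) := by
    rw [map_mul, map_pow, map_pow, map_add, map_one, U]
  rw [kerT, Finset.mul_sum, map_sum]
  refine Finset.sum_congr rfl fun k _ => ?_
  rw [Finset.mul_sum, map_sum]
  refine Finset.sum_congr rfl fun g _ => ?_
  have h1 (A B : LSeries) : mon (-s) * ((X ^ 2) ^ (k + g) * K ^ (k + g) * (A - B)) =
      emb ((X ^ 2) ^ (k + g)) * (mon (-s) * K ^ (k + g) * A - mon (-s) * B * K ^ (k + g)) := by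
    rw [hX]; ring
  rw [h1, CT_emb_mul, map_sub, Finset.mul_sum, map_sum]
  refine congrArg (fun t => _ * (t - _)) (Finset.sum_congr rfl fun h _ => ?_)
  have h2 (A B : LSeries) : mon (-s) * K ^ (k + g) * (U ^ h * (1 + U) ^ 2 * (A + B)) =
      emb (uS ^ h * (1 + uS) ^ 2) * (mon (-s) * A * K ^ (k + g) + mon (-s) * B * K ^ (k + g)) := by
    rw [hU]; ring
  rw [h2, CT_emb_mul, map_add]

theorem Tr_src_sub_dvd (M : ℕ) {s : Fin 4 → ℤ} (hs : WInc s) (h1 : s 2 - s 1 = 1) :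
    X ^ M ∣ ∑ k ∈ Finset.range M, (X ^ 2) ^ k * (Tr ^ k) (src M) s - CT (mon (-s) * kerT M) := by
  have key := sum_reindex_dvd M (X ^ 2) (dvd_pow_self _ two_ne_zero)
    (fun k g => ∑ h ∈ Finset.range M, uS ^ h * (1 + uS) ^ 2 * ((Tr ^ k) (ind (eL g h)) s +
      (Tr ^ k) (ind (eR g h)) s) - (Tr ^ k) (ind (eL g 0)) s) (fun k g hkg => ?_)
  · convert key using 2
    · refine Finset.sum_congr rfl fun k _ => ?_
      rw [← Finset.mul_sum, src, map_sum, Finset.sum_apply]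
      refine congrArg _ (Finset.sum_congr rfl fun g _ => ?_)
      simp only [map_sub, map_sum, map_smul, map_add, Pi.sub_apply, Finset.sum_apply, Pi.smul_apply,
        Pi.add_apply, smul_eq_mul]
    · rw [CT_kerT]
      simp only [Tr_pow_ind _ (inc_eL _ _) hs, Tr_pow_ind _ (inc_eR _ _) hs]
  · have hL (h : ℕ) : (Tr ^ k) (ind (eL g h)) s = 0 := by
      refine Tr_pow_ind_eq_zero ?_
      simp only [eL, Matrix.cons_val]
      omega
    have hR (h : ℕ) : (Tr ^ k) (ind (eR g h)) s = 0 := by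
      refine Tr_pow_ind_eq_zero ?_
      simp only [eR, Matrix.cons_val]
      omega
    simp [hL, hR]

theorem eq_of_forall_X_pow_dvd {f g : PowerSeries ℚ} (h : ∀ M, X ^ M ∣ f - g) : f = g := by
  ext n
  have := X_pow_dvd_iff.1 (h (n + 1)) n (by omega)
  rwa [map_sub, sub_eq_zero] at this

theorem Phi_eq {s : Fin 4 → ℤ} (hs : WInc s) (h1 : s 2 - s 1 = 1) :
    Phi s = bd s + X ^ 2 * CT (mon (-s) * ker) := by
  refine eq_of_forall_X_pow_dvd fun M => ?_
  have d1 := Phi_sub_dvd M hs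
  have d2 : X ^ M ∣ ∑ k ∈ Finset.range M, (X ^ 2) ^ k * (Tr ^ k) (Tr bd) s -
      ∑ k ∈ Finset.range M, (X ^ 2) ^ k * (Tr ^ k) (src M) s := by
    rw [← Finset.sum_sub_distrib]
    refine Finset.dvd_sum fun k hk => ?_
    rw [← mul_sub, ← Pi.sub_apply, ← map_sub]
    rw [Finset.mem_range] at hk
    exact (Tr_pow_dvd (G := M) (fun t ht => Tr_bd_sub_src ht) k s (by omega)).mul_left _
  have d3 := Tr_src_sub_dvd M hs h1
  have d4 : X ^ M ∣ CT (mon (-s) * ker) - CT (mon (-s) * kerT M) :=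
    CT_congr (by rw [map_mul, map_mul, md_ker])
  have := dvd_add d1 (((d2.add d3).sub d4).mul_left (X ^ 2))
  refine this.trans (dvd_of_eq ?_)
  ring

/-- The initial quadruples. -/
def ini (p r : ℕ) (ε : Fin 2 × Fin 2) : Fin 4 → ℤ :=
  ![-1 - (p : ℤ) - ((ε.1 : ℕ) : ℤ), -1, 0, 1 + (r : ℤ) - ((ε.2 : ℕ) : ℤ)]

theorem wInc_ini (p r : ℕ) (ε : Fin 2 × Fin 2) : WInc (ini p r ε) := by
  have := ε.2.isLt
  simp only [WInc, ini, Matrix.cons_val]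
  omega

theorem Phi_ini (p r : ℕ) (ε : Fin 2 × Fin 2) :
    Phi (ini p r ε) = bd (ini p r ε) + X ^ 2 * CT (mon (-ini p r ε) * ker) :=
  Phi_eq (wInc_ini p r ε) (by simp [ini])

theorem sum_bd_ini (p r : ℕ) : ∑ ε, bd (ini p r ε) =
    (if p = 0 then uS ^ r * (1 + uS) else 0) + (if r = 0 then uS ^ p * (1 + uS) else 0) -
      if p = 0 ∧ r = 0 then 1 else 0 := by
  have hb (ε : Fin 2 × Fin 2) : bd (ini p r ε) =
      (if p = 0 ∧ ε.1 = 0 then uS ^ (1 + r - (ε.2 : ℕ)) else 0) +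
      (if r = 0 ∧ ε.2 = 1 then uS ^ (p + (ε.1 : ℕ)) else 0) -
      if (p = 0 ∧ ε.1 = 0) ∧ (r = 0 ∧ ε.2 = 1) then 1 else 0 := by
    have e1 := ε.1.isLt
    have e2 := ε.2.isLt
    have i1 : ini p r ε 0 = ini p r ε 1 ↔ p = 0 ∧ ε.1 = 0 := by
      simp only [ini, Matrix.cons_val, Fin.ext_iff, Fin.val_zero]
      omega
    have i2 : ini p r ε 2 = ini p r ε 3 ↔ r = 0 ∧ ε.2 = 1 := by
      simp only [ini, Matrix.cons_val, Fin.ext_iff, Fin.val_one]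
      omega
    have i3 : (ini p r ε 3 - ini p r ε 2).toNat = 1 + r - (ε.2 : ℕ) := by
      simp only [ini, Matrix.cons_val]
      omega
    have i4 : (ini p r ε 1 - ini p r ε 0).toNat = p + (ε.1 : ℕ) := by
      simp only [ini, Matrix.cons_val]
      omega
    have i5 : ini p r ε 1 < ini p r ε 2 := by simp [ini]
    rw [bd, if_pos i5]
    simp only [i1, i2, i3, i4]
  simp only [hb, Fintype.sum_prod_type, Fin.sum_univ_two]
  by_cases hp : p = 0 <;> by_cases hr : r = 0 <;> simp [hp, hr] <;> ring

theorem sum_mon_ini (p r : ℕ) : ∑ ε, mon (-ini p r ε) = mon ![1, 1, 0, -1] * (1 + mon ![1, 0, 0, 0]) *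
    (1 + mon ![0, 0, 0, 1]) * mon ![1, 0, 0, 0] ^ p * mon ![0, 0, 0, -1] ^ r := by
  have h (ε : Fin 2 × Fin 2) : mon (-ini p r ε) = mon ![1, 1, 0, -1] * mon ![1, 0, 0, 0] ^ (ε.1 : ℕ) *
      mon ![0, 0, 0, 1] ^ (ε.2 : ℕ) * mon ![1, 0, 0, 0] ^ p * mon ![0, 0, 0, -1] ^ r := by
    simp only [← mon_nsmul, ← mon_add]
    refine congrArg mon (funext fun i => ?_)
    fin_cases i <;> simp [ini] <;> ring
  simp only [h, Fintype.sum_prod_type, Fin.sum_univ_two]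
  simp only [Fin.val_zero, Fin.val_one, pow_zero, pow_one]
  ring

end ThreeChoice

namespace ThreeChoice
open PowerSeries

theorem CT_emb (d : PowerSeries ℚ) : CT (emb d) = d := by
  have h : CT 1 = 1 := by
    rw [← mon_zero, CT_mon]
    simp
  rw [← mul_one (emb d), CT_emb_mul, h, mul_one]

theorem CT_X_pow_mul (n : ℕ) (f : LSeries) : CT (X ^ n * f) = X ^ n * CT f := by
  rw [← emb_X, ← map_pow, CT_emb_mul]

/-- The contribution of the exceptional walks whose loops do not overlap. -/
noncomputable def excBd : LSeries := 2 * U ^ 2 * (1 + U) * geo (U ^ 2) - U ^ 2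

/-- The distribution of the initial quadruples. -/
noncomputable def excIni : LSeries := U ^ 2 * (mon ![1, 1, 0, -1] * (1 + mon ![1, 0, 0, 0]) *
    (1 + mon ![0, 0, 0, 1])) * geo (U * mon ![1, 0, 0, 0]) * geo (U * mon ![0, 0, 0, -1])

/-- The series whose constant term counts the exceptional walks. -/
noncomputable def exc : LSeries := excBd + X ^ 2 * (excIni * ker)

/-- The truncated generating function of the exceptional walks. -/
noncomputable def excT (M : ℕ) : PowerSeries ℚ := ∑ p ∈ Finset.range M, ∑ r ∈ Finset.range M,
  uS ^ (p + r + 2) * ∑ ε, Phi (ini p r ε)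

theorem sum_bd (M : ℕ) : ∑ p ∈ Finset.range (M + 1), ∑ r ∈ Finset.range (M + 1),
    uS ^ (p + r + 2) * ∑ ε, bd (ini p r ε) =
    CT (2 * U ^ 2 * (1 + U) * (∑ k ∈ Finset.range (M + 1), (U ^ 2) ^ k) - U ^ 2) := by
  have h : 2 * U ^ 2 * (1 + U) * (∑ k ∈ Finset.range (M + 1), (U ^ 2) ^ k) - U ^ 2 =
      emb (2 * uS ^ 2 * (1 + uS) * (∑ k ∈ Finset.range (M + 1), (uS ^ 2) ^ k) - uS ^ 2) := by
    simp only [U, map_sub, map_mul, map_add, map_sum, map_pow, map_one, map_ofNat]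
  have e (p r : ℕ) : uS ^ (p + r + 2) * ∑ ε, bd (ini p r ε) =
      (if p = 0 then uS ^ 2 * (1 + uS) * (uS ^ 2) ^ r else 0) +
      (if r = 0 then uS ^ 2 * (1 + uS) * (uS ^ 2) ^ p else 0) -
      (if r = 0 then if p = 0 then uS ^ 2 else 0 else 0) := by
    rw [sum_bd_ini]
    by_cases hp : p = 0 <;> by_cases hr : r = 0 <;> simp [hp, hr] <;> ring
  rw [h, CT_emb]
  simp only [e, Finset.sum_add_distrib, Finset.sum_sub_distrib, Finset.sum_ite_eq', Finset.mem_range,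
    Nat.succ_pos, if_true]
  rw [Finset.sum_comm]
  simp only [Finset.sum_ite_eq', Finset.mem_range, Nat.succ_pos, if_true]
  rw [← Finset.mul_sum]
  ring

theorem sum_ini (M : ℕ) : ∑ p ∈ Finset.range M, ∑ r ∈ Finset.range M,
    uS ^ (p + r + 2) * ∑ ε, CT (mon (-ini p r ε) * ker) =
    CT (U ^ 2 * (mon ![1, 1, 0, -1] * (1 + mon ![1, 0, 0, 0]) * (1 + mon ![0, 0, 0, 1])) *
      (∑ p ∈ Finset.range M, (U * mon ![1, 0, 0, 0]) ^ p) *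
      (∑ r ∈ Finset.range M, (U * mon ![0, 0, 0, -1]) ^ r) * ker) := by
  rw [mul_assoc (U ^ 2 * _), Finset.sum_mul_sum, Finset.mul_sum, Finset.sum_mul, map_sum]
  refine Finset.sum_congr rfl fun p _ => ?_
  rw [Finset.mul_sum, Finset.sum_mul, map_sum]
  refine Finset.sum_congr rfl fun r _ => ?_
  rw [← map_sum, ← Finset.sum_mul, sum_mon_ini, ← CT_emb_mul, map_pow, ← U]
  refine congrArg CT ?_
  ring

theorem excT_sub_dvd (M : ℕ) : X ^ M ∣ excT M - CT exc := by
  rcases M with _ | M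
  · simp
  have h : excT (M + 1) = CT (2 * U ^ 2 * (1 + U) * (∑ k ∈ Finset.range (M + 1), (U ^ 2) ^ k) - U ^ 2 +
      X ^ 2 * (U ^ 2 * (mon ![1, 1, 0, -1] * (1 + mon ![1, 0, 0, 0]) * (1 + mon ![0, 0, 0, 1])) *
      (∑ p ∈ Finset.range (M + 1), (U * mon ![1, 0, 0, 0]) ^ p) *
      (∑ r ∈ Finset.range (M + 1), (U * mon ![0, 0, 0, -1]) ^ r) * ker)) := by
    rw [map_add, CT_X_pow_mul, ← sum_bd, ← sum_ini, excT]
    simp only [Phi_ini, Finset.sum_add_distrib, mul_add, Finset.mul_sum]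
    refine congrArg _ (Finset.sum_congr rfl fun p _ => Finset.sum_congr rfl fun r _ =>
      Finset.sum_congr rfl fun ε _ => ?_)
    ring
  rw [h]
  refine CT_congr ?_
  rw [exc, excBd, excIni]
  simp only [map_mul, map_add, map_sub]
  rw [md_geo (M + 1) (dvd_pow X_dvd_U two_ne_zero), md_geo (M + 1) (X_dvd_U.mul_right _),
    md_geo (M + 1) (X_dvd_U.mul_right _)]

theorem coeff_excT (l M : ℕ) : coeff l (excT M) =
    ((∑ κ ∈ Finset.HasAntidiagonal.antidiagonal l, ∑ ι ∈ Finset.HasAntidiagonal.antidiagonal κ.1,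
      ∑ p ∈ Finset.range M, ∑ r ∈ Finset.range M, v κ.2 (p + r + 2) * low ι.1 ι.2 p r : ℕ) : ℚ) := by
  have h (p r m : ℕ) : coeff m (∑ ε, Phi (ini p r ε)) =
      ∑ ι ∈ Finset.HasAntidiagonal.antidiagonal m, (low ι.1 ι.2 p r : ℚ) := by
    simp only [Phi, map_sum, coeff_mk]
    rw [Finset.sum_comm]
    refine Finset.sum_congr rfl fun ι _ => ?_
    rw [low, Nat.cast_sum]
    rfl
  have h2 (p r m : ℕ) : coeff m (uS ^ (p + r + 2)) = (v m (p + r + 2) : ℚ) := by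
    rw [← coeff_uS_pow]
    push_cast
    rfl
  simp only [excT, map_sum, mul_comm (uS ^ _), coeff_mul, h, h2]
  push_cast
  rw [Finset.sum_congr rfl fun p _ => Finset.sum_comm, Finset.sum_comm]
  refine Finset.sum_congr rfl fun κ _ => ?_
  conv_rhs => rw [Finset.sum_comm]
  refine Finset.sum_congr rfl fun p _ => ?_
  conv_rhs => rw [Finset.sum_comm]
  refine Finset.sum_congr rfl fun r _ => ?_
  rw [Finset.sum_mul]
  exact Finset.sum_congr rfl fun ι _ => mul_comm _ _

theorem ncard_excWalks {n : ℕ} (hn : 2 ≤ n) : ((excWalks n).ncard : ℚ) = coeff (n - 2) (CT exc) := by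
  rw [Set.ncard, encard_excWalks hn le_rfl, ENat.toNat_natCast, ← coeff_excT, ← sub_eq_zero, ← map_sub]
  exact X_pow_dvd_iff.1 (excT_sub_dvd n) _ (by omega)

end ThreeChoice

namespace ThreeChoice
open PowerSeries

theorem isRat_two : IsRat 2 := by
  rw [← one_add_one_eq_two]
  exact (IsPol.one.add IsPol.one).isRat

theorem isRat_mon (s : Fin 4 → ℤ) : IsRat (mon s) := (isPol_mon s).isRat

theorem isRat_geo_U_mul_mon (s : Fin 4 → ℤ) : IsRat (geo (U * mon s)) :=
  (isPol_U.isRat.mul (isRat_mon s)).geo (X_dvd_U.mul_right _)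

theorem isRat_one_add_U : IsRat (1 + U) := (IsPol.one.add isPol_U).isRat

theorem isRat_ker : IsRat ker := by
  refine IsRat.sum _ fun τ _ => ?_
  have hK : IsRat (X ^ 2 * K) := (isRat_X.pow 2).mul isPol_K.isRat
  have hX : X ∣ X ^ 2 * K := (dvd_pow_self _ two_ne_zero).mul_right _
  have h := (isRat_mon (![0, 1, 2, 3] ∘ τ)).mul (((hK.geo hX).mul
    ((hK.mul (isRat_mon (![0, 0, 1, 1] ∘ τ))).geo (hX.mul_right _))).mul
    (((isRat_one_add_U.pow 2).mul ((isRat_geo_U_mul_mon (![0, 0, 0, 1] ∘ τ)).add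
      (isRat_geo_U_mul_mon (![0, 1, 1, 1] ∘ τ)))).sub IsPol.one.isRat))
  rcases Int.units_eq_one_or (Equiv.Perm.sign τ) with e | e
  · rw [e, Units.val_one, one_smul]
    exact h
  · rw [e, Units.val_neg, Units.val_one, neg_smul, one_smul]
    exact h.neg

theorem isRat_exc : IsRat exc := by
  have h1 (s : Fin 4 → ℤ) : IsRat (1 + mon s) := IsPol.one.isRat.add (isRat_mon s)
  have hU : IsRat (U ^ 2) := (isPol_U.pow 2).isRat
  refine IsRat.add (IsRat.sub ((((isRat_two.mul hU).mul isRat_one_add_U)).mul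
    (hU.geo (dvd_pow X_dvd_U two_ne_zero))) hU) ((isRat_X.pow 2).mul (IsRat.mul ?_ isRat_ker))
  exact ((hU.mul (((isRat_mon _).mul (h1 _)).mul (h1 _))).mul
    (isRat_geo_U_mul_mon _)).mul (isRat_geo_U_mul_mon _)

/-- The series whose constant term is the generating function of three-choice polygons. -/
noncomputable def total : LSeries := 1 + 2 * X + 2 * X * (U + X * Dx U) + X ^ 2 * (2 * exc)

theorem isRat_total : IsRat total :=
  ((IsPol.one.isRat.add (isRat_two.mul isRat_X)).add ((isRat_two.mul isRat_X).mul
    (isPol_U.isRat.add (isRat_X.mul isRat_Dx_U)))).add ((isRat_X.pow 2).mul (isRat_two.mul isRat_exc))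

theorem CT_total : CT total =
    1 + 2 * X + 2 * X * (uS + X * d⁄dX ℚ uS) + X ^ 2 * (2 * CT exc) := by
  have h : total = emb (1 + 2 * X + 2 * X * (uS + X * d⁄dX ℚ uS)) + X ^ 2 * (emb 2 * exc) := by
    simp only [total, map_add, map_mul, map_one, map_ofNat, emb_X, ← deriv_emb, U, Dx_apply]
  rw [h, map_add, CT_emb, CT_X_pow_mul, CT_emb_mul]

theorem threeChoicePolygonCount_eq (n : ℕ) :
    threeChoicePolygonCount n = {w | IsThreeChoicePolygon n w}.ncard := rfl

theorem threeChoicePolygonCount_zero : threeChoicePolygonCount 0 = 1 := by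
  rw [threeChoicePolygonCount_eq, Set.ncard_eq_one]
  refine ⟨fun _ => (0, 0), Set.ext fun w => ?_⟩
  rw [Set.mem_singleton_iff]
  constructor
  · intro h
    funext i
    rw [Subsingleton.elim (α := Fin 1) i 0]
    exact h.1
  · rintro rfl
    exact ⟨rfl, rfl, fun i => i.elim0, fun i => i.elim0, fun i => i.elim0⟩

theorem threeChoicePolygonCount_one : threeChoicePolygonCount 1 = 2 := by
  rw [threeChoicePolygonCount_eq, Set.ncard_eq_two]
  refine ⟨![(0, 0), (0, 1), (0, 0)], ![(0, 0), (0, -1), (0, 0)], fun h => ?_, Set.ext fun w => ?_⟩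
  · have := congrFun h 1
    simp at this
  · rw [Set.mem_insert_iff, Set.mem_singleton_iff]
    constructor
    · rintro ⟨h0, h2, hs, -, hc⟩
      change w 2 = _ at h2
      have s0 := hs 0
      have c := hc 0 1 rfl
      have e0 : walkStep (2 * 1) w 0 = w 1 - w 0 := rfl
      have e1 : walkStep (2 * 1) w 1 = w 2 - w 1 := rfl
      rw [e0, h0] at s0
      rw [e0, e1, h0, h2] at c
      rcases h : w 1 with ⟨a, b⟩
      rw [h] at s0 c
      simp only [Set.mem_insert_iff, Set.mem_singleton_iff, Prod.mk_sub_mk, Prod.mk.injEq] at s0 c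
      have hab : a = 0 ∧ (b = 1 ∨ b = -1) := by omega
      obtain ⟨rfl, rfl | rfl⟩ := hab
      · left
        funext i
        fin_cases i
        exacts [h0, h, h2]
      · right
        funext i
        fin_cases i
        exacts [h0, h, h2]
    · rintro (rfl | rfl)
      all_goals
        refine ⟨rfl, rfl, fun i => ?_, fun i j => ?_, fun i j => ?_⟩
        · fin_cases i <;> simp [walkStep]
        · fin_cases i <;> fin_cases j <;> simp
        · fin_cases i <;> fin_cases j <;> simp [walkStep]

theorem threeChoicePolygonCount_of_two_le {n : ℕ} (hn : 2 ≤ n) :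
    threeChoicePolygonCount n = 2 * n * v (n - 1) 1 + 2 * (excWalks n).ncard := by
  have hf : (excWalks n).Finite := by
    rw [← Set.encard_ne_top_iff, encard_excWalks hn le_rfl]
    exact ENat.natCast_ne_top _
  rw [threeChoicePolygonCount_eq, Set.ncard, encard_polygons hn, encard_walks hn, ← hf.cast_ncard_eq]
  exact ENat.toNat_natCast (2 * n * v (n - 1) 1 + 2 * (excWalks n).ncard)

theorem Tgf_eq : Tgf = CT total := by
  rw [CT_total]
  ext n
  rw [Tgf, coeff_mk]
  have h2 (f : PowerSeries ℚ) (m : ℕ) : coeff m (2 * f) = 2 * coeff m f := by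
    rw [← map_ofNat C, coeff_C_mul]
  rcases n with _ | _ | n
  · simp [threeChoicePolygonCount_zero]
  · rw [threeChoicePolygonCount_one, pow_two]
    simp [mul_assoc, h2, coeff_one, coeff_succ_X_mul, constantCoeff_uS, coeff_zero_eq_constantCoeff_apply]
  · rw [threeChoicePolygonCount_of_two_le (by omega)]
    have hv := coeff_uS_pow (n + 1) 1
    have he := ncard_excWalks (n := n + 2) (by omega)
    rw [pow_one, Nat.cast_one] at hv
    rw [Nat.add_sub_cancel] at he
    push_cast
    rw [hv, he, pow_two]
    simp only [mul_assoc, map_add, h2, coeff_one, coeff_succ_X_mul, coeff_X, coeff_derivative]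
    simp
    ring

end ThreeChoice

/-- `T(x)` is differentiably finite: there exist `m ≥ 0` and polynomials
`P_0, …, P_m` with rational coefficients, not all zero, such that
`Σ_{k=0}^m P_k(x)·T^{(k)}(x) = 0` as formal power series. -/
theorem Tgf_DFinite :
    ∃ (m : ℕ) (P : Fin (m + 1) → Polynomial ℚ),
      (∃ k : Fin (m + 1), P k ≠ 0) ∧
      ∑ k : Fin (m + 1),
        (P k : PowerSeries ℚ) * (PowerSeries.derivativeFun^[(k : ℕ)] Tgf) = 0 := by
  rw [ThreeChoice.Tgf_eq]
  exact ((ThreeChoice.isPol_zs (-1)).isRat.mul ThreeChoice.isRat_total).dFinite_CTR
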